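/- arXiv:2512.21873 — 4 statements merged into one kernel-verified Lean document; each statement's English description precedes it below -/
import Mathlib

section
/- Let n ≥ 2, s ∈ (0,1), and let 𝓗 be the mixed heat kernel and 𝓩(x) = ∫₀^{+∞} 𝓗(x,t) dt. Then 𝓩(x) > 0 for every x ∈ ℝⁿ \ {0}, and there exist positive constants c₃ and c₄ (depending only on n and s) such that 𝓩(x) ≥ c₃/|x|^{n+2s} if |x| > 1, and 𝓩(x) ≥ c₄/|x|^{n−2} if 0 < |x| ≤ 1. -/
open MeasureTheory Metric Set
open scoped RealInnerProductSpace
noncomputable section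

/-- The mixed heat kernel `𝓗(x,t) = ∫_{ℝⁿ} e^{-t(|ξ|² + |ξ|^{2s}) + 2πi x·ξ} dξ`. -/
def mixedHeatKernel (n : ℕ) (s : ℝ) (x : EuclideanSpace ℝ (Fin n)) (t : ℝ) : ℝ :=
  (∫ ξ : EuclideanSpace ℝ (Fin n),
    Complex.exp (-(t : ℂ) * ((‖ξ‖ ^ 2 + ‖ξ‖ ^ (2 * s) : ℝ) : ℂ)
      + 2 * (Real.pi : ℂ) * Complex.I * ((⟪x, ξ⟫ : ℝ) : ℂ))).re

/-- The fundamental solution `𝓩(x) = ∫₀^{+∞} 𝓗(x,t) dt`. -/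
def mixedZ (n : ℕ) (s : ℝ) (x : EuclideanSpace ℝ (Fin n)) : ℝ :=
  ∫ t in Ioi (0 : ℝ), mixedHeatKernel n s x t


open Filter Topology

inductive CM : (ℝ → ℝ) → Prop
  | exp (u : ℝ) (hu : 0 ≤ u) : CM (fun l => Real.exp (-(u * l)))
  | add (f g : ℝ → ℝ) : CM f → CM g → CM (fun l => f l + g l)
  | smul (c : ℝ) (hc : 0 ≤ c) (f : ℝ → ℝ) : CM f → CM (fun l => c * f l)
  | lim (F : ℕ → ℝ → ℝ) (f : ℝ → ℝ) (hF : ∀ k, CM (F k))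
      (h : ∀ l, 0 ≤ l → Tendsto (fun k => F k l) atTop (𝓝 (f l))) : CM f

lemma CM.bounds {f : ℝ → ℝ} (hf : CM f) : ∀ l, 0 ≤ l → 0 ≤ f l ∧ f l ≤ f 0 := by
  induction hf with
  | exp u hu =>
    intro l hl
    refine ⟨(Real.exp_pos _).le, ?_⟩
    simp only [Real.exp_le_exp]
    nlinarith [mul_nonneg hu hl]
  | add f g _ _ ih1 ih2 =>
    intro l hl
    have := ih1 l hl
    have := ih2 l hl
    constructor <;> linarith
  | smul c hc f _ ih =>
    intro l hl
    exact ⟨mul_nonneg hc (ih l hl).1, mul_le_mul_of_nonneg_left (ih l hl).2 hc⟩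
  | lim F f _ h ih =>
    intro l hl
    exact ⟨ge_of_tendsto' (h l hl) fun k => (ih k l hl).1,
      le_of_tendsto_of_tendsto' (h l hl) (h 0 le_rfl) fun k => (ih k l hl).2⟩

lemma CM.congr {f g : ℝ → ℝ} (hf : CM f) (h : ∀ l, 0 ≤ l → f l = g l) : CM g :=
  CM.lim (fun _ => f) g (fun _ => hf) fun l hl => by rw [h l hl]; exact tendsto_const_nhds

lemma CM.mul {f g : ℝ → ℝ} (hf : CM f) (hg : CM g) : CM (fun l => f l * g l) := by
  induction hf with
  | exp u hu =>
    induction hg with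
    | exp v hv =>
      refine (CM.exp (u + v) (add_nonneg hu hv)).congr fun l _ => ?_
      rw [← Real.exp_add]; congr 1; ring
    | add f g _ _ ih1 ih2 =>
      exact (CM.add _ _ ih1 ih2).congr fun l _ => by ring
    | smul c hc f _ ih =>
      exact (CM.smul c hc _ ih).congr fun l _ => by ring
    | lim F f _ h ih =>
      exact CM.lim _ _ ih fun l hl => (h l hl).const_mul _
  | add f g _ _ ih1 ih2 =>
    exact (CM.add _ _ ih1 ih2).congr fun l _ => by ring
  | smul c hc f _ ih =>
    exact (CM.smul c hc _ ih).congr fun l _ => by ring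
  | lim F f _ h ih =>
    exact CM.lim _ _ ih fun l hl => (h l hl).mul_const _

lemma CM.const (c : ℝ) (hc : 0 ≤ c) : CM (fun _ => c) :=
  (CM.smul c hc _ (CM.exp 0 le_rfl)).congr fun l _ => by simp

lemma CM.pow {f : ℝ → ℝ} (hf : CM f) (k : ℕ) : CM (fun l => f l ^ k) := by
  induction k with
  | zero => simpa using CM.const 1 zero_le_one
  | succ k ih => exact (CM.mul ih hf).congr fun l _ => (pow_succ _ _).symm

lemma CM.sum {F : ℕ → ℝ → ℝ} (hF : ∀ k, CM (F k)) (N : ℕ) :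
    CM (fun l => ∑ k ∈ Finset.range N, F k l) := by
  induction N with
  | zero => simpa using CM.const 0 le_rfl
  | succ k ih => exact (CM.add _ _ ih (hF k)).congr fun l _ => (Finset.sum_range_succ _ _).symm

lemma CM.series {F : ℕ → ℝ → ℝ} {f : ℝ → ℝ} (hF : ∀ k, CM (F k))
    (h : ∀ l, 0 ≤ l → HasSum (fun k => F k l) (f l)) : CM f :=
  CM.lim _ _ (CM.sum hF) fun l hl => (h l hl).tendsto_sum_nat

lemma CM.rexp {f : ℝ → ℝ} (hf : CM f) : CM (fun l => Real.exp (f l)) := by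
  refine CM.series (F := fun k l => ((k.factorial : ℝ))⁻¹ * f l ^ k)
    (fun k => CM.smul _ (by positivity) _ (hf.pow k)) fun l _ => ?_
  have := NormedSpace.expSeries_div_hasSum_exp (f l)
  rw [← Real.exp_eq_exp_ℝ] at this
  simpa [div_eq_inv_mul] using this

lemma choose_sign (s : ℝ) (hs : s ∈ Ioo (0 : ℝ) 1) (k : ℕ) :
    0 ≤ -(Ring.choose s (k + 1) * (-1) ^ (k + 1)) := by
  have key : ∀ k : ℕ, 0 ≤ -((descPochhammer ℝ (k+1)).eval s * (-1) ^ (k + 1)) := by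
    intro k
    induction k with
    | zero => simp [hs.1.le]
    | succ k ih =>
      rw [descPochhammer_succ_eval, pow_succ]
      have h1 : 0 ≤ ((k + 1 : ℕ) : ℝ) - s := by push_cast; linarith [hs.2, (Nat.cast_nonneg k : (0 : ℝ) ≤ k)]
      have := mul_nonneg ih h1
      linarith
  rw [Ring.choose_eq_smul]
  have := key k
  have e : (descPochhammer ℤ (k+1)).smeval s = (descPochhammer ℝ (k+1)).eval s := by
    clear this
    induction k with
    | zero => simp
    | succ k ih =>
      rw [descPochhammer_succ_eval, ← ih, descPochhammer_succ_right, Polynomial.smeval_mul]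
      simp [Polynomial.smeval_natCast]
  rw [e, smul_eq_mul, mul_assoc, ← mul_neg]
  positivity

lemma CM.one_sub_rpow {s : ℝ} (hs : s ∈ Ioo (0 : ℝ) 1) {p : ℝ → ℝ} (hp : CM p)
    (hp1 : ∀ l, 0 ≤ l → p l < 1) : CM (fun l => 1 - (1 - p l) ^ s) := by
  refine CM.series (F := fun k l => -(Ring.choose s (k + 1) * (-1) ^ (k + 1)) * p l ^ (k + 1))
    (fun k => CM.smul _ (choose_sign s hs k) _ (hp.pow _)) fun l hl => ?_
  have h := (Real.one_add_rpow_hasFPowerSeriesOnBall_zero (a := s)).hasSum (y := - p l) (by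
    have := (hp.bounds l hl).1
    have := hp1 l hl
    rw [← ENNReal.ofReal_one, Metric.eball_ofReal]
    simp [abs_lt]
    constructor <;> linarith)
  simp only [binomialSeries_apply] at h
  rw [← hasSum_nat_add_iff' 1] at h
  have h2 := h.neg
  have e1 : (fun k => -(Ring.choose s (k + 1) * (-1) ^ (k + 1)) * p l ^ (k + 1)) =
      fun b => -(Ring.choose s (b + 1) • (List.ofFn fun _ : Fin (b + 1) => -p l).prod) := by
    funext k
    simp only [List.ofFn_const, List.prod_replicate, smul_eq_mul, neg_pow (p l)]
    ring
  have e2 : 1 - (1 - p l) ^ s = -((1 + (0 + -p l)) ^ s -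
      ∑ i ∈ Finset.range 1, Ring.choose s i • (List.ofFn fun _ : Fin i => -p l).prod) := by
    simp [← sub_eq_add_neg]
  simp only [e1, e2]
  exact h2

lemma CM.rpow {s : ℝ} (hs : s ∈ Ioo (0 : ℝ) 1) {t : ℝ} (ht : 0 < t) :
    CM (fun l => Real.exp (-(t * l ^ s))) := by
  have hlim : Tendsto (fun k : ℕ => (1 / ((k : ℝ) + 1))) atTop (𝓝 0) :=
    tendsto_one_div_add_atTop_nhds_zero_nat
  refine CM.lim (fun k l => Real.exp (-(t * ((1 - Real.exp (-((1 / ((k : ℝ) + 1)) * (l + 1 / ((k : ℝ) + 1)))))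
    / (1 / ((k : ℝ) + 1))) ^ s))) _ (fun k => ?_) fun l hl => ?_
  · set h := (1 / ((k : ℝ) + 1)) with hh
    have hpos : 0 < h := by positivity
    have h1 : CM (fun l => Real.exp (-(h * (l + h)))) := by
      refine (CM.smul (Real.exp (-(h * h))) (Real.exp_pos _).le _ (CM.exp h hpos.le)).congr
        fun l _ => ?_
      rw [← Real.exp_add]; congr 1; ring
    have hlt : ∀ l, 0 ≤ l → Real.exp (-(h * (l + h))) < 1 := fun l hl => by
      rw [Real.exp_lt_one_iff]
      have : 0 < h * (l + h) := by positivity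
      linarith
    have h2 := h1.one_sub_rpow hs hlt
    have h3 := (CM.smul (t / h ^ s) (by positivity) _ h2).rexp
    refine (CM.smul (Real.exp (-(t / h ^ s))) (Real.exp_pos _).le _ h3).congr fun l hl => ?_
    rw [← Real.exp_add, Real.div_rpow (by linarith [hlt l hl]) hpos.le]
    congr 1
    ring
  · refine (Real.continuous_exp.tendsto _).comp ((Tendsto.const_mul t ?_).neg)
    refine ((Real.continuousAt_rpow_const l s (Or.inr hs.1.le)).tendsto).comp ?_
    -- (1 - exp(-h(l+h)))/h → l
    have hd : HasDerivAt (fun h : ℝ => 1 - Real.exp (-(h * (l + h)))) l 0 := by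
      have := ((((hasDerivAt_id (0:ℝ)).mul ((hasDerivAt_id (0:ℝ)).const_add l)).neg).exp).const_sub 1
      simpa using this
    have := hd.tendsto_slope_zero
    have h0 : Tendsto (fun k : ℕ => (1 / ((k : ℝ) + 1))) atTop (𝓝[≠] 0) :=
      tendsto_nhdsWithin_iff.2 ⟨hlim, Eventually.of_forall fun k => by
        simp; positivity⟩
    have h4 := this.comp h0
    refine h4.congr fun k => ?_
    simp [div_eq_inv_mul]

lemma CM.meas {f : ℝ → ℝ} (hf : CM f) (n : ℕ) :
    Measurable (fun ξ : EuclideanSpace ℝ (Fin n) => f (‖ξ‖ ^ 2)) := by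
  induction hf with
  | exp u hu => fun_prop
  | add f g _ _ ih1 ih2 => exact ih1.add ih2
  | smul c hc f _ ih => exact ih.const_mul c
  | lim F f _ h ih =>
    exact measurable_of_tendsto_metrizable ih (tendsto_pi_nhds.2 fun ξ => h _ (by positivity))

def gker (n : ℕ) (x : EuclideanSpace ℝ (Fin n)) (τ : ℝ) (ξ : EuclideanSpace ℝ (Fin n)) : ℂ :=
  Complex.exp (-(τ : ℂ) * (‖ξ‖ : ℂ) ^ 2 + 2 * (Real.pi : ℂ) * Complex.I * ((⟪x, ξ⟫ : ℝ) : ℂ))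

def gk (n : ℕ) (x : EuclideanSpace ℝ (Fin n)) (v : ℝ) : ℝ :=
  (Real.pi / v) ^ ((n : ℝ) / 2) * Real.exp (-(Real.pi ^ 2 * ‖x‖ ^ 2 / v))

lemma gk_nonneg (n : ℕ) (x : EuclideanSpace ℝ (Fin n)) {v : ℝ} (hv : 0 < v) : 0 ≤ gk n x v := by
  unfold gk; positivity

lemma gker_integrable (n : ℕ) (x : EuclideanSpace ℝ (Fin n)) {τ : ℝ} (hτ : 0 < τ) :
    Integrable (gker n x τ) :=
  GaussianFourier.integrable_cexp_neg_mul_sq_norm_add (b := (τ : ℂ)) (by simpa using hτ) _ x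

lemma gker_integral (n : ℕ) (x : EuclideanSpace ℝ (Fin n)) {τ : ℝ} (hτ : 0 < τ) :
    ∫ ξ, gker n x τ ξ = (gk n x τ : ℂ) := by
  have h := GaussianFourier.integral_cexp_neg_mul_sq_norm_add (b := (τ : ℂ)) (by simpa using hτ)
    (2 * (Real.pi : ℂ) * Complex.I) x
  unfold gker
  rw [h]
  have h0 : (τ : ℂ) ≠ 0 := by exact_mod_cast hτ.ne'
  unfold gk
  push_cast
  rw [Complex.ofReal_cpow (by positivity)]
  push_cast
  simp only [finrank_euclideanSpace, Fintype.card_fin]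
  congr 2
  field_simp
  ring_nf
  simp

lemma CM.gker_mul_integrable {f : ℝ → ℝ} (hf : CM f) (n : ℕ) (x : EuclideanSpace ℝ (Fin n)) {τ : ℝ}
    (hτ : 0 < τ) : Integrable (fun ξ => gker n x τ ξ * ((f (‖ξ‖ ^ 2) : ℝ) : ℂ)) := by
  refine (gker_integrable n x hτ).mul_bdd (c := f 0) ?_ (Eventually.of_forall fun ξ => ?_)
  · exact (Complex.measurable_ofReal.comp (hf.meas n)).aestronglyMeasurable
  · rw [Complex.norm_real, Real.norm_of_nonneg (hf.bounds _ (by positivity)).1]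
    exact (hf.bounds _ (by positivity)).2

/-- the functional -/
def fnl (n : ℕ) (x : EuclideanSpace ℝ (Fin n)) (τ : ℝ) (f : ℝ → ℝ) : ℝ :=
  (∫ ξ, gker n x τ ξ * ((f (‖ξ‖ ^ 2) : ℝ) : ℂ)).re

lemma fnl_exp (n : ℕ) (x : EuclideanSpace ℝ (Fin n)) {τ : ℝ} (hτ : 0 < τ) {u : ℝ} (hu : 0 ≤ u) :
    fnl n x τ (fun l => Real.exp (-(u * l))) = gk n x (τ + u) := by
  unfold fnl
  rw [← Complex.ofReal_re (gk n x (τ + u)), ← gker_integral n x (by positivity)]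
  congr 2
  funext ξ
  unfold gker
  push_cast
  rw [← Complex.exp_add]
  congr 1
  ring

lemma fnl_add (n : ℕ) (x : EuclideanSpace ℝ (Fin n)) {τ : ℝ} (hτ : 0 < τ) {f g : ℝ → ℝ}
    (hf : CM f) (hg : CM g) : fnl n x τ (fun l => f l + g l) = fnl n x τ f + fnl n x τ g := by
  unfold fnl
  rw [← Complex.add_re, ← integral_add (hf.gker_mul_integrable n x hτ) (hg.gker_mul_integrable n x hτ)]
  congr 2
  funext ξ
  push_cast
  ring

lemma fnl_smul (n : ℕ) (x : EuclideanSpace ℝ (Fin n)) {τ : ℝ} (c : ℝ) (f : ℝ → ℝ) :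
    fnl n x τ (fun l => c * f l) = c * fnl n x τ f := by
  unfold fnl
  rw [← Complex.re_ofReal_mul, ← integral_const_mul]
  congr 2
  funext ξ
  push_cast
  ring

lemma fnl_lim (n : ℕ) (x : EuclideanSpace ℝ (Fin n)) {τ : ℝ} (hτ : 0 < τ)
    {F : ℕ → ℝ → ℝ} {f : ℝ → ℝ} (hF : ∀ k, CM (F k))
    (h : ∀ l, 0 ≤ l → Tendsto (fun k => F k l) atTop (𝓝 (f l))) :
    Tendsto (fun k => fnl n x τ (F k)) atTop (𝓝 (fnl n x τ f)) := by
  obtain ⟨M, hM⟩ := (h 0 le_rfl).bddAbove_range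
  refine (Complex.continuous_re.tendsto _).comp ?_
  refine tendsto_integral_of_dominated_convergence (fun ξ => ‖gker n x τ ξ‖ * M)
    (fun k => ((hF k).gker_mul_integrable n x hτ).aestronglyMeasurable)
    ((gker_integrable n x hτ).norm.mul_const M) (fun k => Eventually.of_forall fun ξ => ?_)
    (Eventually.of_forall fun ξ => ?_)
  · rw [norm_mul]
    refine mul_le_mul_of_nonneg_left ?_ (norm_nonneg _)
    rw [Complex.norm_real, Real.norm_of_nonneg ((hF k).bounds _ (by positivity)).1]
    exact ((hF k).bounds _ (by positivity)).2.trans (hM ⟨k, rfl⟩)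
  · exact ((Complex.continuous_ofReal.tendsto _).comp (h _ (by positivity))).const_mul _

/-- positivity of the functional against exponential test functions -/
lemma fnl_test (n : ℕ) (x : EuclideanSpace ℝ (Fin n)) {τ : ℝ} (hτ : 0 < τ)
    (σ c₁ c₂ c₃ l₁ l₂ l₃ : ℝ) (h₁ : 0 ≤ l₁) (h₂ : 0 ≤ l₂) (h₃ : 0 ≤ l₃)
    (H : ∀ u, 0 ≤ u → 0 ≤ σ * gk n x (τ + u) + c₁ * Real.exp (-(u * l₁)) +
      c₂ * Real.exp (-(u * l₂)) + c₃ * Real.exp (-(u * l₃)))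
    {f : ℝ → ℝ} (hf : CM f) :
    0 ≤ σ * fnl n x τ f + c₁ * f l₁ + c₂ * f l₂ + c₃ * f l₃ := by
  induction hf with
  | exp u hu => rw [fnl_exp n x hτ hu]; exact H u hu
  | add f g hf hg ih1 ih2 => rw [fnl_add n x hτ hf hg]; linarith
  | smul c hc f _ ih => rw [fnl_smul]; have := mul_nonneg hc ih; linarith
  | lim F f hF h ih =>
    exact ge_of_tendsto' (((((fnl_lim n x hτ hF h).const_mul σ).add ((h _ h₁).const_mul c₁)).add
      ((h _ h₂).const_mul c₂)).add ((h _ h₃).const_mul c₃)) ih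

lemma heat_eq (n : ℕ) (s : ℝ) (x : EuclideanSpace ℝ (Fin n)) (t : ℝ) :
    mixedHeatKernel n s x t = fnl n x t (fun l => Real.exp (-(t * l ^ s))) := by
  unfold mixedHeatKernel fnl gker
  congr 2
  funext ξ
  have e : (‖ξ‖ ^ 2) ^ s = ‖ξ‖ ^ (2 * s) := by
    rw [← Real.rpow_natCast, ← Real.rpow_mul (norm_nonneg _)]
    norm_num
  simp only [e]
  push_cast
  rw [← Complex.exp_add]
  congr 1
  ring

lemma heat_nonneg (n : ℕ) {s : ℝ} (hs : s ∈ Ioo (0 : ℝ) 1) (x : EuclideanSpace ℝ (Fin n)) {t : ℝ}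
    (ht : 0 < t) : 0 ≤ mixedHeatKernel n s x t := by
  rw [heat_eq]
  have := fnl_test n x ht 1 0 0 0 0 0 0 le_rfl le_rfl le_rfl
    (fun u hu => by simpa using gk_nonneg n x (by positivity)) (CM.rpow hs ht)
  simpa using this

lemma gk_bdd (n : ℕ) (x : EuclideanSpace ℝ (Fin n)) (hx : x ≠ 0) :
    ∃ C, ∀ v, 0 < v → gk n x v ≤ C := by
  have hr : 0 < ‖x‖ := norm_pos_iff.2 hx
  set c := Real.pi * ‖x‖ ^ 2 with hc
  have hcpos : 0 < c := by positivity
  refine ⟨1 + n.factorial / c ^ n, fun v hv => ?_⟩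
  unfold gk
  set z := Real.pi / v with hz
  have hzpos : 0 < z := by positivity
  have e : Real.pi ^ 2 * ‖x‖ ^ 2 / v = c * z := by rw [hc, hz]; field_simp
  rw [e]
  have h1 : z ^ ((n : ℝ) / 2) ≤ 1 + z ^ n := by
    rcases le_total z 1 with h | h
    · have := Real.rpow_le_one hzpos.le h (by positivity : (0 : ℝ) ≤ (n : ℝ) / 2)
      have : 0 ≤ z ^ n := by positivity
      linarith
    · have : z ^ ((n : ℝ) / 2) ≤ z ^ (n : ℝ) :=
        Real.rpow_le_rpow_of_exponent_le h (by linarith [(Nat.cast_nonneg n : (0 : ℝ) ≤ n)])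
      rw [Real.rpow_natCast] at this
      linarith
  have h2 : (c * z) ^ n / n.factorial ≤ Real.exp (c * z) :=
    Real.pow_div_factorial_le_exp _ (by positivity) n
  have h3 : z ^ n ≤ n.factorial / c ^ n * Real.exp (c * z) := by
    have hf : (0 : ℝ) < n.factorial := by positivity
    rw [div_le_iff₀ hf, mul_pow] at h2
    rw [div_mul_eq_mul_div, le_div_iff₀ (by positivity)]
    linarith
  have h4 : 1 ≤ Real.exp (c * z) := Real.one_le_exp (by positivity)
  rw [Real.exp_neg, ← div_eq_mul_inv, div_le_iff₀ (Real.exp_pos _)]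
  linarith

lemma heat_bdd (n : ℕ) {s : ℝ} (hs : s ∈ Ioo (0 : ℝ) 1) (x : EuclideanSpace ℝ (Fin n))
    (hx : x ≠ 0) : ∃ C, ∀ t, 0 < t → mixedHeatKernel n s x t ≤ C := by
  obtain ⟨C, hC⟩ := gk_bdd n x hx
  refine ⟨C, fun t ht => ?_⟩
  rw [heat_eq]
  have := fnl_test n x ht (-1) C 0 0 0 0 0 le_rfl le_rfl le_rfl
    (fun u hu => by simpa using hC (t + u) (by positivity)) (CM.rpow hs ht)
  simpa [Real.zero_rpow hs.1.ne'] using this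

lemma exp_integrable (n : ℕ) (hn : 2 ≤ n) {s : ℝ} (hs : s ∈ Ioo (0 : ℝ) 1) :
    Integrable (fun ξ : EuclideanSpace ℝ (Fin n) => Real.exp (-‖ξ‖ ^ (2 * s))) := by
  have : Nontrivial (EuclideanSpace ℝ (Fin n)) := by
    have : Nonempty (Fin n) := ⟨⟨0, by omega⟩⟩
    infer_instance
  rw [integrable_fun_norm_addHaar volume (f := fun r : ℝ => Real.exp (-r ^ (2 * s)))]
  have h1 : (2 : ℝ) ≤ n := by exact_mod_cast hn
  have := integrableOn_rpow_mul_exp_neg_rpow (p := 2 * s) (s := (n : ℝ) - 1) (by linarith)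
    (by linarith [hs.1])
  refine this.congr_fun (fun r hr => ?_) measurableSet_Ioi
  simp only [finrank_euclideanSpace, Fintype.card_fin, smul_eq_mul]
  congr 1
  rw [← Real.rpow_natCast, Nat.cast_sub (by omega)]
  simp

lemma heat_decay (n : ℕ) (hn : 2 ≤ n) {s : ℝ} (hs : s ∈ Ioo (0 : ℝ) 1)
    (x : EuclideanSpace ℝ (Fin n)) {t : ℝ} (ht : 0 < t) :
    |mixedHeatKernel n s x t| ≤
      (∫ ξ : EuclideanSpace ℝ (Fin n), Real.exp (-‖ξ‖ ^ (2 * s))) * t ^ (-(n : ℝ) / (2 * s)) := by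
  have hs0 := hs.1
  unfold mixedHeatKernel
  refine (Complex.abs_re_le_norm _).trans ((norm_integral_le_integral_norm _).trans ?_)
  set R := t ^ (1 / (2 * s)) with hR
  have hRpos : 0 < R := by positivity
  have hRs : R ^ (2 * s) = t := by
    rw [hR, ← Real.rpow_mul ht.le]; field_simp; simp
  have h1 := Measure.integral_comp_smul_of_nonneg (volume : Measure (EuclideanSpace ℝ (Fin n)))
    (fun ξ => Real.exp (-‖ξ‖ ^ (2 * s))) R (hR := hRpos.le)
  have h2 : (R ^ Module.finrank ℝ (EuclideanSpace ℝ (Fin n)))⁻¹ = t ^ (-(n : ℝ) / (2 * s)) := by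
    rw [finrank_euclideanSpace, Fintype.card_fin, ← Real.rpow_natCast, hR, ← Real.rpow_mul ht.le,
      ← Real.rpow_neg ht.le]
    congr 1; ring
  rw [h2, smul_eq_mul] at h1
  rw [mul_comm (∫ ξ : EuclideanSpace ℝ (Fin n), Real.exp (-‖ξ‖ ^ (2 * s))), ← h1]
  refine integral_mono_of_nonneg (Eventually.of_forall fun ξ => norm_nonneg _)
    ((exp_integrable n hn hs).comp_smul hRpos.ne') (Eventually.of_forall fun ξ => ?_)
  simp only
  rw [Complex.norm_exp, norm_smul, Real.norm_of_nonneg hRpos.le,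
    Real.mul_rpow hRpos.le (norm_nonneg _), hRs]
  have e : (-(t : ℂ) * ((‖ξ‖ ^ 2 + ‖ξ‖ ^ (2 * s) : ℝ) : ℂ)
      + 2 * (Real.pi : ℂ) * Complex.I * ((⟪x, ξ⟫ : ℝ) : ℂ)).re =
      -t * (‖ξ‖ ^ 2 + ‖ξ‖ ^ (2 * s)) := by
    rw [Complex.add_re, ← Complex.ofReal_neg, ← Complex.ofReal_mul, Complex.ofReal_re]
    simp
  rw [e, Real.exp_le_exp]
  have : 0 ≤ t * ‖ξ‖ ^ 2 := by positivity
  linarith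

lemma heat_meas (n : ℕ) (s : ℝ) (x : EuclideanSpace ℝ (Fin n)) :
    Measurable (fun t => mixedHeatKernel n s x t) := by
  unfold mixedHeatKernel
  refine Complex.measurable_re.comp ?_
  refine StronglyMeasurable.measurable ?_
  refine StronglyMeasurable.integral_prod_right (f := fun (t : ℝ) (ξ : EuclideanSpace ℝ (Fin n)) =>
    Complex.exp (-(t : ℂ) * ((‖ξ‖ ^ 2 + ‖ξ‖ ^ (2 * s) : ℝ) : ℂ)
      + 2 * (Real.pi : ℂ) * Complex.I * ((⟪x, ξ⟫ : ℝ) : ℂ))) ?_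
  refine Measurable.stronglyMeasurable ?_
  unfold Function.uncurry
  fun_prop

lemma heat_integrable (n : ℕ) (hn : 2 ≤ n) {s : ℝ} (hs : s ∈ Ioo (0 : ℝ) 1)
    (x : EuclideanSpace ℝ (Fin n)) (hx : x ≠ 0) :
    IntegrableOn (fun t => mixedHeatKernel n s x t) (Ioi 0) := by
  have h1 : (2 : ℝ) ≤ n := by exact_mod_cast hn
  rw [← Ioc_union_Ioi_eq_Ioi (zero_le_one : (0 : ℝ) ≤ 1), integrableOn_union]
  constructor
  · obtain ⟨C, hC⟩ := heat_bdd n hs x hx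
    refine Measure.integrableOn_of_bounded (M := C) (by simp)
      (heat_meas n s x).aestronglyMeasurable ?_
    refine (ae_restrict_iff' measurableSet_Ioc).2 (Eventually.of_forall fun t ht => ?_)
    rw [Real.norm_of_nonneg (heat_nonneg n hs x ht.1)]
    exact hC t ht.1
  · have := integrableOn_Ioi_rpow_of_lt (a := -(n : ℝ) / (2 * s)) (by
      rw [div_lt_iff₀ (by linarith [hs.1])]; linarith [hs.2]) zero_lt_one
    refine Integrable.mono' (this.const_mul
      (∫ ξ : EuclideanSpace ℝ (Fin n), Real.exp (-‖ξ‖ ^ (2 * s)))) (heat_meas n s x).aestronglyMeasurable ?_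
    refine (ae_restrict_iff' measurableSet_Ioi).2 (Eventually.of_forall fun t ht => ?_)
    exact heat_decay n hn hs x (zero_lt_one.trans ht)

lemma Z_lower (n : ℕ) (hn : 2 ≤ n) {s : ℝ} (hs : s ∈ Ioo (0 : ℝ) 1)
    (x : EuclideanSpace ℝ (Fin n)) (hx : x ≠ 0) {a m : ℝ} (ha : 0 < a)
    (h : ∀ t, a ≤ t → t ≤ 2 * a → m ≤ mixedHeatKernel n s x t) : a * m ≤ mixedZ n s x := by
  have hi := heat_integrable n hn hs x hx
  have hsub : Icc a (2 * a) ⊆ Ioi 0 := fun t ht => ha.trans_le ht.1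
  unfold mixedZ
  calc a * m = ∫ _t in Icc a (2 * a), m := by
        rw [setIntegral_const, Real.volume_real_Icc_of_le (by linarith), smul_eq_mul]; ring
    _ ≤ ∫ t in Icc a (2 * a), mixedHeatKernel n s x t :=
        setIntegral_mono_on (integrableOn_const (by simp)) (hi.mono_set hsub) measurableSet_Icc
          fun t ht => h t ht.1 ht.2
    _ ≤ _ := setIntegral_mono_set hi
        ((ae_restrict_iff' measurableSet_Ioi).2 (Eventually.of_forall fun t ht =>
          heat_nonneg n hs x ht)) hsub.eventuallyLE

lemma gk_lower (n : ℕ) (x : EuclideanSpace ℝ (Fin n)) (hx : x ≠ 0) {K v : ℝ} (hK : 0 < K)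
    (h1 : ‖x‖ ^ 2 ≤ K * v) (h2 : v ≤ 5 * ‖x‖ ^ 2) :
    ((Real.pi / 5) ^ ((n : ℝ) / 2) * Real.exp (-(Real.pi ^ 2 * K))) * ‖x‖ ^ (-(n : ℝ)) ≤
      gk n x v := by
  have hr : 0 < ‖x‖ := norm_pos_iff.2 hx
  have hv : 0 < v := by
    by_contra hv
    push Not at hv
    have : 0 < ‖x‖ ^ 2 := by positivity
    nlinarith
  have e : ‖x‖ ^ (-(n : ℝ)) = ((‖x‖ ^ 2)⁻¹) ^ ((n : ℝ) / 2) := by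
    rw [Real.inv_rpow (by positivity), ← Real.rpow_natCast, ← Real.rpow_mul hr.le,
      ← Real.rpow_neg hr.le]
    congr 1; push_cast; ring
  rw [e, mul_right_comm, ← Real.mul_rpow (by positivity) (by positivity)]
  unfold gk
  refine mul_le_mul ?_ ?_ (Real.exp_pos _).le (by positivity)
  · refine Real.rpow_le_rpow (by positivity) ?_ (by positivity)
    rw [← div_eq_mul_inv, div_div]
    exact div_le_div_of_nonneg_left (by positivity) hv h2
  · rw [Real.exp_le_exp, neg_le_neg_iff, div_le_iff₀ hv, mul_assoc]
    exact mul_le_mul_of_nonneg_left h1 (by positivity)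

lemma heat_small (n : ℕ) {s : ℝ} (hs : s ∈ Ioo (0 : ℝ) 1) (x : EuclideanSpace ℝ (Fin n))
    (hx : x ≠ 0) (hx1 : ‖x‖ ≤ 1) {t : ℝ} (h1 : ‖x‖ ^ 2 ≤ t) (h2 : t ≤ 2 * ‖x‖ ^ 2) :
    (((Real.pi / 5) ^ ((n : ℝ) / 2) * Real.exp (-(Real.pi ^ 2 * 1))) * ‖x‖ ^ (-(n : ℝ))) *
      (Real.exp (-2) - Real.exp (-3)) ≤ mixedHeatKernel n s x t := by
  have hr : 0 < ‖x‖ := norm_pos_iff.2 hx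
  have hr2 : 0 < ‖x‖ ^ 2 := by positivity
  have ht : 0 < t := hr2.trans_le h1
  have hg := fun v h1 h2 => gk_lower n x hx (K := 1) (v := v) one_pos h1 h2
  set m := ((Real.pi / 5) ^ ((n : ℝ) / 2) * Real.exp (-(Real.pi ^ 2 * 1))) * ‖x‖ ^ (-(n : ℝ))
  have hm : 0 < m := by positivity
  rw [heat_eq]
  have key := fnl_test n x ht 1 (-m) (m * Real.exp (-3)) 0 ((‖x‖ ^ 2)⁻¹) 0 0 (by positivity)
    le_rfl le_rfl (fun u hu => by
      simp only [mul_zero, neg_zero, Real.exp_zero, mul_one, one_mul, zero_mul, add_zero]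
      rcases le_total u (3 * ‖x‖ ^ 2) with h | h
      · have := hg (t + u) (by linarith) (by linarith)
        have h3 : Real.exp (-(u * (‖x‖ ^ 2)⁻¹)) ≤ 1 := by
          rw [Real.exp_le_one_iff]
          have : 0 ≤ u * (‖x‖ ^ 2)⁻¹ := by positivity
          linarith
        have h4 : m * Real.exp (-(u * (‖x‖ ^ 2)⁻¹)) ≤ m * 1 := mul_le_mul_of_nonneg_left h3 hm.le
        have : 0 < m * Real.exp (-3) := by positivity
        linarith
      · have := gk_nonneg n x (v := t + u) (by positivity)
        have h3 : Real.exp (-(u * (‖x‖ ^ 2)⁻¹)) ≤ Real.exp (-3) := by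
          rw [Real.exp_le_exp, neg_le_neg_iff, ← div_eq_mul_inv, le_div_iff₀ hr2]
          exact h
        have h4 := mul_le_mul_of_nonneg_left h3 hm.le
        linarith) (CM.rpow hs ht)
  have h0 : Real.exp (-(t * (0 : ℝ) ^ s)) = 1 := by simp [Real.zero_rpow hs.1.ne']
  have hl : Real.exp (-2) ≤ Real.exp (-(t * ((‖x‖ ^ 2)⁻¹) ^ s)) := by
    rw [Real.exp_le_exp, neg_le_neg_iff, Real.inv_rpow hr2.le, ← div_eq_mul_inv,
      div_le_iff₀ (by positivity)]
    have : ‖x‖ ^ 2 ≤ (‖x‖ ^ 2) ^ s :=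
      Real.self_le_rpow_of_le_one hr2.le (by nlinarith) hs.2.le
    linarith
  rw [h0] at key
  have := mul_le_mul_of_nonneg_left hl hm.le
  linarith

lemma heat_large (n : ℕ) {s : ℝ} (hs : s ∈ Ioo (0 : ℝ) 1) (x : EuclideanSpace ℝ (Fin n))
    (hx1 : 1 < ‖x‖) {t : ℝ} (h1 : (‖x‖ ^ 2) ^ s ≤ t) (h2 : t ≤ 2 * (‖x‖ ^ 2) ^ s) :
    (((Real.pi / 5) ^ ((n : ℝ) / 2) * Real.exp (-(Real.pi ^ 2 * (5 : ℝ) ^ (1 / s)))) *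
      ‖x‖ ^ (-(n : ℝ))) *
      (Real.exp (-2) - Real.exp (-3) - Real.exp (-4)) ≤ mixedHeatKernel n s x t := by
  have hr : 0 < ‖x‖ := by linarith
  have hx : x ≠ 0 := norm_pos_iff.1 hr
  have hr2 : 0 < ‖x‖ ^ 2 := by positivity
  have hr2s : 0 < (‖x‖ ^ 2) ^ s := by positivity
  have ht : 0 < t := hr2s.trans_le h1
  set K := (5 : ℝ) ^ (1 / s) with hK
  have hKpos : 0 < K := by positivity
  have hKs : K ^ s = 5 := by
    rw [hK, ← Real.rpow_mul (by norm_num), one_div_mul_cancel hs.1.ne', Real.rpow_one]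
  have ht2 : t ≤ 2 * ‖x‖ ^ 2 := by
    have : (‖x‖ ^ 2) ^ s ≤ (‖x‖ ^ 2) ^ (1 : ℝ) :=
      Real.rpow_le_rpow_of_exponent_le (by nlinarith) hs.2.le
    rw [Real.rpow_one] at this
    linarith
  have hg := fun v h1 h2 => gk_lower n x hx (K := K) (v := v) hKpos h1 h2
  set m := ((Real.pi / 5) ^ ((n : ℝ) / 2) * Real.exp (-(Real.pi ^ 2 * K))) * ‖x‖ ^ (-(n : ℝ))
  have hm : 0 < m := by positivity
  rw [heat_eq]
  have key := fnl_test n x ht 1 (-m) (m * Real.exp (-3)) (m * Real.exp 1) ((‖x‖ ^ 2)⁻¹) 0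
    (K * (‖x‖ ^ 2)⁻¹) (by positivity)
    le_rfl (by positivity) (fun u hu => by
      simp only [mul_zero, neg_zero, Real.exp_zero, mul_one, one_mul]
      have h3 : Real.exp (-(u * (‖x‖ ^ 2)⁻¹)) ≤ 1 := by
        rw [Real.exp_le_one_iff]
        have : 0 ≤ u * (‖x‖ ^ 2)⁻¹ := by positivity
        linarith
      have h4 : m * Real.exp (-(u * (‖x‖ ^ 2)⁻¹)) ≤ m * 1 := mul_le_mul_of_nonneg_left h3 hm.le
      have h5 : 0 < m * Real.exp (-3) := by positivity
      have h6 : 0 < m * Real.exp 1 * Real.exp (-(u * (K * (‖x‖ ^ 2)⁻¹))) := by positivity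
      have h7 := gk_nonneg n x (v := t + u) (by positivity)
      rcases le_total u (3 * ‖x‖ ^ 2) with h | h
      · rcases le_total (‖x‖ ^ 2) (K * u) with h' | h'
        · have := hg (t + u) (by nlinarith) (by linarith)
          linarith
        · have h8 : 1 ≤ Real.exp 1 * Real.exp (-(u * (K * (‖x‖ ^ 2)⁻¹))) := by
            rw [← Real.exp_add]
            apply Real.one_le_exp
            have : u * (K * (‖x‖ ^ 2)⁻¹) ≤ 1 := by
              rw [← mul_assoc, ← div_eq_mul_inv, div_le_one hr2]; linarith
            linarith
          have := mul_le_mul_of_nonneg_left h8 hm.le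
          linarith
      · have h3 : Real.exp (-(u * (‖x‖ ^ 2)⁻¹)) ≤ Real.exp (-3) := by
          rw [Real.exp_le_exp, neg_le_neg_iff, ← div_eq_mul_inv, le_div_iff₀ hr2]
          exact h
        have h4 := mul_le_mul_of_nonneg_left h3 hm.le
        linarith) (CM.rpow hs ht)
  have h0 : Real.exp (-(t * (0 : ℝ) ^ s)) = 1 := by simp [Real.zero_rpow hs.1.ne']
  have hl : Real.exp (-2) ≤ Real.exp (-(t * ((‖x‖ ^ 2)⁻¹) ^ s)) := by
    rw [Real.exp_le_exp, neg_le_neg_iff, Real.inv_rpow hr2.le, ← div_eq_mul_inv,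
      div_le_iff₀ (by positivity)]
    exact h2
  have hb : Real.exp 1 * Real.exp (-(t * (K * (‖x‖ ^ 2)⁻¹) ^ s)) ≤ Real.exp (-4) := by
    rw [← Real.exp_add, Real.exp_le_exp, Real.mul_rpow hKpos.le (by positivity), hKs,
      Real.inv_rpow hr2.le]
    have : 1 ≤ t * ((‖x‖ ^ 2) ^ s)⁻¹ := by
      rw [← div_eq_mul_inv, le_div_iff₀ hr2s]; linarith
    linarith
  rw [h0] at key
  have h8 := mul_le_mul_of_nonneg_left hl hm.le
  have h9 := mul_le_mul_of_nonneg_left hb hm.le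
  linarith

lemma exp_num : 0 < Real.exp (-2) - Real.exp (-3) - Real.exp (-4) := by
  have h1 : (2 : ℝ) ≤ Real.exp 1 := by linarith [Real.add_one_le_exp (1 : ℝ)]
  have h3 : Real.exp (-2) = Real.exp 1 * Real.exp (-3) := by rw [← Real.exp_add]; norm_num
  have h4 : Real.exp (-3) = Real.exp 1 * Real.exp (-4) := by rw [← Real.exp_add]; norm_num
  have h5 := Real.exp_pos (-4)
  have h6 := Real.exp_pos (-3)
  nlinarith

theorem stmt1 (n : ℕ) (hn : 2 ≤ n) (s : ℝ) (hs : s ∈ Ioo (0 : ℝ) 1) :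
    (∀ x : EuclideanSpace ℝ (Fin n), x ≠ 0 → 0 < mixedZ n s x) ∧
    ∃ c₃ c₄ : ℝ, 0 < c₃ ∧ 0 < c₄ ∧
      (∀ x : EuclideanSpace ℝ (Fin n), 1 < ‖x‖ →
        c₃ / ‖x‖ ^ ((n : ℝ) + 2 * s) ≤ mixedZ n s x) ∧
      (∀ x : EuclideanSpace ℝ (Fin n), 0 < ‖x‖ → ‖x‖ ≤ 1 →
        c₄ / ‖x‖ ^ ((n : ℝ) - 2) ≤ mixedZ n s x) := by
  have main : ∃ c₃ c₄ : ℝ, 0 < c₃ ∧ 0 < c₄ ∧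
      (∀ x : EuclideanSpace ℝ (Fin n), 1 < ‖x‖ →
        c₃ / ‖x‖ ^ ((n : ℝ) + 2 * s) ≤ mixedZ n s x) ∧
      (∀ x : EuclideanSpace ℝ (Fin n), 0 < ‖x‖ → ‖x‖ ≤ 1 →
        c₄ / ‖x‖ ^ ((n : ℝ) - 2) ≤ mixedZ n s x) := by
    have hnum := exp_num
    have hnum' : 0 < Real.exp (-2) - Real.exp (-3) := by linarith [Real.exp_pos (-4)]
    refine ⟨((Real.pi / 5) ^ ((n : ℝ) / 2) * Real.exp (-(Real.pi ^ 2 * (5 : ℝ) ^ (1 / s)))) *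
        (Real.exp (-2) - Real.exp (-3) - Real.exp (-4)),
      ((Real.pi / 5) ^ ((n : ℝ) / 2) * Real.exp (-(Real.pi ^ 2 * 1))) *
        (Real.exp (-2) - Real.exp (-3)), by positivity, by positivity, ?_, ?_⟩
    · intro x hx1
      have hr : 0 < ‖x‖ := by linarith
      have h := Z_lower n hn hs x (norm_pos_iff.1 hr) (a := (‖x‖ ^ 2) ^ s) (by positivity)
        (fun t h1 h2 => heat_large n hs x hx1 h1 h2)
      refine le_trans ?_ h
      set c := ((Real.pi / 5) ^ ((n : ℝ) / 2) * Real.exp (-(Real.pi ^ 2 * (5 : ℝ) ^ (1 / s))))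
      have e1 : ‖x‖ ^ (-((n : ℝ) + 2 * s)) ≤ (‖x‖ ^ 2) ^ s * ‖x‖ ^ (-(n : ℝ)) := by
        rw [← Real.rpow_natCast, ← Real.rpow_mul hr.le, ← Real.rpow_add hr]
        apply Real.rpow_le_rpow_of_exponent_le hx1.le
        push_cast
        linarith [hs.1]
      rw [div_eq_mul_inv, ← Real.rpow_neg hr.le]
      have := mul_le_mul_of_nonneg_left e1
        (by positivity : 0 ≤ c * (Real.exp (-2) - Real.exp (-3) - Real.exp (-4)))
      linarith
    · intro x hr hx1
      have h := Z_lower n hn hs x (norm_pos_iff.1 hr) (a := ‖x‖ ^ 2) (by positivity)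
        (fun t h1 h2 => heat_small n hs x (norm_pos_iff.1 hr) hx1 h1 h2)
      refine le_trans (le_of_eq ?_) h
      have e1 : ‖x‖ ^ (-((n : ℝ) - 2)) = ‖x‖ ^ 2 * ‖x‖ ^ (-(n : ℝ)) := by
        rw [← Real.rpow_natCast, ← Real.rpow_add hr]
        congr 1
        push_cast
        ring
      rw [div_eq_mul_inv, ← Real.rpow_neg hr.le, e1]
      ring
  refine ⟨fun x hx => ?_, main⟩
  obtain ⟨c₃, c₄, h3, h4, hL, hS⟩ := main
  have hr : 0 < ‖x‖ := norm_pos_iff.2 hx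
  rcases le_or_gt ‖x‖ 1 with h | h
  · exact lt_of_lt_of_le (by positivity) (hS x hr h)
  · exact lt_of_lt_of_le (by positivity) (hL x h)
end
end

section
/- Let n ≥ 2 and s ∈ (0,1), and let 𝓗 be the mixed heat kernel and 𝓩(x) = ∫₀^{+∞} 𝓗(x,t) dt. Then for every Schwartz function φ : ℝⁿ → ℝ one has ∫_{ℝⁿ} 𝓩(x) φ(x) dx = ∫_{ℝⁿ} φ̂(ξ)/(|ξ|^{2s} + |ξ|²) dξ, where φ̂(ξ) = ∫_{ℝⁿ} e^{−2πi x·ξ} φ(x) dx is the Fourier transform of φ. In particular the Fourier transform of 𝓩 equals 1/(|ξ|^{2s} + |ξ|²) in the sense of distributions. -/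
open MeasureTheory Metric Set
open scoped RealInnerProductSpace
noncomputable section

/-- The Fourier transform `φ̂(ξ) = ∫ e^{-2πi x·ξ} φ(x) dx` of a real Schwartz function. -/
def fourierHat (n : ℕ) (φ : SchwartzMap (EuclideanSpace ℝ (Fin n)) ℝ)
    (ξ : EuclideanSpace ℝ (Fin n)) : ℂ :=
  ∫ x : EuclideanSpace ℝ (Fin n),
    Complex.exp (-2 * (Real.pi : ℂ) * Complex.I * ((⟪x, ξ⟫ : ℝ) : ℂ)) * (φ x : ℂ)


namespace MixedAux
open Filter Topology FourierTransform
open scoped NNReal Polynomial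

lemma choose_sign (s : ℝ) (hs : s ∈ Ioo (0 : ℝ) 1) (k : ℕ) :
    0 ≤ -(Ring.choose s (k+1) * (-1)^(k+1)) := by
  have hrec : ∀ k : ℕ, Ring.choose s (k+1) = Ring.choose s k * (s - k) / (k+1) := by
    intro k
    rw [Ring.choose_eq_smul, Ring.choose_eq_smul, descPochhammer_succ_right]
    simp only [Polynomial.smeval_mul, Polynomial.smeval_sub, Polynomial.smeval_X,
      Polynomial.smeval_natCast, smul_eq_mul, Nat.factorial_succ]
    push_cast
    field_simp
    simp
  induction k with
  | zero => simp [hrec]; exact hs.1.le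
  | succ k ih =>
    have e : -(Ring.choose s (k+1+1) * (-1)^(k+1+1))
      = -(Ring.choose s (k+1) * (-1)^(k+1)) * ((k + 1 - s) / (k+2)) := by
      rw [hrec (k+1)]; push_cast; field_simp; ring
    rw [e]
    apply mul_nonneg ih
    have := hs.2
    apply div_nonneg <;> [skip; positivity]
    have : (0:ℝ) ≤ k := by positivity
    linarith

/-- Coefficients. -/
def cf (s : ℝ) (k : ℕ) : ℝ := -(Ring.choose s (k+1) * (-1)^(k+1))

lemma cf_hasSum (s : ℝ) {z : ℝ} (h0 : 0 ≤ z) (h1 : z < 1) :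
    HasSum (fun k => cf s k * z^(k+1)) (1 - (1-z)^s) := by
  have := (Real.one_add_rpow_hasFPowerSeriesOnBall_zero (a := s)).hasSum
    (y := -z) (by simp [enorm_eq_nnnorm]; rw [← NNReal.coe_lt_coe]; simp [abs_of_nonneg h0, h1])
  simp only [binomialSeries_apply] at this
  rw [hasSum_nat_add_iff' 1 |>.symm] at this
  simp at this
  have h2 := this.neg
  have e : -((1 + -z)^s - 1) = 1 - (1-z)^s := by rw [← sub_eq_add_neg]; ring
  rw [e] at h2
  refine h2.congr_fun ?_
  intro k
  rw [cf, neg_pow z]; ring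

/-- The partial sums as polynomials. -/
def pN (s : ℝ) (N : ℕ) : ℝ≥0[X] :=
  ∑ k ∈ Finset.range N, Polynomial.C (cf s k).toNNReal * Polynomial.X^(k+1)

lemma pN_aeval (s : ℝ) (hs : s ∈ Ioo (0 : ℝ) 1) (N : ℕ) (z : ℝ) :
    Polynomial.aeval z (pN s N) = ∑ k ∈ Finset.range N, cf s k * z^(k+1) := by
  simp only [pN, map_sum, map_mul, Polynomial.aeval_C, map_pow, Polynomial.aeval_X]
  refine Finset.sum_congr rfl fun k _ => ?_
  congr 1
  exact Real.coe_toNNReal _ (choose_sign s hs k)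

variable {E : Type*} [NormedAddCommGroup E] [InnerProductSpace ℝ E] [FiniteDimensional ℝ E]
  [MeasurableSpace E] [BorelSpace E]

lemma gauss_int {a : ℝ} (ha : 0 < a) : Integrable (fun v : E => Real.exp (-a * ‖v‖^2)) := by
  have := (GaussianFourier.integrable_cexp_neg_mul_sq_norm_add (V := E) (b := (a:ℂ))
    (by simpa using ha) 0 0).re
  refine this.congr (ae_of_all _ fun v => ?_)
  simp only [zero_mul, add_zero]
  rw [show (-(a:ℂ) * (‖v‖:ℂ)^2) = ((-a * ‖v‖^2 : ℝ) : ℂ) by push_cast; ring, ← Complex.ofReal_exp]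
  exact Complex.ofReal_re _

/-- positive-definiteness after damping -/
def PD (a : ℝ) (F : E → ℝ) : Prop :=
  ∀ x : E, 0 ≤ (𝓕 (fun v : E => ((Real.exp (-a * ‖v‖^2) * F v : ℝ) : ℂ)) x).re

lemma pd_lim {a : ℝ} (ha : 0 < a) {C : ℝ} (F : ℕ → E → ℝ) (G : E → ℝ)
    (hm : ∀ k, Measurable (F k)) (hb : ∀ k, ∀ᵐ v, |F k v| ≤ C)
    (hl : ∀ᵐ v, Tendsto (fun k => F k v) atTop (𝓝 (G v)))
    (hF : ∀ k, PD a (F k)) : PD a G := by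
  intro x
  have : Tendsto (fun k => 𝓕 (fun v : E => ((Real.exp (-a * ‖v‖^2) * F k v : ℝ) : ℂ)) x) atTop
      (𝓝 (𝓕 (fun v : E => ((Real.exp (-a * ‖v‖^2) * G v : ℝ) : ℂ)) x)) := by
    simp only [Real.fourier_eq']
    refine tendsto_integral_of_dominated_convergence (fun v => C * Real.exp (-a * ‖v‖^2)) ?_
      ((gauss_int ha).const_mul C) ?_ ?_
    · intro k
      have := hm k
      apply Measurable.aestronglyMeasurable
      fun_prop
    · intro k
      filter_upwards [hb k] with v hv
      rw [norm_smul, Complex.norm_exp_ofReal_mul_I, one_mul, Complex.norm_real, norm_mul,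
        Real.norm_eq_abs, Real.norm_eq_abs, abs_of_pos (Real.exp_pos _), mul_comm]
      gcongr
    · filter_upwards [hl] with v hv
      refine Tendsto.const_smul ?_ _
      refine (Complex.continuous_ofReal.tendsto _).comp ?_
      exact hv.const_mul _
  have h2 := (Complex.continuous_re.tendsto _).comp this
  exact ge_of_tendsto' h2 fun k => hF k x

lemma pd_poly {a : ℝ} (ha : 0 < a) {b : ℝ} (hb : 0 ≤ b) (p : ℝ≥0[X]) :
    PD a (fun v : E => Polynomial.aeval (Real.exp (-b * ‖v‖^2)) p) := by
  intro x
  have e : (fun v : E => ((Real.exp (-a * ‖v‖^2) * Polynomial.aeval (Real.exp (-b * ‖v‖^2)) p : ℝ) : ℂ))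
    = fun v => ∑ k ∈ Finset.range (p.natDegree+1), ((p.coeff k : ℝ) : ℂ) * Complex.exp (-((a + k * b : ℝ):ℂ) * ‖v‖^2) := by
    ext v
    rw [Polynomial.aeval_eq_sum_range, Finset.mul_sum]
    push_cast
    refine Finset.sum_congr rfl fun k _ => ?_
    rw [NNReal.smul_def, smul_eq_mul]
    push_cast
    rw [mul_left_comm, ← Complex.exp_nat_mul, ← Complex.exp_add]
    congr 2
    ring
  have hpos : ∀ k : ℕ, 0 < a + k * b := fun k => by positivity
  rw [e, Real.fourier_eq']
  simp only [Finset.smul_sum]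
  rw [integral_finsetSum]
  · rw [Complex.re_sum]
    refine Finset.sum_nonneg fun k _ => ?_
    have h := fourier_gaussian_innerProductSpace (V := E) (b := ((a + k * b : ℝ):ℂ)) (by simpa using hpos k) x
    rw [Real.fourier_eq'] at h
    have hc : ∀ (c u g : ℂ), u • (c * g) = c * (u • g) := by
      intro c u g; simp only [smul_eq_mul]; ring
    simp only [hc]
    rw [integral_const_mul, h, Complex.re_ofReal_mul]
    refine mul_nonneg (NNReal.coe_nonneg _) ?_
    have : ((Real.pi : ℂ) / ((a + k * b : ℝ):ℂ)) ^ (Module.finrank ℝ E / 2 : ℂ) * Complex.exp (-Real.pi ^ 2 * ‖x‖ ^ 2 / ((a + k * b : ℝ):ℂ))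
      = (((Real.pi / (a+k*b)) ^ (Module.finrank ℝ E / 2 : ℝ) * Real.exp (-Real.pi ^ 2 * ‖x‖ ^ 2 / (a+k*b)) : ℝ) : ℂ) := by
      have := hpos k
      push_cast [Complex.ofReal_cpow (show 0 ≤ Real.pi / (a+k*b) by positivity)]
      rfl
    rw [this, Complex.ofReal_re]
    have := hpos k
    positivity
  · intro k _
    have hi : Integrable (fun v : E => ((p.coeff k : ℝ) : ℂ) * Complex.exp (-((a + k * b : ℝ):ℂ) * ‖v‖^2)) := by
      refine Integrable.const_mul ?_ _
      refine (gauss_int (E := E) (hpos k)).ofReal.congr (ae_of_all _ fun v => ?_)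
      simp
    have := (Real.fourierIntegral_convergent_iff (V := E) x).2 hi
    refine this.congr (ae_of_all _ fun v => ?_)
    simp only [Circle.smul_def, Real.fourierChar_apply]
    congr 2
    push_cast; ring

lemma pd_exp [Nontrivial E] {a : ℝ} (ha : 0 < a) {s : ℝ} (hs : s ∈ Ioo (0 : ℝ) 1) :
    PD a (fun v : E => Real.exp (-a * ‖v‖^(2*s))) := by
  have hne : ∀ᵐ v : E, v ≠ 0 := by
    rw [ae_iff]; simp
  have hz : ∀ b : ℝ, 0 < b → ∀ v : E, v ≠ 0 → Real.exp (-b * ‖v‖^2) ∈ Ico (0:ℝ) 1 := by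
    intro b hb v hv
    refine ⟨(Real.exp_pos _).le, ?_⟩
    rw [Real.exp_lt_one_iff]
    have := norm_pos_iff.2 hv
    have : 0 < b * ‖v‖^2 := by positivity
    linarith
  have hpn : ∀ N : ℕ, ∀ z ∈ Ico (0:ℝ) 1, 0 ≤ Polynomial.aeval z (pN s N) ∧ Polynomial.aeval z (pN s N) ≤ 1 - (1-z)^s := by
    intro N z hz
    rw [pN_aeval s hs]
    have hnn : ∀ k, 0 ≤ cf s k * z^(k+1) := fun k => mul_nonneg (choose_sign s hs k) (pow_nonneg hz.1 _)
    refine ⟨Finset.sum_nonneg fun k _ => hnn k, ?_⟩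
    exact sum_le_hasSum _ (fun k _ => hnn k) (cf_hasSum s hz.1 hz.2)
  have hpn1 : ∀ N : ℕ, ∀ z ∈ Ico (0:ℝ) 1, Polynomial.aeval z (pN s N) ≤ 1 := by
    intro N z hz
    have := (hpn N z hz).2
    have h2 : 0 ≤ (1-z)^s := Real.rpow_nonneg (by linarith [hz.2]) _
    linarith
  -- step 1
  have step1 : ∀ M : ℝ, 0 ≤ M → ∀ b : ℝ, 0 < b → ∀ N : ℕ,
      PD a (fun v : E => Real.exp (-M) * Real.exp (M * Polynomial.aeval (Real.exp (-b * ‖v‖^2)) (pN s N))) := by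
    intro M hM b hb N
    refine pd_lim ha (C := 1) (fun m v => Real.exp (-M) * (1 + (M * Polynomial.aeval (Real.exp (-b * ‖v‖^2)) (pN s N)) / m)^m) _ ?_ ?_ ?_ ?_
    · intro m
      simp only [pN_aeval s hs]
      fun_prop
    · intro m
      filter_upwards [hne] with v hv
      have h0 := (hpn N _ (hz b hb v hv)).1
      have h1 := hpn1 N _ (hz b hb v hv)
      set q := Polynomial.aeval (Real.exp (-b * ‖v‖^2)) (pN s N)
      rw [abs_of_nonneg (by positivity)]
      calc Real.exp (-M) * (1 + M * q / m)^m ≤ Real.exp (-M) * Real.exp (M * q / m) ^ m := by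
            gcongr
            linarith [Real.add_one_le_exp (M * q / m)]
        _ ≤ Real.exp (-M) * Real.exp M := by
            gcongr
            rw [← Real.exp_nat_mul]
            apply Real.exp_le_exp.2
            rcases Nat.eq_zero_or_pos m with rfl | hm
            · simpa using hM
            · have : (0:ℝ) < m := by exact_mod_cast hm
              rw [mul_div_cancel₀ _ this.ne']
              nlinarith
        _ = 1 := by rw [← Real.exp_add]; simp
    · refine ae_of_all _ fun v => ?_
      exact (Real.tendsto_one_add_div_pow_exp _).const_mul _
    · intro m
      have := pd_poly (E := E) ha hb.le (Polynomial.C (Real.exp (-M)).toNNReal * (1 + Polynomial.C (M / m).toNNReal * pN s N)^m)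
      simp only [map_mul, map_pow, map_add, map_one, Polynomial.aeval_C] at this
      convert this using 3 with v
      · exact (Real.coe_toNNReal _ (Real.exp_pos _).le).symm
      · congr 2
        have : algebraMap ℝ≥0 ℝ (M/m).toNNReal = M / m := Real.coe_toNNReal _ (by positivity)
        rw [this]; ring
  have step2 : ∀ M : ℝ, 0 ≤ M → ∀ b : ℝ, 0 < b →
      PD a (fun v : E => Real.exp (-M * (1 - Real.exp (-b * ‖v‖^2))^s)) := by
    intro M hM b hb
    refine pd_lim ha (C := 1) _ _ ?_ ?_ ?_ (step1 M hM b hb)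
    · intro m
      simp only [pN_aeval s hs]
      fun_prop
    · intro N
      filter_upwards [hne] with v hv
      have h1 := hpn1 N _ (hz b hb v hv)
      rw [abs_of_nonneg (by positivity), ← Real.exp_add]
      apply Real.exp_le_one_iff.2
      nlinarith
    · filter_upwards [hne] with v hv
      have hzz := hz b hb v hv
      have := (cf_hasSum s hzz.1 hzz.2).tendsto_sum_nat
      simp only [← pN_aeval s hs] at this
      have h2 := ((Real.continuous_exp.tendsto _).comp (this.const_mul M)).const_mul (Real.exp (-M))
      have e : Real.exp (-M * (1 - Real.exp (-b * ‖v‖^2))^s) =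
          Real.exp (-M) * Real.exp (M * (1 - (1 - Real.exp (-b * ‖v‖ ^ 2)) ^ s)) := by
        rw [← Real.exp_add]
        congr 1; ring
      rw [e]
      exact h2
  refine pd_lim ha (C := 1) (fun m v => Real.exp (-(a * ((m+1 : ℕ):ℝ)^s) * (1 - Real.exp (-(1/((m+1 : ℕ):ℝ)) * ‖v‖^2))^s)) _ ?_ ?_ ?_ ?_
  · intro m; fun_prop
  · intro m
    filter_upwards [hne] with v hv
    have hzz := hz (1/((m+1 : ℕ):ℝ)) (by positivity) v hv
    rw [abs_of_nonneg (Real.exp_pos _).le]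
    apply Real.exp_le_one_iff.2
    have h2 : 0 ≤ (1-Real.exp (-(1/((m+1 : ℕ):ℝ)) * ‖v‖^2))^s := Real.rpow_nonneg (by linarith [hzz.2]) _
    have : 0 ≤ a * ((m+1 : ℕ):ℝ)^s := by positivity
    nlinarith
  · filter_upwards [hne] with v hv
    refine (Real.continuous_exp.tendsto _).comp ?_
    have key : Tendsto (fun m : ℕ => (((m+1 : ℕ):ℝ) * (1 - Real.exp (-(1/((m+1 : ℕ):ℝ)) * ‖v‖^2)))) atTop (𝓝 (‖v‖^2)) := by
      have hd : HasDerivAt (fun u : ℝ => -Real.exp (-u * ‖v‖^2)) (‖v‖^2) 0 := by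
        have := (((hasDerivAt_id (0:ℝ)).neg.mul_const (‖v‖^2)).exp).neg
        convert! this using 1
        simp
      have h1 := hd.tendsto_slope
      have h2 : Tendsto (fun m : ℕ => 1 / ((m+1 : ℕ):ℝ)) atTop (𝓝[≠] 0) := by
        refine tendsto_nhdsWithin_iff.2 ⟨?_, Eventually.of_forall fun m => ?_⟩
        · exact (tendsto_one_div_atTop_nhds_zero_nat (𝕜 := ℝ)).comp (tendsto_add_atTop_nat 1)
        · simp; positivity
      refine (h1.comp h2).congr fun m => ?_
      simp [slope_def_field]
      ring
    have k2 := ((Real.continuousAt_rpow_const (‖v‖^2) s (Or.inr hs.1.le)).tendsto.comp key).const_mul (-a)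
    convert k2 using 2 with m
    · have hzz := hz (1/((m+1 : ℕ):ℝ)) (by positivity) v hv
      simp only [Function.comp]
      rw [Real.mul_rpow (by positivity) (by linarith [hzz.2])]
      ring
    · rw [Real.rpow_mul (norm_nonneg _)]; norm_num
  · intro m
    exact step2 _ (by positivity) _ (by positivity)

set_option linter.unusedSectionVars false

/-- the symbol -/
def hk (s t : ℝ) (v : E) : ℝ := Real.exp (-t * ‖v‖^2) * Real.exp (-t * ‖v‖^(2*s))

lemma hk_nonneg (s t : ℝ) (v : E) : 0 ≤ hk s t v := by unfold hk; positivity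

lemma hk_le_gauss {s t : ℝ} (ht : 0 < t) (v : E) : hk s t v ≤ Real.exp (-t * ‖v‖^2) := by
  unfold hk
  have : Real.exp (-t * ‖v‖^(2*s)) ≤ 1 := by
    apply Real.exp_le_one_iff.2
    have : 0 ≤ t * ‖v‖^(2*s) := by positivity
    linarith
  exact mul_le_of_le_one_right (Real.exp_pos _).le this

lemma hk_le_one {s t : ℝ} (ht : 0 < t) (v : E) : hk s t v ≤ 1 := by
  refine (hk_le_gauss ht v).trans ?_
  apply Real.exp_le_one_iff.2
  have : 0 ≤ t * ‖v‖^2 := by positivity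
  linarith

lemma hk_int {s t : ℝ} (ht : 0 < t) : Integrable (fun v : E => hk s t v) := by
  refine (gauss_int ht).mono' ?_ (ae_of_all _ fun v => ?_)
  · apply Measurable.aestronglyMeasurable
    unfold hk
    fun_prop
  · rw [Real.norm_eq_abs, abs_of_nonneg (hk_nonneg _ _ _)]
    exact hk_le_gauss ht v

lemma hk_intC {s t : ℝ} (ht : 0 < t) : Integrable (fun v : E => ((hk s t v : ℝ) : ℂ)) :=
  (hk_int ht).ofReal

lemma fourier_adj {f g : E → ℂ} (hf : Integrable f) (hg : Integrable g) :
    ∫ x, 𝓕 f x * g x = ∫ x, f x * 𝓕 g x := by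
  simpa using! VectorFourier.integral_bilin_fourierIntegral_eq_flip (.mul ℂ ℂ) (L := innerₗ E)
    Real.continuous_fourierChar continuous_inner hf hg

lemma H_eq (n : ℕ) (s t : ℝ) (x : EuclideanSpace ℝ (Fin n)) :
    ((mixedHeatKernel n s x t : ℝ) : ℂ) = 𝓕 (fun v : EuclideanSpace ℝ (Fin n) => ((hk s t v : ℝ) : ℂ)) x := by
  have e1 : 𝓕 (fun v : EuclideanSpace ℝ (Fin n) => ((hk s t v : ℝ) : ℂ)) x =
      ∫ ξ : EuclideanSpace ℝ (Fin n),
    Complex.exp (-(t : ℂ) * ((‖ξ‖ ^ 2 + ‖ξ‖ ^ (2 * s) : ℝ) : ℂ)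
      + 2 * (Real.pi : ℂ) * Complex.I * ((⟪x, ξ⟫ : ℝ) : ℂ)) := by
    rw [Real.fourier_eq', ← integral_neg_eq_self]
    refine integral_congr_ae (ae_of_all _ fun v => ?_)
    simp only [hk, norm_neg, inner_neg_left, smul_eq_mul, real_inner_comm x v]
    push_cast
    rw [← Complex.exp_add, ← Complex.exp_add]
    congr 1
    ring
  have e2 : (starRingEnd ℂ) (𝓕 (fun v : EuclideanSpace ℝ (Fin n) => ((hk s t v : ℝ) : ℂ)) x)
      = 𝓕 (fun v : EuclideanSpace ℝ (Fin n) => ((hk s t v : ℝ) : ℂ)) x := by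
    rw [Real.fourier_eq', ← integral_conj, ← integral_neg_eq_self]
    refine integral_congr_ae (ae_of_all _ fun v => ?_)
    simp only [hk, norm_neg, inner_neg_left, smul_eq_mul, map_mul, Complex.conj_ofReal,
      ← Complex.exp_conj, Complex.conj_I]
    congr 2
    push_cast
    ring
  rw [mixedHeatKernel, ← e1]
  exact Complex.conj_eq_iff_re.1 e2

lemma H_nonneg (n : ℕ) (hn : 2 ≤ n) (s : ℝ) (hs : s ∈ Ioo (0 : ℝ) 1) {t : ℝ} (ht : 0 < t)
    (x : EuclideanSpace ℝ (Fin n)) : 0 ≤ mixedHeatKernel n s x t := by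
  have : Nonempty (Fin n) := ⟨⟨0, by omega⟩⟩
  have := pd_exp (E := EuclideanSpace ℝ (Fin n)) ht hs x
  have h2 := congrArg Complex.re (H_eq n s t x)
  rw [Complex.ofReal_re] at h2
  rw [h2]
  exact this

lemma H_le (n : ℕ) (s t : ℝ) (x : EuclideanSpace ℝ (Fin n)) :
    |mixedHeatKernel n s x t| ≤ ∫ v : EuclideanSpace ℝ (Fin n), hk s t v := by
  have : ‖((mixedHeatKernel n s x t : ℝ) : ℂ)‖ ≤ ∫ v : EuclideanSpace ℝ (Fin n), ‖((hk s t v : ℝ) : ℂ)‖ := by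
    rw [H_eq]
    exact VectorFourier.norm_fourierIntegral_le_integral_norm _ _ _ _ _
  rw [Complex.norm_real, Real.norm_eq_abs] at this
  refine this.trans_eq ?_
  refine integral_congr_ae (ae_of_all _ fun v => ?_)
  simp only [Complex.norm_real, Real.norm_eq_abs, abs_of_nonneg (hk_nonneg _ _ _)]

lemma H_meas (n : ℕ) (s : ℝ) :
    Measurable (fun p : EuclideanSpace ℝ (Fin n) × ℝ => mixedHeatKernel n s p.1 p.2) := by
  unfold mixedHeatKernel
  refine Complex.measurable_re.comp ?_
  refine (StronglyMeasurable.integral_prod_right ?_).measurable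
  apply Measurable.stronglyMeasurable
  unfold Function.uncurry
  fun_prop

lemma H_L1 (n : ℕ) (hn : 2 ≤ n) (s : ℝ) (hs : s ∈ Ioo (0 : ℝ) 1) {t : ℝ} (ht : 0 < t) :
    ∫⁻ x : EuclideanSpace ℝ (Fin n), ENNReal.ofReal (mixedHeatKernel n s x t) ≤ 1 := by
  have hmeas : Measurable (fun x : EuclideanSpace ℝ (Fin n) => mixedHeatKernel n s x t) :=
    (H_meas n s).comp (measurable_id.prodMk measurable_const)
  have key : ∀ b : ℝ, 0 < b → ∫⁻ x : EuclideanSpace ℝ (Fin n),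
      ENNReal.ofReal (mixedHeatKernel n s x t * Real.exp (-b * ‖x‖^2)) ≤ 1 := by
    intro b hb
    have hi : Integrable (fun x : EuclideanSpace ℝ (Fin n) => mixedHeatKernel n s x t * Real.exp (-b * ‖x‖^2)) := by
      refine (gauss_int hb).bdd_mul (c := ∫ v : EuclideanSpace ℝ (Fin n), hk s t v) hmeas.aestronglyMeasurable (ae_of_all _ fun x => ?_)
      exact H_le n s t x
    rw [← ofReal_integral_eq_lintegral_ofReal hi (ae_of_all _ fun x => mul_nonneg (H_nonneg n hn s hs ht x) (Real.exp_pos _).le)]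
    rw [ENNReal.ofReal_le_one]
    have e1 : ((∫ x : EuclideanSpace ℝ (Fin n), mixedHeatKernel n s x t * Real.exp (-b * ‖x‖^2) : ℝ) : ℂ)
        = ∫ v : EuclideanSpace ℝ (Fin n), ((hk s t v : ℝ) : ℂ) * 𝓕 (fun v : EuclideanSpace ℝ (Fin n) => Complex.exp (-(b:ℂ) * ‖v‖^2)) v := by
      rw [← integral_complex_ofReal, ← fourier_adj (hk_intC ht)]
      · refine integral_congr_ae (ae_of_all _ fun v => ?_)
        simp only [← H_eq]
        push_cast
        rfl
      · refine (gauss_int hb).ofReal.congr (ae_of_all _ fun v => ?_)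
        simp
    have hg : ∀ w : EuclideanSpace ℝ (Fin n), 𝓕 (fun v : EuclideanSpace ℝ (Fin n) => Complex.exp (-(b:ℂ) * ‖v‖^2)) w =
       (((Real.pi / b) ^ (Module.finrank ℝ (EuclideanSpace ℝ (Fin n)) / 2 : ℝ) * Real.exp (-(Real.pi^2/b) * ‖w‖ ^ 2) : ℝ) : ℂ) := by
      intro w
      rw [fourier_gaussian_innerProductSpace (by simpa using hb)]
      push_cast [Complex.ofReal_cpow (show 0 ≤ Real.pi / b by positivity)]
      congr 2
      ring
    simp only [hg, ← Complex.ofReal_mul] at e1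
    rw [integral_complex_ofReal, Complex.ofReal_inj] at e1
    rw [e1]
    have hb' : 0 < Real.pi^2/b := by positivity
    calc _ ≤ ∫ w : EuclideanSpace ℝ (Fin n), (Real.pi / b) ^ (Module.finrank ℝ (EuclideanSpace ℝ (Fin n)) / 2 : ℝ) * Real.exp (-(Real.pi^2/b) * ‖w‖ ^ 2) := by
            refine integral_mono_of_nonneg (ae_of_all _ fun w => ?_) ((gauss_int hb').const_mul _) (ae_of_all _ fun w => ?_)
            · exact mul_nonneg (hk_nonneg _ _ _) (by positivity)
            · exact mul_le_of_le_one_left (by positivity) (hk_le_one ht w)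
      _ = 1 := by
        rw [integral_const_mul, GaussianFourier.integral_rexp_neg_mul_sq_norm hb', ← Real.mul_rpow (by positivity) (by positivity)]
        have : Real.pi / b * (Real.pi / (Real.pi^2/b)) = 1 := by
          have := Real.pi_pos
          field_simp
        rw [this, Real.one_rpow]
  have hlim : ∀ x : EuclideanSpace ℝ (Fin n), liminf (fun m : ℕ => ENNReal.ofReal (mixedHeatKernel n s x t * Real.exp (-(1/((m:ℝ)+1)) * ‖x‖^2))) atTop
      = ENNReal.ofReal (mixedHeatKernel n s x t) := by
    intro x
    refine Tendsto.liminf_eq ?_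
    refine ENNReal.tendsto_ofReal ?_
    have h1 := (tendsto_one_div_add_atTop_nhds_zero_nat (𝕜 := ℝ)).neg.mul_const (‖x‖^2)
    have h2 := ((Real.continuous_exp.tendsto _).comp h1).const_mul (mixedHeatKernel n s x t)
    simpa using! h2
  calc _ = ∫⁻ x : EuclideanSpace ℝ (Fin n), liminf (fun m : ℕ => ENNReal.ofReal (mixedHeatKernel n s x t * Real.exp (-(1/((m:ℝ)+1)) * ‖x‖^2))) atTop := by
        simp only [hlim]
    _ ≤ liminf (fun m : ℕ => ∫⁻ x : EuclideanSpace ℝ (Fin n), ENNReal.ofReal (mixedHeatKernel n s x t * Real.exp (-(1/((m:ℝ)+1)) * ‖x‖^2))) atTop := by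
        refine lintegral_liminf_le fun m => ?_
        fun_prop
    _ ≤ liminf (fun m : ℕ => (1 : ENNReal)) atTop := by
        refine liminf_le_liminf (Eventually.of_forall fun m => ?_)
        exact key _ (by positivity)
    _ = 1 := by simp

lemma div_int [Nontrivial E] (hd : 2 ≤ Module.finrank ℝ E) {s : ℝ} (hs : s ∈ Ioo (0 : ℝ) 1) {F : E → ℝ} (hF : Measurable F)
    (hle : ∀ v, ‖v‖^(2*s) ≤ F v) {g : E → ℂ} (hg : Integrable g) {C : ℝ} (hC : ∀ v, ‖g v‖ ≤ C) :
    Integrable (fun v => ‖g v‖ / F v) := by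
  have hne : ∀ᵐ v : E, v ≠ 0 := by
    rw [ae_iff]; simp
  have hF0 : ∀ v, 0 ≤ F v := fun v => le_trans (by positivity) (hle v)
  have hm : AEStronglyMeasurable (fun v => ‖g v‖ / F v) volume :=
    (hg.1.norm.aemeasurable.div hF.aemeasurable).aestronglyMeasurable
  rw [← integrableOn_univ, ← union_compl_self (ball (0:E) 1)]
  refine IntegrableOn.union ?_ ?_
  · refine integrableOn_ball_of_norm_le_rpow (α := 2*s) (C := C) (by omega) ?_ (ae_restrict_of_ae (hne.mono fun v hv => ?_)) hm
    · have : (2:ℝ) ≤ Module.finrank ℝ E := by exact_mod_cast hd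
      linarith [hs.2]
    · rw [Real.norm_eq_abs, abs_of_nonneg (div_nonneg (norm_nonneg _) (hF0 v)), Real.rpow_neg (norm_nonneg _), ← div_eq_mul_inv]
      have : 0 < ‖v‖^(2*s) := Real.rpow_pos_of_pos (norm_pos_iff.2 hv) _
      have hgC := (norm_nonneg _).trans (hC v)
      exact div_le_div₀ hgC (hC v) this (hle v)
  · refine Integrable.mono' hg.norm.integrableOn hm.restrict ?_
    refine (ae_restrict_iff' measurableSet_ball.compl).2 (ae_of_all _ fun v hv => ?_)
    rw [Real.norm_eq_abs, abs_of_nonneg (div_nonneg (norm_nonneg _) (hF0 v))]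
    have h1 : 1 ≤ ‖v‖ := by simpa using hv
    have h2 : 1 ≤ F v := (Real.one_le_rpow h1 (by linarith [hs.1])).trans (hle v)
    exact div_le_self (norm_nonneg _) h2

lemma exp_int {c : ℝ} (hc : 0 < c) : ∫ t in Ioi (0:ℝ), Real.exp (-t * c) = 1 / c := by
  have := integral_exp_mul_Ioi (a := -c) (by linarith) 0
  simp only [mul_zero, Real.exp_zero] at this
  rw [neg_div_neg_eq] at this
  rw [← this]
  congr 1; ext t; congr 1; ring

lemma tonelli_int [Nontrivial E] (hd : 2 ≤ Module.finrank ℝ E) {s : ℝ} (hs : s ∈ Ioo (0 : ℝ) 1) {F : E → ℝ} (hF : Measurable F)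
    (hle : ∀ v, ‖v‖^(2*s) ≤ F v) {g : E → ℂ} (hgm : Measurable g) (hg : Integrable g) {C : ℝ} (hC : ∀ v, ‖g v‖ ≤ C) :
    Integrable (fun p : E × ℝ => g p.1 * ((Real.exp (-p.2 * F p.1) : ℝ) : ℂ))
      ((volume : Measure E).prod (volume.restrict (Ioi (0:ℝ)))) := by
  have hne : ∀ᵐ v : E, v ≠ 0 := by
    rw [ae_iff]; simp
  have hFp : ∀ v, v ≠ 0 → 0 < F v := fun v hv =>
    lt_of_lt_of_le (Real.rpow_pos_of_pos (norm_pos_iff.2 hv) _) (hle v)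
  rw [integrable_prod_iff]
  · constructor
    · filter_upwards [hne] with v hv
      refine Integrable.const_mul ?_ _
      refine Integrable.ofReal ?_
      refine (exp_neg_integrableOn_Ioi 0 (hFp v hv)).congr (ae_of_all _ fun t => ?_)
      simp only; congr 1; ring
    · refine (div_int hd hs hF hle hg hC).congr ?_
      filter_upwards [hne] with v hv
      simp only [norm_mul, Complex.norm_real, Real.norm_eq_abs, Real.abs_exp]
      rw [integral_const_mul, exp_int (hFp v hv)]
      ring
  · apply Measurable.aestronglyMeasurable
    fun_prop

lemma joint_int (n : ℕ) (hn : 2 ≤ n) (s : ℝ) (hs : s ∈ Ioo (0 : ℝ) 1)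
    (φ : SchwartzMap (EuclideanSpace ℝ (Fin n)) ℝ) :
    Integrable (fun p : EuclideanSpace ℝ (Fin n) × ℝ => mixedHeatKernel n s p.1 p.2 * φ p.1)
      ((volume : Measure (EuclideanSpace ℝ (Fin n))).prod (volume.restrict (Ioi (0:ℝ)))) := by
  have : Nonempty (Fin n) := ⟨⟨0, by omega⟩⟩
  have hφm : Measurable φ := φ.continuous.measurable
  have hmeas : Measurable (fun p : EuclideanSpace ℝ (Fin n) × ℝ => mixedHeatKernel n s p.1 p.2 * φ p.1) :=
    (H_meas n s).mul (hφm.comp measurable_fst)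
  have hHm : ∀ t, Measurable (fun x : EuclideanSpace ℝ (Fin n) => mixedHeatKernel n s x t) := fun t =>
    (H_meas n s).comp (measurable_id.prodMk measurable_const)
  obtain ⟨C, hC⟩ : ∃ C, ∀ x, ‖φ x‖ ≤ C := ⟨_, SchwartzMap.norm_le_seminorm ℝ φ⟩
  have hC0 : 0 ≤ C := (norm_nonneg _).trans (hC 0)
  rw [integrable_prod_iff' hmeas.aestronglyMeasurable]
  constructor
  · refine (ae_restrict_iff' measurableSet_Ioi).2 (ae_of_all _ fun t ht => ?_)
    exact φ.integrable.bdd_mul (hHm t).aestronglyMeasurable (ae_of_all _ fun x => H_le n s t x)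
  · have hT := (tonelli_int (E := EuclideanSpace ℝ (Fin n)) (by simpa using hn) hs
      (F := fun v => ‖v‖^(2*s)) (by fun_prop) (fun v => le_rfl)
      (g := fun v => ((Real.exp (-1 * ‖v‖^2) : ℝ) : ℂ)) (by fun_prop) (gauss_int one_pos).ofReal
      (C := 1) (fun v => by
        rw [Complex.norm_real, Real.norm_eq_abs, Real.abs_exp]
        apply Real.exp_le_one_iff.2
        have : 0 ≤ ‖v‖^2 := by positivity
        linarith)).norm.integral_prod_right
    simp only [← Complex.ofReal_mul, Complex.norm_real, Real.norm_eq_abs, abs_mul, Real.abs_exp] at hT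
    have hB : Integrable (fun t : ℝ => (Ioc (0:ℝ) 1).indicator (fun _ => C) t +
       (∫ v : EuclideanSpace ℝ (Fin n), Real.exp (-1 * ‖v‖^2) * Real.exp (-t * ‖v‖^(2*s))) * ∫ x, ‖φ x‖)
       (volume.restrict (Ioi (0:ℝ))) := by
      refine Integrable.add ?_ (hT.mul_const _)
      refine Integrable.restrict ?_
      rw [integrable_indicator_iff measurableSet_Ioc]
      exact integrableOn_const (by simp)
    refine hB.mono' ?_ ?_
    · exact (hmeas.norm.stronglyMeasurable.integral_prod_left').aestronglyMeasurable
    refine (ae_restrict_iff' measurableSet_Ioi).2 (ae_of_all _ fun t ht => ?_)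
    have ht0 : 0 < t := ht
    have hN0 : 0 ≤ (∫ v : EuclideanSpace ℝ (Fin n), Real.exp (-1 * ‖v‖^2) * Real.exp (-t * ‖v‖^(2*s))) * ∫ x, ‖φ x‖ :=
      mul_nonneg (integral_nonneg fun v => by positivity) (integral_nonneg fun v => by positivity)
    rw [Real.norm_eq_abs, abs_of_nonneg (integral_nonneg fun x => norm_nonneg _)]
    by_cases h1 : t ≤ 1
    · rw [indicator_of_mem (show t ∈ Ioc (0:ℝ) 1 from ⟨ht0, h1⟩)]
      refine le_trans ?_ (le_add_of_nonneg_right hN0)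
      have hHi : Integrable (fun x : EuclideanSpace ℝ (Fin n) => mixedHeatKernel n s x t) := by
        refine ⟨(hHm t).aestronglyMeasurable, ?_⟩
        rw [hasFiniteIntegral_iff_ofReal (ae_of_all _ fun x => H_nonneg n hn s hs ht0 x)]
        exact (H_L1 n hn s hs ht0).trans_lt ENNReal.one_lt_top
      have hH1 : ∫ x : EuclideanSpace ℝ (Fin n), mixedHeatKernel n s x t ≤ 1 := by
        rw [← ENNReal.ofReal_le_one, ofReal_integral_eq_lintegral_ofReal hHi (ae_of_all _ fun x => H_nonneg n hn s hs ht0 x)]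
        exact H_L1 n hn s hs ht0
      calc ∫ x, ‖mixedHeatKernel n s x t * φ x‖ ≤ ∫ x, mixedHeatKernel n s x t * C := by
            refine integral_mono_of_nonneg (ae_of_all _ fun x => norm_nonneg _) (hHi.mul_const _) (ae_of_all _ fun x => ?_)
            have h0 := H_nonneg n hn s hs ht0 x
            simp only [norm_mul]
            rw [Real.norm_of_nonneg h0]
            exact mul_le_mul_of_nonneg_left (hC x) h0
        _ ≤ C := by
            rw [integral_mul_const]
            exact mul_le_of_le_one_left hC0 hH1
    · rw [indicator_of_notMem (fun h => h1 h.2), zero_add, ← integral_const_mul]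
      refine integral_mono_of_nonneg (ae_of_all _ fun x => norm_nonneg _) (φ.integrable.norm.const_mul _) (ae_of_all _ fun x => ?_)
      simp only [norm_mul]
      refine mul_le_mul_of_nonneg_right ?_ (norm_nonneg _)
      refine (H_le n s t x).trans ?_
      push Not at h1
      refine integral_mono_of_nonneg (ae_of_all _ fun v => hk_nonneg _ _ _) ?_ (ae_of_all _ fun v => ?_)
      · refine (gauss_int one_pos).mul_bdd (c := 1) (Measurable.aestronglyMeasurable (by fun_prop)) (ae_of_all _ fun v => ?_)
        rw [Real.norm_eq_abs, Real.abs_exp]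
        apply Real.exp_le_one_iff.2
        have : 0 ≤ t * ‖v‖^(2*s) := by positivity
        linarith
      · refine mul_le_mul_of_nonneg_right ?_ (Real.exp_pos _).le
        apply Real.exp_le_exp.2
        have : 0 ≤ ‖v‖^2 := by positivity
        nlinarith

end MixedAux

open MixedAux FourierTransform in
/-- The Fourier transform of `𝓩` is `1/(|ξ|^{2s} + |ξ|²)` in the sense of distributions:
for every Schwartz `φ`, `∫ 𝓩(x) φ(x) dx = ∫ φ̂(ξ)/(|ξ|^{2s} + |ξ|²) dξ`. -/
theorem stmt3 (n : ℕ) (hn : 2 ≤ n) (s : ℝ) (hs : s ∈ Ioo (0 : ℝ) 1)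
    (φ : SchwartzMap (EuclideanSpace ℝ (Fin n)) ℝ) :
    ((∫ x : EuclideanSpace ℝ (Fin n), mixedZ n s x * φ x : ℝ) : ℂ)
      = ∫ ξ : EuclideanSpace ℝ (Fin n),
          fourierHat n φ ξ / ((‖ξ‖ ^ (2 * s) + ‖ξ‖ ^ 2 : ℝ) : ℂ) := by
  have : Nonempty (Fin n) := ⟨⟨0, by omega⟩⟩
  let ψ : SchwartzMap (EuclideanSpace ℝ (Fin n)) ℂ := φ.postcompCLM Complex.ofRealCLM
  have hψ : ∀ x, ψ x = (φ x : ℂ) := fun x => rfl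
  have hhat : ∀ ξ, fourierHat n φ ξ = 𝓕 ψ ξ := by
    intro ξ
    rw [SchwartzMap.fourier_coe, Real.fourier_eq', fourierHat]
    refine integral_congr_ae (ae_of_all _ fun v => ?_)
    simp only [hψ, smul_eq_mul]
    congr 2
    push_cast; ring
  have e1 : ∫ x : EuclideanSpace ℝ (Fin n), mixedZ n s x * φ x =
      ∫ t in Ioi (0:ℝ), ∫ x : EuclideanSpace ℝ (Fin n), mixedHeatKernel n s x t * φ x := by
    rw [← integral_integral_swap (joint_int n hn s hs φ)]
    refine integral_congr_ae (ae_of_all _ fun x => ?_)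
    simp only [mixedZ, integral_mul_const]
  have hT := tonelli_int (E := EuclideanSpace ℝ (Fin n)) (by simpa using hn) hs
      (F := fun v => ‖v‖^(2*s) + ‖v‖^2) (by fun_prop) (fun v => le_add_of_nonneg_right (by positivity))
      (g := ⇑(𝓕 ψ : SchwartzMap (EuclideanSpace ℝ (Fin n)) ℂ)) (𝓕 ψ : SchwartzMap (EuclideanSpace ℝ (Fin n)) ℂ).continuous.measurable (𝓕 ψ : SchwartzMap (EuclideanSpace ℝ (Fin n)) ℂ).integrable
      (SchwartzMap.norm_le_seminorm ℝ (𝓕 ψ))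
  have e2 : ∀ t ∈ Ioi (0:ℝ), ((∫ x : EuclideanSpace ℝ (Fin n), mixedHeatKernel n s x t * φ x : ℝ) : ℂ)
      = ∫ v : EuclideanSpace ℝ (Fin n), 𝓕 ψ v * ((Real.exp (-t * (‖v‖^(2*s) + ‖v‖^2)) : ℝ) : ℂ) := by
    intro t ht
    rw [← integral_complex_ofReal]
    have := fourier_adj (hk_intC (E := EuclideanSpace ℝ (Fin n)) (s := s) ht) ψ.integrable
    calc _ = _ := ?_
      _ = _ := this
      _ = _ := ?_
    · refine integral_congr_ae (ae_of_all _ fun v => ?_)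
      simp only [Complex.ofReal_mul, H_eq, hψ]
    · refine integral_congr_ae (ae_of_all _ fun v => ?_)
      simp only [hk, ← Real.exp_add, SchwartzMap.fourier_coe]
      rw [mul_comm]
      congr 4
      ring
  rw [e1, ← integral_complex_ofReal, setIntegral_congr_fun measurableSet_Ioi e2, ← integral_integral_swap hT]
  refine integral_congr_ae ?_
  have hne : ∀ᵐ v : EuclideanSpace ℝ (Fin n), v ≠ 0 := by
    rw [ae_iff]; simp
  filter_upwards [hne] with v hv
  have hp : 0 < ‖v‖^(2*s) + ‖v‖^2 := by
    have := norm_pos_iff.2 hv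
    positivity
  rw [integral_const_mul, integral_complex_ofReal, exp_int hp, hhat]
  push_cast
  ring
end
end

section
/- Let n ≥ 1, s ∈ (0,1), 1/2 ≤ r < R < 1, and f ∈ L^∞(B₁). Let u ∈ C²_loc(B₁) with ‖u‖_{L₁(ℝⁿ,ω)} < ∞ satisfy −Δu(x) + (−Δ)^s u(x) = f(x) for every x ∈ B_R. Then for any α ∈ (0, min{1, 2s}), there is a constant N = N(n, s, α) such that [u]_{C^α(B_r)} ≤ N ( (R−r)^{−α} sup_{B_R}|u| + (R−r)^{2s−α−2} sup_{B_R}|u| + (R−r)^{−n−α} ‖u‖_{L₁(ℝⁿ,ω)} + (R−r)^{2s−α} osc_{B_R} f ). -/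
open MeasureTheory Metric Set
noncomputable section

/-- The Laplacian `Δu(x) = ∑ᵢ ∂²u/∂xᵢ²(x)`. -/
def lap (n : ℕ) (u : EuclideanSpace ℝ (Fin n) → ℝ) (x : EuclideanSpace ℝ (Fin n)) : ℝ :=
  ∑ i : Fin n,
    iteratedFDeriv ℝ 2 u x ![EuclideanSpace.single i 1, EuclideanSpace.single i 1]

/-- The standard normalization constant `c_{n,s}` of the fractional Laplacian. -/
def fracLapConst (n : ℕ) (s : ℝ) : ℝ :=
  (2 : ℝ) ^ (2 * s) * s * Real.Gamma ((n : ℝ) / 2 + s)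
    / (Real.pi ^ ((n : ℝ) / 2) * Real.Gamma (1 - s))

/-- The fractional Laplacian
`(-Δ)^s u(x) = (c_{n,s}/2) ∫ (2u(x) - u(x+z) - u(x-z))/|z|^{n+2s} dz`. -/
def fracLap (n : ℕ) (s : ℝ) (u : EuclideanSpace ℝ (Fin n) → ℝ)
    (x : EuclideanSpace ℝ (Fin n)) : ℝ :=
  (fracLapConst n s / 2) *
    ∫ z : EuclideanSpace ℝ (Fin n),
      (2 * u x - u (x + z) - u (x - z)) / ‖z‖ ^ ((n : ℝ) + 2 * s)

open Topology Filter

theorem second_deriv_nonpos (g g' : ℝ → ℝ) (c : ℝ)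
    (hg : ∀ᶠ h in 𝓝 (0:ℝ), HasDerivAt g (g' h) h) (hg' : HasDerivAt g' c 0)
    (hmax : IsLocalMax g 0) : c ≤ 0 := by
  by_contra hc
  push Not at hc
  have hd : deriv g =ᶠ[𝓝 0] g' := hg.mono fun h hh => hh.deriv
  have h2 : deriv (deriv g) 0 = c := by rw [hd.deriv_eq]; exact hg'.deriv
  have hmin : IsLocalMin g 0 :=
    isLocalMin_of_deriv_deriv_pos (by rw [h2]; exact hc) hmax.deriv_eq_zero
      hg.self_of_nhds.continuousAt
  have hconst : g =ᶠ[𝓝 0] fun _ => g 0 := by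
    filter_upwards [hmax, hmin] with h h1 h2
    exact le_antisymm h1 h2
  have h3 : deriv g =ᶠ[𝓝 0] fun _ => 0 := by
    have := hconst.deriv
    simpa using this
  have h4 : deriv (deriv g) 0 = 0 := by rw [h3.deriv_eq]; simp
  linarith

theorem line_derivs {E : Type*} [NormedAddCommGroup E] [NormedSpace ℝ E] (u : E → ℝ) (x v : E)
    (hu : ContDiffAt ℝ 2 u x) :
    (∀ᶠ h in 𝓝 (0:ℝ), HasDerivAt (fun h : ℝ => u (x + h • v)) (fderiv ℝ u (x + h • v) v) h) ∧
    HasDerivAt (fun h : ℝ => fderiv ℝ u (x + h • v) v) (iteratedFDeriv ℝ 2 u x ![v, v]) 0 := by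
  have hl : ∀ h : ℝ, HasDerivAt (fun h : ℝ => x + h • v) v h := by
    intro h
    simpa using ((hasDerivAt_id h).smul_const v).const_add x
  have hx0 : x + (0:ℝ) • v = x := by simp
  constructor
  · have h1 : ∀ᶠ y in 𝓝 x, ContDiffAt ℝ 2 u y := hu.eventually (by simp)
    have h2 : Tendsto (fun h : ℝ => x + h • v) (𝓝 0) (𝓝 x) := by
      have := (hl 0).continuousAt.tendsto
      rwa [hx0] at this
    filter_upwards [h2.eventually h1] with h hh
    exact (hh.differentiableAt (by simp)).hasFDerivAt.comp_hasDerivAt h (hl h)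
  · have h1 : DifferentiableAt ℝ (fderiv ℝ u) x :=
      (hu.fderiv_right (m := 1) (by norm_num)).differentiableAt (by simp)
    have h2 : HasFDerivAt (fderiv ℝ u) (fderiv ℝ (fderiv ℝ u) x) (x + (0:ℝ) • v) := by
      rw [hx0]; exact h1.hasFDerivAt
    have h3 := h2.comp_hasDerivAt (0:ℝ) (hl 0)
    have h4 := h3.clm_apply (hasDerivAt_const (0:ℝ) v)
    rw [iteratedFDeriv_two_apply]
    simpa using h4

theorem diff_bound {E : Type*} [NormedAddCommGroup E] [NormedSpace ℝ E] (u : E → ℝ) (x : E)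
    (hu : ContDiffAt ℝ 2 u x) :
    ∃ C δ : ℝ, 0 ≤ C ∧ 0 < δ ∧ ∀ z : E, ‖z‖ < δ → |2 * u x - u (x + z) - u (x - z)| ≤ C * ‖z‖ ^ 2 := by
  obtain ⟨K, t, ht, hK⟩ := (hu.fderiv_right (m := 1) (by norm_num)).exists_lipschitzOnWith
  have h1 : ∀ᶠ y in 𝓝 x, ContDiffAt ℝ 2 u y := hu.eventually (by simp)
  obtain ⟨δ, hδ, hb⟩ := Metric.mem_nhds_iff.1 (inter_mem ht h1)
  refine ⟨2 * K, δ, by positivity, hδ, fun z hz => ?_⟩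
  have hin : ∀ w : E, ‖w‖ < δ → x + w ∈ ball x δ := fun w hw => by simpa using hw
  have hder : ∀ w ∈ closedBall (0:E) ‖z‖, HasFDerivWithinAt (fun w => u (x + w) + u (x - w))
      (fderiv ℝ u (x + w) - fderiv ℝ u (x - w)) (closedBall (0:E) ‖z‖) w := by
    intro w hw
    have hw' : ‖w‖ ≤ ‖z‖ := by simpa using hw
    have ha : ContDiffAt ℝ 2 u (x + w) := (hb (hin w (by linarith))).2
    have hbb : ContDiffAt ℝ 2 u (x - w) := by
      have := (hb (hin (-w) (by rw [norm_neg]; linarith))).2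
      rwa [← sub_eq_add_neg] at this
    have e1 := (ha.differentiableAt (by simp)).hasFDerivAt.comp w ((hasFDerivAt_id w).const_add x)
    have e2 := (hbb.differentiableAt (by simp)).hasFDerivAt.comp w ((hasFDerivAt_id w).const_sub x)
    have h12 := e1.add e2
    have e : fderiv ℝ u (x + w) - fderiv ℝ u (x - w) =
        fderiv ℝ u (x + w) ∘SL ContinuousLinearMap.id ℝ E +
          fderiv ℝ u (x - w) ∘SL (-ContinuousLinearMap.id ℝ E) := by
      ext w
      simp [sub_eq_add_neg]
    rw [e]
    exact HasFDerivAt.hasFDerivWithinAt h12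
  have hbd : ∀ w ∈ closedBall (0:E) ‖z‖, ‖fderiv ℝ u (x + w) - fderiv ℝ u (x - w)‖ ≤ 2 * K * ‖z‖ := by
    intro w hw
    have hw' : ‖w‖ ≤ ‖z‖ := by simpa using hw
    have ha := (hb (hin w (by linarith))).1
    have hbb := (hb (hin (-w) (by rw [norm_neg]; linarith))).1
    have := hK.dist_le_mul _ ha _ hbb
    rw [dist_eq_norm, dist_eq_norm] at this
    rw [← sub_eq_add_neg] at this
    have e : ‖x + w - (x - w)‖ ≤ 2 * ‖w‖ := by
      have : x + w - (x - w) = w + w := by abel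
      rw [this, two_mul]; exact norm_add_le _ _
    have hK0 : (0:ℝ) ≤ K := K.2
    calc _ ≤ _ := this
      _ ≤ K * (2 * ‖z‖) := by gcongr; linarith
      _ = _ := by ring
  have := (convex_closedBall (0:E) ‖z‖).norm_image_sub_le_of_norm_hasFDerivWithin_le hder hbd
    (x := 0) (y := z) (by simp) (by simp)
  simp only [add_zero, sub_zero, Real.norm_eq_abs] at this
  rw [abs_sub_comm] at this
  calc _ = |u x + u x - (u (x + z) + u (x - z))| := by congr 1; ring
    _ ≤ _ := this
    _ = _ := by ring

theorem levy_integrable (n : ℕ) (hn : 1 ≤ n) (s : ℝ) (hs : s ∈ Ioo (0 : ℝ) 1) :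
    Integrable (fun z : EuclideanSpace ℝ (Fin n) => min 1 (‖z‖ ^ 2) / ‖z‖ ^ ((n : ℝ) + 2 * s)) := by
  have : Nonempty (Fin n) := ⟨⟨0, hn⟩⟩
  have := (integrable_fun_norm_addHaar (volume : Measure (EuclideanSpace ℝ (Fin n)))
    (f := fun y : ℝ => min 1 (y ^ 2) / y ^ ((n : ℝ) + 2 * s))).2
  apply this
  rw [finrank_euclideanSpace_fin, ← Ioc_union_Ioi_eq_Ioi (zero_le_one (α := ℝ))]
  have hpow : ∀ y : ℝ, 0 < y → y ^ (n - 1) = y ^ ((n : ℝ) - 1) := by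
    intro y hy
    rw [← Real.rpow_natCast, Nat.cast_sub hn]; simp
  apply IntegrableOn.union
  · have h1 : IntegrableOn (fun y : ℝ => y ^ (1 - 2 * s)) (Ioc 0 1) := by
      have := intervalIntegral.intervalIntegrable_rpow' (a := 0) (b := 1) (r := 1 - 2 * s)
        (by linarith [hs.2])
      rwa [intervalIntegrable_iff_integrableOn_Ioc_of_le zero_le_one] at this
    refine h1.congr_fun (fun y hy => ?_) measurableSet_Ioc
    have hm : min 1 (y ^ 2) = y ^ (2:ℝ) := by
      rw [Real.rpow_two]
      exact min_eq_right (pow_le_one₀ hy.1.le hy.2)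
    simp only [smul_eq_mul]
    rw [hm, hpow y hy.1, ← Real.rpow_sub hy.1, ← Real.rpow_add hy.1]
    congr 1; ring
  · have h1 : IntegrableOn (fun y : ℝ => y ^ (-1 - 2 * s)) (Ioi 1) :=
      integrableOn_Ioi_rpow_of_lt (by linarith [hs.1]) one_pos
    refine h1.congr_fun (fun y hy => ?_) measurableSet_Ioi
    have hy0 : (0:ℝ) < y := one_pos.trans hy
    have hm : min 1 (y ^ 2) = 1 := min_eq_left (one_le_pow₀ (le_of_lt hy))
    simp only [smul_eq_mul]
    rw [hm, hpow y hy0, one_div, ← Real.rpow_neg hy0.le, ← Real.rpow_add hy0]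
    congr 1; ring

theorem lap_eq_basis (n : ℕ) (u : EuclideanSpace ℝ (Fin n) → ℝ) (x : EuclideanSpace ℝ (Fin n))
    (b : OrthonormalBasis (Fin n) ℝ (EuclideanSpace ℝ (Fin n))) :
    lap n u x = ∑ i, iteratedFDeriv ℝ 2 u x ![b i, b i] := by
  have h1 := congrFun (InnerProductSpace.laplacian_eq_iteratedFDeriv_orthonormalBasis u b) x
  have h2 := congrFun (InnerProductSpace.laplacian_eq_iteratedFDeriv_orthonormalBasis u
    (EuclideanSpace.basisFun (Fin n) ℝ)) x
  rw [← h1, h2, lap]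
  simp

theorem fracLapConst_nonneg (n : ℕ) (s : ℝ) (hs : s ∈ Ioo (0 : ℝ) 1) : 0 ≤ fracLapConst n s := by
  have h1 : 0 < Real.Gamma ((n : ℝ) / 2 + s) :=
    Real.Gamma_pos_of_pos (by have := hs.1; positivity)
  have h2 : 0 < Real.Gamma (1 - s) := Real.Gamma_pos_of_pos (by linarith [hs.2])
  have := hs.1
  unfold fracLapConst
  positivity

theorem hess_sum (n : ℕ) (α K L : ℝ) (u : EuclideanSpace ℝ (Fin n) → ℝ)
    (x0 x y : EuclideanSpace ℝ (Fin n)) (hxy : x ≠ y)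
    (hux : ContDiffAt ℝ 2 u x) (huy : ContDiffAt ℝ 2 u y)
    (hmax : ∀ᶠ p in 𝓝 (x, y), u p.1 - u p.2 - L * ‖p.1 - p.2‖ ^ α - K * ‖p.1 - x0‖ ^ 2 ≤
      u x - u y - L * ‖x - y‖ ^ α - K * ‖x - x0‖ ^ 2) :
    lap n u x - lap n u y ≤ -(4 * (α * (1 - α)) * L * ‖x - y‖ ^ (α - 2)) + 2 * n * K := by
  set a := x - y with ha
  have ha0 : 0 < ‖a‖ := norm_pos_iff.2 (sub_ne_zero.2 hxy)
  set e : EuclideanSpace ℝ (Fin n) := ‖a‖⁻¹ • a with he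
  have hae : a = ‖a‖ • e := by rw [he, smul_smul, mul_inv_cancel₀ ha0.ne', one_smul]
  have hne : ‖e‖ = 1 := by
    rw [he, norm_smul, norm_inv, norm_norm, inv_mul_cancel₀ ha0.ne']
  set T := (Submodule.span ℝ {e}).reflection with hT
  set b := EuclideanSpace.basisFun (Fin n) ℝ with hb
  have hTv : ∀ v, v + T v = (2 * inner ℝ e v) • e := by
    intro v
    rw [hT, Submodule.reflection_singleton_apply, hne]
    simp [two_smul, two_mul, add_smul]
  have key : ∀ i, iteratedFDeriv ℝ 2 u x ![b i, b i] -
      iteratedFDeriv ℝ 2 u y ![(b.map (T.trans (LinearIsometryEquiv.neg ℝ))) i,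
        (b.map (T.trans (LinearIsometryEquiv.neg ℝ))) i] ≤
      -(4 * (α * (1 - α)) * L * ‖a‖ ^ (α - 2)) * (inner ℝ e (b i)) ^ 2 + 2 * K := by
    intro i
    set v := b i with hv
    have hvn : ‖v‖ = 1 := b.orthonormal.1 i
    set w := (b.map (T.trans (LinearIsometryEquiv.neg ℝ))) i with hw
    have hwv : v - w = (2 * inner ℝ e v) • e := by
      rw [← hTv v, hw]; simp [hv]
    set t := inner ℝ e v with ht
    obtain ⟨d1, d1'⟩ := line_derivs u x v hux
    obtain ⟨d2, d2'⟩ := line_derivs u y w huy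
    have hlin : ∀ h : ℝ, HasDerivAt (fun h : ℝ => ‖a‖ + 2 * t * h) (2 * t) h := by
      intro h
      simpa using ((hasDerivAt_id h).const_mul (2 * t)).const_add ‖a‖
    have hpos : ∀ᶠ h in 𝓝 (0:ℝ), 0 < ‖a‖ + 2 * t * h := by
      have : Tendsto (fun h : ℝ => ‖a‖ + 2 * t * h) (𝓝 0) (𝓝 (‖a‖ + 2 * t * 0)) :=
        (hlin 0).continuousAt.tendsto
      exact this.eventually (lt_mem_nhds (by simpa using ha0))
    have hq : ∀ h : ℝ, ‖x + h • v - x0‖ ^ 2 =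
        ‖x - x0‖ ^ 2 + 2 * inner ℝ (x - x0) v * h + h ^ 2 := by
      intro h
      rw [show x + h • v - x0 = (x - x0) + h • v by abel, norm_add_sq_real, norm_smul, hvn,
        inner_smul_right]
      simp
      ring
    have hqd : ∀ h : ℝ, HasDerivAt (fun h : ℝ => ‖x - x0‖ ^ 2 + 2 * inner ℝ (x - x0) v * h + h ^ 2)
        (2 * inner ℝ (x - x0) v + 2 * h) h := by
      intro h
      have h1 := ((hasDerivAt_id h).const_mul (2 * inner ℝ (x - x0) v)).const_add (‖x - x0‖ ^ 2)
      have h2 := hasDerivAt_pow 2 h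
      have h3 := h1.add h2
      simp at h3
      exact h3
    have hqd' : HasDerivAt (fun h : ℝ => 2 * inner ℝ (x - x0) v + 2 * h) 2 0 := by
      simpa using ((hasDerivAt_id (0:ℝ)).const_mul 2).const_add (2 * inner ℝ (x - x0) v)
    have := second_deriv_nonpos
      (fun h : ℝ => u (x + h • v) - u (y + h • w) - L * (‖a‖ + 2 * t * h) ^ α
        - K * (‖x - x0‖ ^ 2 + 2 * inner ℝ (x - x0) v * h + h ^ 2))
      (fun h : ℝ => fderiv ℝ u (x + h • v) v - fderiv ℝ u (y + h • w) w
        - L * (2 * t * α * (‖a‖ + 2 * t * h) ^ (α - 1))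
        - K * (2 * inner ℝ (x - x0) v + 2 * h))
      (iteratedFDeriv ℝ 2 u x ![v, v] - iteratedFDeriv ℝ 2 u y ![w, w]
        - L * (2 * t * α * (2 * t * (α - 1) * ‖a‖ ^ (α - 1 - 1))) - K * 2) ?_ ?_ ?_
    · have e2 : α - 1 - 1 = α - 2 := by ring
      rw [e2] at this
      nlinarith [this]
    · filter_upwards [d1, d2, hpos] with h h1 h2 h3
      exact ((h1.sub h2).sub (((hlin h).rpow_const (p := α) (Or.inl h3.ne')).const_mul L)).sub
        ((hqd h).const_mul K)
    · have h3 := (hlin 0).rpow_const (p := α - 1) (Or.inl (by simpa using ha0.ne'))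
      have h4 := ((d1'.sub d2').sub ((h3.const_mul (2 * t * α)).const_mul L)).sub
        (hqd'.const_mul K)
      simp at h4
      exact h4
    · have hc : Tendsto (fun h : ℝ => (x + h • v, y + h • w)) (𝓝 0) (𝓝 (x, y)) := by
        have : Continuous (fun h : ℝ => (x + h • v, y + h • w)) := by fun_prop
        simpa using this.tendsto 0
      have h5 := hc.eventually hmax
      refine (h5.and hpos).mono ?_
      rintro h ⟨h6, h7⟩
      have hn : ‖x + h • v - (y + h • w)‖ = ‖a‖ + 2 * t * h := by
        have : x + h • v - (y + h • w) = (‖a‖ + 2 * t * h) • e := by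
          rw [add_smul, ← hae, mul_comm (2 * t) h, mul_smul, ← hwv, smul_sub, ha]; abel
        rw [this, norm_smul, hne, mul_one, Real.norm_eq_abs, abs_of_pos h7]
      simp only [hn, hq] at h6
      simpa using h6
  rw [lap_eq_basis n u x b, lap_eq_basis n u y (b.map (T.trans (LinearIsometryEquiv.neg ℝ))),
    ← Finset.sum_sub_distrib]
  refine (Finset.sum_le_sum fun i _ => key i).trans (le_of_eq ?_)
  rw [Finset.sum_add_distrib, ← Finset.mul_sum]
  have : ∑ i, (inner ℝ e (b i)) ^ 2 = 1 := by
    have := b.sum_sq_norm_inner_left e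
    rw [hne] at this
    simpa using this
  rw [this]
  simp
  ring

theorem weight_bound {E : Type*} [NormedAddCommGroup E] (p τ : ℝ) (hp : 0 ≤ p) (x y z : E)
    (hx : ‖x‖ ≤ 1) (hτ : 0 < τ) (hτ1 : τ ≤ 1) (hz : τ ≤ ‖z‖) (hy : ‖y‖ ≤ ‖x‖ + ‖z‖) :
    1 / ‖z‖ ^ p ≤ 2 * (2 / τ) ^ p / (1 + ‖y‖ ^ p) := by
  have hz0 : 0 < ‖z‖ := hτ.trans_le hz
  have h1 : 1 ≤ ‖z‖ / τ := by rwa [one_le_div hτ]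
  have h0 : ‖z‖ ≤ ‖z‖ / τ := by rw [le_div_iff₀ hτ]; nlinarith
  have h2 : ‖y‖ ≤ 2 / τ * ‖z‖ := by
    have : 2 / τ * ‖z‖ = ‖z‖ / τ + ‖z‖ / τ := by ring
    linarith
  have h3 : ‖y‖ ^ p ≤ (2 / τ) ^ p * ‖z‖ ^ p := by
    rw [← Real.mul_rpow (by positivity) (by positivity)]
    exact Real.rpow_le_rpow (norm_nonneg _) h2 hp
  have h4 : 1 ≤ (2 / τ) ^ p * ‖z‖ ^ p := by
    rw [← Real.mul_rpow (by positivity) (by positivity)]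
    apply Real.one_le_rpow _ hp
    have : 2 / τ * ‖z‖ = ‖z‖ / τ + ‖z‖ / τ := by ring
    linarith
  have h5 : 0 < ‖z‖ ^ p := Real.rpow_pos_of_pos hz0 p
  have h6 : 0 ≤ ‖y‖ ^ p := Real.rpow_nonneg (norm_nonneg _) p
  rw [div_le_div_iff₀ h5 (by linarith)]
  linarith

theorem frac_integrable (n : ℕ) (hn : 1 ≤ n) (s : ℝ) (hs : s ∈ Ioo (0 : ℝ) 1)
    (u : EuclideanSpace ℝ (Fin n) → ℝ)
    (hu : Integrable (fun y : EuclideanSpace ℝ (Fin n) => u y / (1 + ‖y‖ ^ ((n : ℝ) + 2 * s))))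
    (x : EuclideanSpace ℝ (Fin n)) (hx : ‖x‖ ≤ 1) (hux : ContDiffAt ℝ 2 u x) :
    Integrable (fun z => (2 * u x - u (x + z) - u (x - z)) / ‖z‖ ^ ((n : ℝ) + 2 * s)) := by
  set p := (n : ℝ) + 2 * s with hp
  have hp0 : 0 ≤ p := by have := hs.1; positivity
  have hden : ∀ y : EuclideanSpace ℝ (Fin n), 0 < 1 + ‖y‖ ^ p := fun y => by
    have := Real.rpow_nonneg (norm_nonneg y) p
    linarith
  have hmeas : AEStronglyMeasurable u := by
    have h1 : AEStronglyMeasurable (fun y : EuclideanSpace ℝ (Fin n) => 1 + ‖y‖ ^ p) := by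
      apply Measurable.aestronglyMeasurable
      fun_prop
    refine (hu.1.mul h1).congr (Eventually.of_forall fun y => ?_)
    simp only [Pi.mul_apply]
    field_simp [(hden y).ne']
  have hW : Integrable (fun y : EuclideanSpace ℝ (Fin n) => |u y| / (1 + ‖y‖ ^ p)) := by
    refine hu.norm.congr (Eventually.of_forall fun y => ?_)
    simp only [norm_div, Real.norm_eq_abs, abs_of_pos (hden y)]
  obtain ⟨C, δ, hC, hδ, hb⟩ := diff_bound u x hux
  set τ := min δ 1 with hτ
  have hτ0 : 0 < τ := lt_min hδ one_pos
  have hτ1 : τ ≤ 1 := min_le_right _ _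
  have hm := levy_integrable n hn s hs
  have hmajor : Integrable (fun z : EuclideanSpace ℝ (Fin n) =>
      (C + 2 * |u x| / τ ^ 2) * (min 1 (‖z‖ ^ 2) / ‖z‖ ^ p) +
      2 * (2 / τ) ^ p * (|u (x + z)| / (1 + ‖x + z‖ ^ p) + |u (x - z)| / (1 + ‖x - z‖ ^ p))) :=
    (hm.const_mul _).add (((hW.comp_add_left x).add (hW.comp_sub_left x)).const_mul _)
  refine hmajor.mono' ?_ (Eventually.of_forall fun z => ?_)
  · have h1 : AEStronglyMeasurable (fun z => u (x + z)) :=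
      hmeas.comp_quasiMeasurePreserving (measurePreserving_add_left volume x).quasiMeasurePreserving
    have h2 : AEStronglyMeasurable (fun z => u (x - z)) :=
      hmeas.comp_quasiMeasurePreserving (quasiMeasurePreserving_sub_left volume x)
    have h3 : AEStronglyMeasurable (fun z : EuclideanSpace ℝ (Fin n) => ‖z‖ ^ p) := by
      apply Measurable.aestronglyMeasurable
      fun_prop
    exact (((aestronglyMeasurable_const.sub h1).sub h2).aemeasurable.div
      h3.aemeasurable).aestronglyMeasurable
  · have hzp : 0 ≤ ‖z‖ ^ p := Real.rpow_nonneg (norm_nonneg z) p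
    rw [norm_div, Real.norm_eq_abs, Real.norm_eq_abs, abs_of_nonneg hzp]
    have hW1 : 0 ≤ |u (x + z)| / (1 + ‖x + z‖ ^ p) := div_nonneg (abs_nonneg _) (hden _).le
    have hW2 : 0 ≤ |u (x - z)| / (1 + ‖x - z‖ ^ p) := div_nonneg (abs_nonneg _) (hden _).le
    have hm0 : 0 ≤ min 1 (‖z‖ ^ 2) / ‖z‖ ^ p := by positivity
    rcases lt_or_ge ‖z‖ τ with hz | hz
    · have h1 := hb z (hz.trans_le (min_le_left _ _))
      have h2 : min 1 (‖z‖ ^ 2) = ‖z‖ ^ 2 :=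
        min_eq_right (pow_le_one₀ (norm_nonneg _) (hz.le.trans hτ1))
      have h3 : |2 * u x - u (x + z) - u (x - z)| / ‖z‖ ^ p ≤ C * (min 1 (‖z‖ ^ 2) / ‖z‖ ^ p) := by
        rw [h2, ← mul_div_assoc]
        gcongr
      have h4 : 0 ≤ 2 * |u x| / τ ^ 2 * (min 1 (‖z‖ ^ 2) / ‖z‖ ^ p) := by positivity
      have h5 : 0 ≤ 2 * (2 / τ) ^ p * (|u (x + z)| / (1 + ‖x + z‖ ^ p) +
        |u (x - z)| / (1 + ‖x - z‖ ^ p)) := by positivity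
      linarith
    · have k1 := weight_bound p τ hp0 x (x + z) z hx hτ0 hτ1 hz (norm_add_le _ _)
      have k2 := weight_bound p τ hp0 x (x - z) z hx hτ0 hτ1 hz (norm_sub_le _ _)
      have k3 : 1 ≤ min 1 (‖z‖ ^ 2) / τ ^ 2 := by
        rw [one_le_div (by positivity)]
        exact le_min (pow_le_one₀ hτ0.le hτ1) (by gcongr)
      have j1 := mul_le_mul_of_nonneg_left k1 (abs_nonneg (u (x + z)))
      have j2 := mul_le_mul_of_nonneg_left k2 (abs_nonneg (u (x - z)))
      have j3 : 2 * |u x| * (1 / ‖z‖ ^ p) ≤ 2 * |u x| * (1 / ‖z‖ ^ p) * (min 1 (‖z‖ ^ 2) / τ ^ 2) :=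
        le_mul_of_one_le_right (by positivity) k3
      have j4 : |2 * u x - u (x + z) - u (x - z)| ≤ 2 * |u x| + |u (x + z)| + |u (x - z)| := by
        rw [abs_le]
        constructor <;> linarith [abs_le.1 (le_refl |u x|), abs_le.1 (le_refl |u (x + z)|),
          abs_le.1 (le_refl |u (x - z)|), le_abs_self (u x), le_abs_self (u (x + z)), le_abs_self (u (x - z)),
          neg_abs_le (u x), neg_abs_le (u (x + z)), neg_abs_le (u (x - z))]
      have j5 : 0 ≤ C * (min 1 (‖z‖ ^ 2) / ‖z‖ ^ p) := by positivity
      calc _ ≤ (2 * |u x| + |u (x + z)| + |u (x - z)|) / ‖z‖ ^ p := by gcongr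
        _ = 2 * |u x| * (1 / ‖z‖ ^ p) + |u (x + z)| * (1 / ‖z‖ ^ p) + |u (x - z)| * (1 / ‖z‖ ^ p) := by
          ring
        _ ≤ 2 * |u x| * (1 / ‖z‖ ^ p) * (min 1 (‖z‖ ^ 2) / τ ^ 2) +
          |u (x + z)| * (2 * (2 / τ) ^ p / (1 + ‖x + z‖ ^ p)) +
          |u (x - z)| * (2 * (2 / τ) ^ p / (1 + ‖x - z‖ ^ p)) + C * (min 1 (‖z‖ ^ 2) / ‖z‖ ^ p) := by
            linarith
        _ = _ := by ring

theorem frac_diff (n : ℕ) (hn : 1 ≤ n) (s : ℝ) (hs : s ∈ Ioo (0 : ℝ) 1)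
    (u : EuclideanSpace ℝ (Fin n) → ℝ)
    (hu : Integrable (fun y : EuclideanSpace ℝ (Fin n) => u y / (1 + ‖y‖ ^ ((n : ℝ) + 2 * s))))
    (x0 x y : EuclideanSpace ℝ (Fin n)) (hx : ‖x‖ ≤ 1) (hy : ‖y‖ ≤ 1)
    (hux : ContDiffAt ℝ 2 u x) (huy : ContDiffAt ℝ 2 u y) (S K ρ : ℝ) (hK : 0 ≤ K)
    (hxS : |u x| ≤ S) (hyS : |u y| ≤ S) (hρ : 0 < ρ) (hρ1 : ρ ≤ 1)
    (hloc : ∀ z, ‖z‖ < ρ / 2 → u (x + z) - u (y + z) - K * ‖x + z - x0‖ ^ 2 ≤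
      u x - u y - K * ‖x - x0‖ ^ 2) :
    -(fracLapConst n s / 2 * ((2 * K + 16 * S / ρ ^ 2) *
        (∫ z : EuclideanSpace ℝ (Fin n), min 1 (‖z‖ ^ 2) / ‖z‖ ^ ((n : ℝ) + 2 * s)) +
      8 * (4 / ρ) ^ ((n : ℝ) + 2 * s) *
        ∫ z : EuclideanSpace ℝ (Fin n), |u z| / (1 + ‖z‖ ^ ((n : ℝ) + 2 * s)))) ≤
      fracLap n s u x - fracLap n s u y := by
  have hix := frac_integrable n hn s hs u hu x hx hux
  have hiy := frac_integrable n hn s hs u hu y hy huy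
  have hm := levy_integrable n hn s hs
  have hc := fracLapConst_nonneg n s hs
  unfold fracLap
  rw [← mul_sub, ← integral_sub hix hiy, ← mul_neg]
  refine mul_le_mul_of_nonneg_left ?_ (by positivity)
  set p := (n : ℝ) + 2 * s with hp
  have hp0 : 0 ≤ p := by have := hs.1; positivity
  have hden : ∀ y : EuclideanSpace ℝ (Fin n), 0 < 1 + ‖y‖ ^ p := fun y => by
    have := Real.rpow_nonneg (norm_nonneg y) p
    linarith
  have hW : Integrable (fun y : EuclideanSpace ℝ (Fin n) => |u y| / (1 + ‖y‖ ^ p)) := by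
    refine hu.norm.congr (Eventually.of_forall fun y => ?_)
    simp only [norm_div, Real.norm_eq_abs, abs_of_pos (hden y)]
  have hS : 0 ≤ S := (abs_nonneg _).trans hxS
  set W : EuclideanSpace ℝ (Fin n) → ℝ := fun y => |u y| / (1 + ‖y‖ ^ p) with hWdef
  have hW0 : ∀ y, 0 ≤ W y := fun y => div_nonneg (abs_nonneg _) (hden y).le
  have i1 := hW.comp_add_left x
  have i2 := hW.comp_sub_left x
  have i3 := hW.comp_add_left y
  have i4 := hW.comp_sub_left y
  have e1 : ∫ z, W (x + z) = ∫ z, W z := integral_add_left_eq_self W x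
  have e2 : ∫ z, W (x - z) = ∫ z, W z := integral_sub_left_eq_self W volume x
  have e3 : ∫ z, W (y + z) = ∫ z, W z := integral_add_left_eq_self W y
  have e4 : ∫ z, W (y - z) = ∫ z, W z := integral_sub_left_eq_self W volume y
  have i12 : Integrable (fun z => W (x + z) + W (x - z)) := i1.add i2
  have i123 : Integrable (fun z => W (x + z) + W (x - z) + W (y + z)) := i12.add i3
  have i1234 : Integrable (fun z => W (x + z) + W (x - z) + W (y + z) + W (y - z)) := i123.add i4
  have hint : Integrable (fun z => (2 * K + 16 * S / ρ ^ 2) * (min 1 (‖z‖ ^ 2) / ‖z‖ ^ p) +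
      2 * (4 / ρ) ^ p * (((W (x + z) + W (x - z)) + W (y + z)) + W (y - z))) :=
    (hm.const_mul _).add (i1234.const_mul _)
  have hval : ∫ z, ((2 * K + 16 * S / ρ ^ 2) * (min 1 (‖z‖ ^ 2) / ‖z‖ ^ p) +
      2 * (4 / ρ) ^ p * (((W (x + z) + W (x - z)) + W (y + z)) + W (y - z))) =
      (2 * K + 16 * S / ρ ^ 2) * (∫ z : EuclideanSpace ℝ (Fin n), min 1 (‖z‖ ^ 2) / ‖z‖ ^ p) +
      8 * (4 / ρ) ^ p * ∫ z, W z := by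
    rw [integral_add (hm.const_mul _) (i1234.const_mul _),
      integral_const_mul, integral_const_mul, integral_add i123 i4,
      integral_add i12 i3, integral_add i1 i2, e1, e2, e3, e4]
    ring
  rw [← hval, ← integral_neg]
  refine integral_mono hint.neg (hix.sub hiy) fun z => ?_
  have hzp : 0 ≤ ‖z‖ ^ p := Real.rpow_nonneg (norm_nonneg z) p
  have hm0 : 0 ≤ min 1 (‖z‖ ^ 2) / ‖z‖ ^ p := by positivity
  have w1 := hW0 (x + z)
  have w2 := hW0 (x - z)
  have w3 := hW0 (y + z)
  have w4 := hW0 (y - z)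
  show -_ ≤ _ - _
  rw [← sub_div]
  rcases lt_or_ge ‖z‖ (ρ / 2) with hz | hz
  · have h1 := hloc z hz
    have h2 := hloc (-z) (by rwa [norm_neg])
    rw [← sub_eq_add_neg, ← sub_eq_add_neg] at h2
    have h3 : ‖x + z - x0‖ ^ 2 + ‖x - z - x0‖ ^ 2 = 2 * ‖x - x0‖ ^ 2 + 2 * ‖z‖ ^ 2 := by
      have := parallelogram_law_with_norm ℝ (x - x0) z
      rw [show x + z - x0 = x - x0 + z by abel, show x - z - x0 = x - x0 - z by abel]
      nlinarith [this]
    have h4 : min 1 (‖z‖ ^ 2) = ‖z‖ ^ 2 :=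
      min_eq_right (pow_le_one₀ (norm_nonneg _) (by linarith))
    have h5 : -(2 * K * ‖z‖ ^ 2) ≤ 2 * u x - u (x + z) - u (x - z) -
        (2 * u y - u (y + z) - u (y - z)) := by
      have : K * (‖x + z - x0‖ ^ 2 + ‖x - z - x0‖ ^ 2) = K * (2 * ‖x - x0‖ ^ 2 + 2 * ‖z‖ ^ 2) := by
        rw [h3]
      linarith
    have h6 := div_le_div_of_nonneg_right h5 hzp
    have h7 : -(2 * K * ‖z‖ ^ 2) / ‖z‖ ^ p = -(2 * K * (min 1 (‖z‖ ^ 2) / ‖z‖ ^ p)) := by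
      rw [h4]; ring
    rw [h7] at h6
    have h8 : 0 ≤ 16 * S / ρ ^ 2 * (min 1 (‖z‖ ^ 2) / ‖z‖ ^ p) := by positivity
    have h9 : 0 ≤ 2 * (4 / ρ) ^ p * (((W (x + z) + W (x - z)) + W (y + z)) + W (y - z)) := by
      positivity
    linarith
  · have hτ0 : 0 < ρ / 2 := by positivity
    have hτ1 : ρ / 2 ≤ 1 := by linarith
    have e5 : 2 / (ρ / 2) = 4 / ρ := by field_simp; norm_num
    have k1 := weight_bound p _ hp0 x (x + z) z hx hτ0 hτ1 hz (norm_add_le _ _)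
    have k2 := weight_bound p _ hp0 x (x - z) z hx hτ0 hτ1 hz (norm_sub_le _ _)
    have k3 := weight_bound p _ hp0 y (y + z) z hy hτ0 hτ1 hz (norm_add_le _ _)
    have k4 := weight_bound p _ hp0 y (y - z) z hy hτ0 hτ1 hz (norm_sub_le _ _)
    rw [e5] at k1 k2 k3 k4
    have j1 := mul_le_mul_of_nonneg_left k1 (abs_nonneg (u (x + z)))
    have j2 := mul_le_mul_of_nonneg_left k2 (abs_nonneg (u (x - z)))
    have j3 := mul_le_mul_of_nonneg_left k3 (abs_nonneg (u (y + z)))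
    have j4 := mul_le_mul_of_nonneg_left k4 (abs_nonneg (u (y - z)))
    have k5 : 1 ≤ min 1 (‖z‖ ^ 2) / (ρ / 2) ^ 2 := by
      rw [one_le_div (by positivity)]
      exact le_min (pow_le_one₀ hτ0.le hτ1) (by gcongr)
    have j5 : 4 * S * (1 / ‖z‖ ^ p) ≤ 4 * S * (1 / ‖z‖ ^ p) * (min 1 (‖z‖ ^ 2) / (ρ / 2) ^ 2) :=
      le_mul_of_one_le_right (by positivity) k5
    have j6 : -(4 * S + |u (x + z)| + |u (x - z)| + |u (y + z)| + |u (y - z)|) ≤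
        2 * u x - u (x + z) - u (x - z) - (2 * u y - u (y + z) - u (y - z)) := by
      have := (abs_le.1 hxS).1
      have := (abs_le.1 hyS).2
      linarith [le_abs_self (u (x + z)), le_abs_self (u (x - z)), neg_abs_le (u (y + z)),
        neg_abs_le (u (y - z))]
    have j7 := div_le_div_of_nonneg_right j6 hzp
    refine le_trans ?_ j7
    have j8 : 0 ≤ 2 * K * (min 1 (‖z‖ ^ 2) / ‖z‖ ^ p) := by positivity
    have e6 : -(4 * S + |u (x + z)| + |u (x - z)| + |u (y + z)| + |u (y - z)|) / ‖z‖ ^ p =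
      -(4 * S * (1 / ‖z‖ ^ p) + |u (x + z)| * (1 / ‖z‖ ^ p) + |u (x - z)| * (1 / ‖z‖ ^ p)
        + |u (y + z)| * (1 / ‖z‖ ^ p) + |u (y - z)| * (1 / ‖z‖ ^ p)) := by ring
    rw [e6, neg_le_neg_iff]
    have e7 : 4 * S * (1 / ‖z‖ ^ p) * (min 1 (‖z‖ ^ 2) / (ρ / 2) ^ 2) =
      16 * S / ρ ^ 2 * (min 1 (‖z‖ ^ 2) / ‖z‖ ^ p) := by ring
    have e8 : ∀ y, |u y| * (2 * (4 / ρ) ^ p / (1 + ‖y‖ ^ p)) = 2 * (4 / ρ) ^ p * W y := by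
      intro y; simp only [hWdef]; ring
    rw [e8] at j1 j2 j3 j4
    linarith

set_option maxHeartbeats 1600000 in
theorem one_side (n : ℕ) (hn : 1 ≤ n) (s α : ℝ) (hs : s ∈ Ioo (0 : ℝ) 1)
    (hα0 : 0 < α) (hα1 : α < 1) :
    ∃ N : ℝ, 2 ≤ N ∧ ∀ r R : ℝ, 1 / 2 ≤ r → r < R → R < 1 →
      ∀ (u f : EuclideanSpace ℝ (Fin n) → ℝ) (S O : ℝ),
        ContDiffOn ℝ 2 u (ball (0 : EuclideanSpace ℝ (Fin n)) 1) →
        Integrable (fun y : EuclideanSpace ℝ (Fin n) =>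
          u y / (1 + ‖y‖ ^ ((n : ℝ) + 2 * s))) →
        (∀ x ∈ ball (0 : EuclideanSpace ℝ (Fin n)) R,
          -lap n u x + fracLap n s u x = f x) →
        (∀ x ∈ ball (0 : EuclideanSpace ℝ (Fin n)) R, |u x| ≤ S) →
        (∀ x ∈ ball (0 : EuclideanSpace ℝ (Fin n)) R,
          ∀ y ∈ ball (0 : EuclideanSpace ℝ (Fin n)) R, f x - f y ≤ O) → 0 ≤ O →
        ∀ x0 ∈ ball (0 : EuclideanSpace ℝ (Fin n)) r,
        ∀ y0 ∈ closedBall x0 (R - r), u x0 - u y0 ≤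
          N * ((R - r) ^ (-α) * S + (R - r) ^ (-(n : ℝ) - α) *
                  (∫ z : EuclideanSpace ℝ (Fin n), |u z| / (1 + ‖z‖ ^ ((n : ℝ) + 2 * s)))
              + (R - r) ^ (2 - α) * O) * ‖x0 - y0‖ ^ α := by
  set c := fracLapConst n s with hc
  have hc0 : 0 ≤ c := fracLapConst_nonneg n s hs
  set M := ∫ z : EuclideanSpace ℝ (Fin n), min 1 (‖z‖ ^ 2) / ‖z‖ ^ ((n : ℝ) + 2 * s) with hM
  have hM0 : 0 ≤ M := integral_nonneg fun z => by positivity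
  set Q := α * (1 - α) with hQ
  have hQ0 : 0 < Q := mul_pos hα0 (by linarith)
  set B := 1 + 64 * n + 40 * c * M + 4 * c * 4 ^ ((n : ℝ) + 2 * s) with hB
  have hB0 : 0 ≤ B := by positivity
  have h4α : 1 ≤ (4:ℝ) ^ α := Real.one_le_rpow (by norm_num) hα0.le
  refine ⟨2 * 4 ^ α + B / (4 * Q), ?_, ?_⟩
  · have : 0 ≤ B / (4 * Q) := by positivity
    linarith
  intro r R hr hrR hR u f S O hu hint heq hS hO hO0 x0 hx0 y0 hy0
  set N := 2 * 4 ^ α + B / (4 * Q) with hN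
  have hN0 : 0 < N := by positivity
  have hNB : B < 4 * Q * N := by
    have : 4 * Q * N = 8 * Q * 4 ^ α + B := by rw [hN]; field_simp; ring
    have : 0 < 8 * Q * 4 ^ α := by positivity
    linarith
  set d := R - r with hd
  have hd0 : 0 < d := by linarith
  have hd1 : d ≤ 1 := by linarith
  set U := ∫ z : EuclideanSpace ℝ (Fin n), |u z| / (1 + ‖z‖ ^ ((n : ℝ) + 2 * s)) with hU
  have hU0 : 0 ≤ U := integral_nonneg fun z => by positivity
  have hx0' : ‖x0‖ < r := by simpa using hx0
  have hsub : ∀ z ∈ closedBall x0 d, z ∈ ball (0 : EuclideanSpace ℝ (Fin n)) R := by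
    intro z hz
    rw [mem_closedBall, dist_eq_norm] at hz
    rw [mem_ball_zero_iff]
    have : ‖z‖ ≤ ‖x0‖ + ‖z - x0‖ := by
      have := norm_add_le x0 (z - x0)
      simpa using this
    linarith
  have hS0 : 0 ≤ S := (abs_nonneg _).trans (hS x0 (hsub x0 (by simp [hd0.le])))
  set L := N * (d ^ (-α) * S + d ^ (-(n : ℝ) - α) * U + d ^ (2 - α) * O) with hL
  have hLS : 2 * 4 ^ α * (d ^ (-α) * S) ≤ L := by
    have a1 : 0 ≤ d ^ (-α) * S := by positivity
    have a2 : 0 ≤ d ^ (-(n : ℝ) - α) * U + d ^ (2 - α) * O := by positivity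
    have a3 : 2 * 4 ^ α ≤ N := by
      have : 0 ≤ B / (4 * Q) := by positivity
      linarith
    calc _ ≤ N * (d ^ (-α) * S) := by gcongr
      _ ≤ _ := by rw [hL]; gcongr; linarith
  have hL0 : 0 ≤ L := by positivity
  clear_value L N B Q
  by_contra hcon
  push Not at hcon
  set K := 32 * S / d ^ 2 with hK
  have hK0 : 0 ≤ K := by positivity
  have hR1 : ∀ z ∈ ball (0 : EuclideanSpace ℝ (Fin n)) R, ContDiffAt ℝ 2 u z := by
    intro z hz
    refine hu.contDiffAt (isOpen_ball.mem_nhds ?_)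
    exact ball_subset_ball hR.le hz
  have hcu : ContinuousOn u (closedBall x0 d) := fun z hz =>
    (hR1 z (hsub z hz)).continuousAt.continuousWithinAt
  have hcomp : IsCompact (closedBall x0 d ×ˢ closedBall x0 d) :=
    (isCompact_closedBall _ _).prod (isCompact_closedBall _ _)
  obtain ⟨⟨x, y⟩, hmem, hmax⟩ := hcomp.exists_isMaxOn
    (f := fun p : EuclideanSpace ℝ (Fin n) × EuclideanSpace ℝ (Fin n) =>
      u p.1 - u p.2 - L * ‖p.1 - p.2‖ ^ α - K * ‖p.1 - x0‖ ^ 2)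
    ⟨(x0, y0), by simp [hd0.le], hy0⟩ (by
      refine ContinuousOn.sub (ContinuousOn.sub (ContinuousOn.sub ?_ ?_) ?_) ?_
      · exact hcu.comp continuousOn_fst fun p hp => hp.1
      · exact hcu.comp continuousOn_snd fun p hp => hp.2
      · refine (continuousOn_const.mul (Continuous.continuousOn ?_))
        exact Continuous.rpow_const (by fun_prop) fun _ => Or.inr hα0.le
      · fun_prop)
  have hmax' : ∀ p ∈ closedBall x0 d, ∀ q ∈ closedBall x0 d,
      u p - u q - L * ‖p - q‖ ^ α - K * ‖p - x0‖ ^ 2 ≤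
      u x - u y - L * ‖x - y‖ ^ α - K * ‖x - x0‖ ^ 2 := fun p hp q hq =>
    hmax (show (p, q) ∈ closedBall x0 d ×ˢ closedBall x0 d from ⟨hp, hq⟩)
  have hpos : 0 < u x - u y - L * ‖x - y‖ ^ α - K * ‖x - x0‖ ^ 2 := by
    have := hmax' x0 (by simp [hd0.le]) y0 hy0
    simp at this
    linarith
  have hxR := hsub x hmem.1
  have hyR := hsub y hmem.2
  have hxS := hS x hxR
  have hyS := hS y hyR
  have hdiff : u x - u y ≤ 2 * S := by
    linarith [(abs_le.1 hxS).2, (abs_le.1 hyS).1]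
  have hLa : 0 ≤ L * ‖x - y‖ ^ α := by positivity
  have hKa : 0 ≤ K * ‖x - x0‖ ^ 2 := by positivity
  have hSpos : 0 < S := by linarith
  have hxy : x ≠ y := by
    rintro rfl
    linarith
  have hapos : 0 < ‖x - y‖ := norm_pos_iff.2 (sub_ne_zero.2 hxy)
  have hxd : ‖x - x0‖ < d / 4 := by
    by_contra hh
    push Not at hh
    have h1 : K * (d / 4) ^ 2 ≤ K * ‖x - x0‖ ^ 2 := by gcongr
    have h2 : K * (d / 4) ^ 2 = 2 * S := by rw [hK]; field_simp; norm_num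
    linarith
  have had : ‖x - y‖ < d / 4 := by
    by_contra hh
    push Not at hh
    have h1 : (d / 4) ^ α ≤ ‖x - y‖ ^ α := Real.rpow_le_rpow (by positivity) hh hα0.le
    have h2 : 2 * 4 ^ α * (d ^ (-α) * S) * (d / 4) ^ α ≤ L * ‖x - y‖ ^ α :=
      mul_le_mul hLS h1 (Real.rpow_nonneg (by positivity) _) hL0
    have h3 : 2 * 4 ^ α * (d ^ (-α) * S) * (d / 4) ^ α = 2 * S := by
      rw [Real.div_rpow hd0.le (by norm_num), Real.rpow_neg hd0.le]
      have : 0 < d ^ α := Real.rpow_pos_of_pos hd0 α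
      field_simp
    linarith
  have hyd : ‖y - x0‖ < d / 2 := by
    have := norm_add_le (x - x0) (y - x)
    rw [norm_sub_rev y x] at this
    rw [show y - x0 = x - x0 + (y - x) by abel]
    linarith
  have hloc : ∀ p, ‖p - x0‖ < d → p ∈ closedBall x0 d := by
    intro p hp
    rw [mem_closedBall, dist_eq_norm]; exact hp.le
  -- local part
  have hlap := hess_sum n α K L u x0 x y hxy (hR1 x hxR) (hR1 y hyR) (by
    have n1 : closedBall x0 d ∈ 𝓝 x :=
      closedBall_mem_nhds_of_mem (by rw [mem_ball, dist_eq_norm]; linarith)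
    have n2 : closedBall x0 d ∈ 𝓝 y :=
      closedBall_mem_nhds_of_mem (by rw [mem_ball, dist_eq_norm]; linarith)
    filter_upwards [prod_mem_nhds n1 n2] with p hp
    exact hmax' p.1 hp.1 p.2 hp.2)
  -- nonlocal part
  have hxn : ‖x‖ ≤ 1 := by have := mem_ball_zero_iff.1 hxR; linarith
  have hyn : ‖y‖ ≤ 1 := by have := mem_ball_zero_iff.1 hyR; linarith
  have hfr := frac_diff n hn s hs u hint x0 x y hxn hyn (hR1 x hxR) (hR1 y hyR) S K d hK0 hxS hyS
    hd0 hd1 (by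
      intro z hz
      have m1 : x + z ∈ closedBall x0 d := by
        apply hloc
        have := norm_add_le (x - x0) z
        rw [show x + z - x0 = x - x0 + z by abel]; linarith
      have m2 : y + z ∈ closedBall x0 d := by
        apply hloc
        have := norm_add_le (y - x0) z
        rw [show y + z - x0 = y - x0 + z by abel]; linarith
      have := hmax' _ m1 _ m2
      rw [show x + z - (y + z) = x - y by abel] at this
      linarith)
  rw [← hc, ← hM, ← hU] at hfr
  rw [← hQ] at hlap
  clear_value c M U K
  have hf := hO x hxR y hyR
  rw [← heq x hxR, ← heq y hyR] at hf
  have hpw : d ^ (α - 2) ≤ ‖x - y‖ ^ (α - 2) :=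
    Real.rpow_le_rpow_of_nonpos hapos (by linarith) (by linarith)
  have hmain : 4 * Q * L * d ^ (α - 2) ≤ O + 2 * n * K + c / 2 * ((2 * K + 16 * S / d ^ 2) * M +
      8 * (4 / d) ^ ((n : ℝ) + 2 * s) * U) := by
    have : 4 * Q * L * d ^ (α - 2) ≤ 4 * Q * L * ‖x - y‖ ^ (α - 2) :=
      mul_le_mul_of_nonneg_left hpw (by positivity)
    linarith
  have hLd : L * d ^ (α - 2) = N * (S / d ^ 2 + d ^ (-(n : ℝ) - 2) * U + O) := by
    have a1 : d ^ (-α) * d ^ (α - 2) = (d ^ 2)⁻¹ := by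
      rw [← Real.rpow_add hd0, ← Real.rpow_natCast, ← Real.rpow_neg hd0.le]
      congr 1; push_cast; ring
    have a2 : d ^ (-(n : ℝ) - α) * d ^ (α - 2) = d ^ (-(n : ℝ) - 2) := by
      rw [← Real.rpow_add hd0]; congr 1; ring
    have a3 : d ^ (2 - α) * d ^ (α - 2) = 1 := by
      rw [← Real.rpow_add hd0]; simp
    calc L * d ^ (α - 2) = N * ((d ^ (-α) * d ^ (α - 2)) * S +
          (d ^ (-(n : ℝ) - α) * d ^ (α - 2)) * U + (d ^ (2 - α) * d ^ (α - 2)) * O) := by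
          rw [hL]; ring
      _ = _ := by rw [a1, a2, a3]; ring
  have hq : (4 / d) ^ ((n : ℝ) + 2 * s) ≤ 4 ^ ((n : ℝ) + 2 * s) * d ^ (-(n : ℝ) - 2) := by
    rw [Real.div_rpow (by norm_num) hd0.le, div_eq_mul_inv, ← Real.rpow_neg hd0.le]
    refine mul_le_mul_of_nonneg_left ?_ (by positivity)
    exact Real.rpow_le_rpow_of_exponent_ge hd0 hd1 (by linarith [hs.2])
  set D := d ^ (-(n : ℝ) - 2) with hD
  have hD0 : 0 ≤ D := by positivity
  clear_value D
  have hSd : 0 < S / d ^ 2 := by positivity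
  have hK' : K = 32 * (S / d ^ 2) := by rw [hK]; ring
  have hS' : 16 * S / d ^ 2 = 16 * (S / d ^ 2) := by ring
  rw [mul_assoc, hLd, hK', hS'] at hmain
  set X := S / d ^ 2 with hX
  clear_value X
  have t1 : c / 2 * (8 * (4 / d) ^ ((n : ℝ) + 2 * s) * U) ≤
      c / 2 * (8 * (4 ^ ((n : ℝ) + 2 * s) * D) * U) :=
    mul_le_mul_of_nonneg_left (mul_le_mul_of_nonneg_right
      (mul_le_mul_of_nonneg_left hq (by norm_num)) hU0) (by positivity)
  have hcM : 0 ≤ 40 * c * M := by positivity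
  have hc4 : 0 ≤ 4 * c * 4 ^ ((n : ℝ) + 2 * s) := by positivity
  have hn0 : (0:ℝ) ≤ 64 * n := by positivity
  have t2 : (64 * n + 40 * c * M) * X ≤ B * X := by
    refine mul_le_mul_of_nonneg_right ?_ hSd.le
    linarith
  have t3 : (4 * c * 4 ^ ((n : ℝ) + 2 * s)) * (D * U) ≤ B * (D * U) := by
    refine mul_le_mul_of_nonneg_right ?_ (by positivity)
    linarith
  have t4 : 1 * O ≤ B * O := by
    refine mul_le_mul_of_nonneg_right ?_ hO0
    linarith
  have t5 : B * X < 4 * Q * N * X := mul_lt_mul_of_pos_right hNB hSd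
  have t6 : B * (D * U) ≤ 4 * Q * N * (D * U) :=
    mul_le_mul_of_nonneg_right hNB.le (by positivity)
  have t7 : B * O ≤ 4 * Q * N * O := mul_le_mul_of_nonneg_right hNB.le hO0
  linarith

/-- Interior Hölder estimate for the mixed operator: if `-Δu + (-Δ)ˢu = f` in `B_R`, then
`[u]_{C^α(B_r)} ≤ N((R-r)^{-α} sup_{B_R}|u| + (R-r)^{2s-α-2} sup_{B_R}|u|
  + (R-r)^{-n-α}‖u‖_{L₁(ω)} + (R-r)^{2s-α} osc_{B_R} f)`, with `N = N(n,s,α)`. -/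
theorem stmt5 (n : ℕ) (hn : 1 ≤ n) (s α : ℝ) (hs : s ∈ Ioo (0 : ℝ) 1)
    (hα : α ∈ Ioo (0 : ℝ) (min 1 (2 * s))) :
    ∃ N : ℝ, 0 < N ∧
      ∀ r R : ℝ, 1 / 2 ≤ r → r < R → R < 1 →
      ∀ u f : EuclideanSpace ℝ (Fin n) → ℝ,
        ContDiffOn ℝ 2 u (ball (0 : EuclideanSpace ℝ (Fin n)) 1) →
        Integrable (fun y : EuclideanSpace ℝ (Fin n) =>
          u y / (1 + ‖y‖ ^ ((n : ℝ) + 2 * s))) →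
        (∃ M : ℝ, ∀ x ∈ ball (0 : EuclideanSpace ℝ (Fin n)) 1, |f x| ≤ M) →
        (∀ x ∈ ball (0 : EuclideanSpace ℝ (Fin n)) R,
          -lap n u x + fracLap n s u x = f x) →
        ∀ x ∈ ball (0 : EuclideanSpace ℝ (Fin n)) r,
        ∀ y ∈ ball (0 : EuclideanSpace ℝ (Fin n)) r,
          |u x - u y| ≤
            N * ((R - r) ^ (-α) * sSup ((fun z => |u z|) '' ball (0 : EuclideanSpace ℝ (Fin n)) R)
              + (R - r) ^ (2 * s - α - 2) *
                  sSup ((fun z => |u z|) '' ball (0 : EuclideanSpace ℝ (Fin n)) R)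
              + (R - r) ^ (-(n : ℝ) - α) *
                  (∫ z : EuclideanSpace ℝ (Fin n), |u z| / (1 + ‖z‖ ^ ((n : ℝ) + 2 * s)))
              + (R - r) ^ (2 * s - α) *
                  (sSup (f '' ball (0 : EuclideanSpace ℝ (Fin n)) R)
                    - sInf (f '' ball (0 : EuclideanSpace ℝ (Fin n)) R)))
              * ‖x - y‖ ^ α := by
  have hα1 : α < 1 := hα.2.trans_le (min_le_left _ _)
  obtain ⟨N, hN2, hN⟩ := one_side n hn s α hs hα.1 hα1
  refine ⟨N, by linarith, ?_⟩
  intro r R hr hrR hR u f hu hint hf heq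
  have hcu : ContinuousOn u (closedBall (0 : EuclideanSpace ℝ (Fin n)) R) :=
    hu.continuousOn.mono (closedBall_subset_ball hR)
  have hbS : BddAbove ((fun z => |u z|) '' ball (0 : EuclideanSpace ℝ (Fin n)) R) :=
    ((isCompact_closedBall _ _).bddAbove_image hcu.abs).mono (image_mono ball_subset_closedBall)
  obtain ⟨M, hM⟩ := hf
  have hMR : ∀ x ∈ ball (0 : EuclideanSpace ℝ (Fin n)) R, |f x| ≤ M := fun x hx =>
    hM x (ball_subset_ball hR.le hx)
  have hfa : BddAbove (f '' ball (0 : EuclideanSpace ℝ (Fin n)) R) := by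
    refine ⟨M, ?_⟩
    rintro _ ⟨x, hx, rfl⟩
    exact (abs_le.1 (hMR x hx)).2
  have hfb : BddBelow (f '' ball (0 : EuclideanSpace ℝ (Fin n)) R) := by
    refine ⟨-M, ?_⟩
    rintro _ ⟨x, hx, rfl⟩
    exact (abs_le.1 (hMR x hx)).1
  set S := sSup ((fun z => |u z|) '' ball (0 : EuclideanSpace ℝ (Fin n)) R) with hSdef
  set U := ∫ z : EuclideanSpace ℝ (Fin n), |u z| / (1 + ‖z‖ ^ ((n : ℝ) + 2 * s)) with hU
  set O := sSup (f '' ball (0 : EuclideanSpace ℝ (Fin n)) R)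
                    - sInf (f '' ball (0 : EuclideanSpace ℝ (Fin n)) R) with hOdef
  have hU0 : 0 ≤ U := integral_nonneg fun z => by positivity
  have hS : ∀ x ∈ ball (0 : EuclideanSpace ℝ (Fin n)) R, |u x| ≤ S := fun x hx =>
    le_csSup hbS ⟨x, hx, rfl⟩
  have hO : ∀ x ∈ ball (0 : EuclideanSpace ℝ (Fin n)) R,
      ∀ y ∈ ball (0 : EuclideanSpace ℝ (Fin n)) R, f x - f y ≤ O := fun x hx y hy => by
    have h1 : f x ≤ sSup (f '' ball (0 : EuclideanSpace ℝ (Fin n)) R) :=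
      le_csSup hfa ⟨x, hx, rfl⟩
    have h2 : sInf (f '' ball (0 : EuclideanSpace ℝ (Fin n)) R) ≤ f y :=
      csInf_le hfb ⟨y, hy, rfl⟩
    linarith
  have h0R : (0 : EuclideanSpace ℝ (Fin n)) ∈ ball (0 : EuclideanSpace ℝ (Fin n)) R :=
    mem_ball_self (by linarith)
  have hS0 : 0 ≤ S := (abs_nonneg _).trans (hS 0 h0R)
  have hO0 : 0 ≤ O := by simpa using hO 0 h0R 0 h0R
  have hone := hN r R hr hrR hR u f S O hu hint heq hS hO hO0
  set d := R - r with hd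
  have hd0 : 0 < d := by linarith
  have hd1 : d ≤ 1 := by linarith
  have hside : ∀ x ∈ ball (0 : EuclideanSpace ℝ (Fin n)) r,
      ∀ y ∈ ball (0 : EuclideanSpace ℝ (Fin n)) r,
      u x - u y ≤ N * (d ^ (-α) * S + d ^ (2 * s - α - 2) * S + d ^ (-(n : ℝ) - α) * U
        + d ^ (2 * s - α) * O) * ‖x - y‖ ^ α := by
    intro x hx y hy
    have p1 : 0 ≤ d ^ (-α) * S := by positivity
    have p2 : 0 ≤ d ^ (2 * s - α - 2) * S := by positivity
    have p3 : 0 ≤ d ^ (-(n : ℝ) - α) * U := by positivity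
    have p4 : 0 ≤ d ^ (2 * s - α) * O := by positivity
    have hN0 : 0 ≤ N := by linarith
    by_cases hxy : y ∈ closedBall x d
    · have h1 := hone x hx y hxy
      have h2 : d ^ (2 - α) * O ≤ d ^ (2 * s - α) * O := by
        refine mul_le_mul_of_nonneg_right ?_ hO0
        exact Real.rpow_le_rpow_of_exponent_ge hd0 hd1 (by linarith [hs.2])
      refine h1.trans ?_
      refine mul_le_mul_of_nonneg_right ?_ (by positivity)
      refine mul_le_mul_of_nonneg_left ?_ hN0
      linarith
    · rw [mem_closedBall, dist_comm, dist_eq_norm, not_le] at hxy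
      have h1 : u x - u y ≤ 2 * S := by
        have a1 := hS x (ball_subset_ball hrR.le hx)
        have a2 := hS y (ball_subset_ball hrR.le hy)
        linarith [(abs_le.1 a1).2, (abs_le.1 a2).1]
      have h2 : d ^ α ≤ ‖x - y‖ ^ α := Real.rpow_le_rpow hd0.le hxy.le hα.1.le
      have h3 : d ^ (-α) * d ^ α = 1 := by
        rw [← Real.rpow_add hd0]; simp
      calc u x - u y ≤ 2 * S := h1
        _ = 2 * (d ^ (-α) * S) * d ^ α := by
          calc 2 * S = 2 * S * (d ^ (-α) * d ^ α) := by rw [h3, mul_one]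
            _ = _ := by ring
        _ ≤ N * (d ^ (-α) * S) * ‖x - y‖ ^ α := by gcongr
        _ ≤ _ := by
          refine mul_le_mul_of_nonneg_right ?_ (by positivity)
          refine mul_le_mul_of_nonneg_left ?_ hN0
          linarith
  intro x hx y hy
  rw [abs_le]
  constructor
  · have := hside y hy x hx
    rw [norm_sub_rev y x] at this
    linarith
  · exact hside x hx y hy
end
end

section
/- Let n ≥ 1, s ∈ (0,1), and f ∈ L^∞(B₁). Let u ∈ C²_loc(B₁) with ‖u‖_{L₁(ℝⁿ,ω)} < ∞ satisfy −Δu(x) + (−Δ)^s u(x) = f(x) for every x ∈ B₁. Then for any α ∈ (0, min{1, 2s}), there is a constant N = N(n, s, α) such that [u]_{C^α(B_{1/2})} ≤ N ‖u‖_{L₁(ℝⁿ,ω)} + N osc_{B₁} f. -/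
open MeasureTheory Metric Set
noncomputable section

lemma secdiff {E : Type*} [NormedAddCommGroup E] [NormedSpace ℝ E] {u : E → ℝ} {x : E}
    (hu : ContDiffAt ℝ 2 u x) {ε : ℝ} (hε : 0 < ε) :
    ∃ r > 0, ∀ z : E, ‖z‖ < r →
      |u (x + z) + u (x - z) - 2 * u x - iteratedFDeriv ℝ 2 u x ![z, z]| ≤ ε * ‖z‖ ^ 2 := by
  have h1 : ContDiffAt ℝ 1 (fderiv ℝ u) x := hu.fderiv_right (by norm_num)
  have h2 : HasFDerivAt (fderiv ℝ u) (fderiv ℝ (fderiv ℝ u) x) x :=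
    (h1.differentiableAt (by norm_num)).hasFDerivAt
  have h3 : ∀ᶠ y in nhds x, DifferentiableAt ℝ u y := by
    have := hu.eventually (by simp)
    filter_upwards [this] with y hy
    exact hy.differentiableAt (by norm_num)
  have h4 := h2.isLittleO.def (c := ε / 2) (by positivity)
  obtain ⟨r, hr, h5⟩ := Metric.eventually_nhds_iff.1 (h3.and h4)
  refine ⟨r, hr, fun z hz => ?_⟩
  set g := fderiv ℝ u
  set L := fderiv ℝ g x
  have hd : ∀ t : ℝ, |t| ≤ 1 → dist (x + t • z) x < r := by
    intro t ht
    rw [dist_eq_norm, add_sub_cancel_left, norm_smul, Real.norm_eq_abs]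
    exact lt_of_le_of_lt (mul_le_of_le_one_left (norm_nonneg _) ht) hz
  have hder : ∀ t : ℝ, |t| ≤ 1 → HasDerivAt (fun t : ℝ => u (x + t • z)) (g (x + t • z) z) t := by
    intro t ht
    have := (h5 (hd t ht)).1.hasFDerivAt
    have h6 : HasDerivAt (fun t : ℝ => x + t • z) z t := by
      simpa using ((hasDerivAt_id t).smul_const z).const_add x
    exact this.comp_hasDerivAt t h6
  have hder2 : ∀ t ∈ Icc (0:ℝ) 1, HasDerivWithinAt
      (fun t : ℝ => u (x + t • z) + u (x + (-t) • z) - t ^ 2 * L z z)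
      (g (x + t • z) z - g (x + (-t) • z) z - 2 * t * L z z) (Icc (0:ℝ) 1) t := by
    intro t ht
    have ht' : |t| ≤ 1 := abs_le.2 ⟨by linarith [ht.1], ht.2⟩
    have a := hder t ht'
    have b := (hder (-t) (by rwa [abs_neg])).scomp t (hasDerivAt_neg t)
    have c := ((hasDerivAt_pow 2 t).mul_const (L z z))
    have := ((a.add b).sub c).hasDerivWithinAt (s := Icc (0:ℝ) 1)
    convert! this using 1
    simp
    ring
  have key := norm_image_sub_le_of_norm_deriv_le_segment_01' hder2 (C := ε * ‖z‖ ^ 2) ?_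
  · rw [iteratedFDeriv_two_apply]
    simp only [one_smul, neg_smul, zero_smul, neg_zero, add_zero, Real.norm_eq_abs] at key
    simp only [Matrix.cons_val_zero, Matrix.cons_val_one]
    convert key using 2
    rw [← sub_eq_add_neg]
    ring
  · intro t ht
    have ht' : |t| ≤ 1 := abs_le.2 ⟨by linarith [ht.1], ht.2.le⟩
    have a := (h5 (hd t ht')).2
    have b := (h5 (hd (-t) (by rwa [abs_neg]))).2
    simp only [add_sub_cancel_left, norm_smul, map_smul, norm_neg] at a b
    have e : g (x + t • z) z - g (x + (-t) • z) z - 2 * t * L z z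
      = (g (x + t • z) - g x - t • L z) z - (g (x + (-t) • z) - g x - (-t) • L z) z := by
      simp; ring
    rw [e]
    have hn : ‖t‖ ≤ 1 := ht'
    have a2 := (ContinuousLinearMap.le_opNorm (g (x + t • z) - g x - t • L z) z).trans
      (mul_le_mul_of_nonneg_right a (norm_nonneg z))
    have b2 := (ContinuousLinearMap.le_opNorm (g (x + (-t) • z) - g x - (-t) • L z) z).trans
      (mul_le_mul_of_nonneg_right b (norm_nonneg z))
    refine (norm_sub_le _ _).trans ((add_le_add a2 b2).trans ?_)
    have : ‖t‖ * (ε * ‖z‖ ^ 2) ≤ ε * ‖z‖ ^ 2 := mul_le_of_le_one_left (by positivity) hn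
    nlinarith

lemma dir_comp {E : Type*} [NormedAddCommGroup E] [InnerProductSpace ℝ E] {u : E → ℝ}
    {x y x0 e v w : E} {K A δ c r : ℝ} (hx : ContDiffAt ℝ 2 u x) (hy : ContDiffAt ℝ 2 u y)
    (he : ‖e‖ = 1) (hv : ‖v‖ = 1) (hw : ‖w‖ = 1) (hδ : 0 < δ) (hxy : x - y = δ • e)
    (hvw : v - w = (2 * c) • e) (hr : 0 < r)
    (hmax : ∀ a b : E, ‖a‖ < r → ‖b‖ < r →
      u (x + a) - u (y + b) - K * (4 * ‖x + a - (y + b)‖ - ‖x + a - (y + b)‖ ^ 2)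
        - A * ‖x + a - x0‖ ^ 2 - A * ‖y + b - x0‖ ^ 2
      ≤ u x - u y - K * (4 * ‖x - y‖ - ‖x - y‖ ^ 2) - A * ‖x - x0‖ ^ 2 - A * ‖y - x0‖ ^ 2) :
    iteratedFDeriv ℝ 2 u x ![v, v] - iteratedFDeriv ℝ 2 u y ![w, w] ≤ -8 * K * c ^ 2 + 4 * A := by
  refine le_of_forall_pos_le_add fun ε hε => ?_
  obtain ⟨r1, hr1, h1⟩ := secdiff hx (half_pos hε)
  obtain ⟨r2, hr2, h2⟩ := secdiff hy (half_pos hε)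
  have hc : 0 < δ / (2 * |c| + 1) := by positivity
  obtain ⟨t, ht, htm⟩ : ∃ t : ℝ, 0 < t ∧ t < min (min r r1) (min r2 (δ / (2 * |c| + 1))) :=
    exists_between (by simp [hr, hr1, hr2, hc])
  simp only [lt_min_iff] at htm
  obtain ⟨⟨t0, t1⟩, t2, t3⟩ := htm
  rw [lt_div_iff₀ (by positivity)] at t3
  have nv : ‖t • v‖ = t := by rw [norm_smul, hv, Real.norm_eq_abs, abs_of_pos ht, mul_one]
  have nw : ‖t • w‖ = t := by rw [norm_smul, hw, Real.norm_eq_abs, abs_of_pos ht, mul_one]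
  have s1 := h1 (t • v) (by rwa [nv])
  have s2 := h2 (t • w) (by rwa [nw])
  have m1 := hmax (t • v) (t • w) (by rwa [nv]) (by rwa [nw])
  have m2 := hmax (-(t • v)) (-(t • w)) (by rwa [norm_neg, nv]) (by rwa [norm_neg, nw])
  have htc : |t * (2 * c)| < δ := by
    rw [abs_mul, abs_mul, abs_of_pos ht, abs_two]; nlinarith [abs_nonneg c]
  have q1 : ‖x + t • v - (y + t • w)‖ = δ + t * (2 * c) := by
    have : x + t • v - (y + t • w) = (δ + t * (2 * c)) • e := by
      rw [add_smul, ← hxy, mul_smul, ← hvw, smul_sub]; abel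
    rw [this, norm_smul, he, mul_one, Real.norm_eq_abs, abs_of_pos]
    linarith [(abs_lt.1 htc).1]
  have q2 : ‖x + -(t • v) - (y + -(t • w))‖ = δ - t * (2 * c) := by
    have : x + -(t • v) - (y + -(t • w)) = (δ - t * (2 * c)) • e := by
      rw [sub_smul, ← hxy, mul_smul, ← hvw, smul_sub]; abel
    rw [this, norm_smul, he, mul_one, Real.norm_eq_abs, abs_of_pos]
    linarith [(abs_lt.1 htc).2]
  have q0 : ‖x - y‖ = δ := by rw [hxy, norm_smul, he, mul_one, Real.norm_eq_abs, abs_of_pos hδ]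
  have par : ∀ p a : E, ‖p + a - x0‖ ^ 2 + ‖p + -a - x0‖ ^ 2 = 2 * ‖p - x0‖ ^ 2 + 2 * ‖a‖ ^ 2 := by
    intro p a
    have := parallelogram_law_with_norm ℝ (p - x0) a
    rw [show p + a - x0 = p - x0 + a by abel, show p + -a - x0 = p - x0 - a by abel]
    simp only [pow_two]
    linarith
  have p1 := par x (t • v)
  have p2 := par y (t • w)
  rw [q1, q0] at m1
  rw [q2, q0] at m2
  rw [nv] at p1 s1
  rw [nw] at p2 s2
  have hom : ∀ (p a : E), iteratedFDeriv ℝ 2 u p ![t • a, t • a]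
      = t ^ 2 * iteratedFDeriv ℝ 2 u p ![a, a] := by
    intro p a
    simp only [iteratedFDeriv_two_apply, Matrix.cons_val_zero, Matrix.cons_val_one, map_smul,
      _root_.smul_apply, smul_eq_mul]
    ring
  rw [hom] at s1 s2
  rw [sub_eq_add_neg] at s1 s2
  simp only [sub_eq_add_neg x, sub_eq_add_neg y] at s1 s2
  have s1' := (abs_le.1 s1).1
  have s2' := (abs_le.1 s2).2
  have hA : A * (‖x + t • v - x0‖ ^ 2 + ‖x + -(t • v) - x0‖ ^ 2)
    = A * (2 * ‖x - x0‖ ^ 2 + 2 * t ^ 2) := by rw [p1]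
  have hA' : A * (‖y + t • w - x0‖ ^ 2 + ‖y + -(t • w) - x0‖ ^ 2)
    = A * (2 * ‖y - x0‖ ^ 2 + 2 * t ^ 2) := by rw [p2]
  have fin : t ^ 2 * (iteratedFDeriv ℝ 2 u x ![v, v] - iteratedFDeriv ℝ 2 u y ![w, w])
     ≤ t ^ 2 * (-8 * K * c ^ 2 + 4 * A + ε) := by linarith
  exact le_of_mul_le_mul_left fin (by positivity)

lemma lap_comp {n : ℕ} {u : EuclideanSpace ℝ (Fin n) → ℝ}
    {x y x0 : EuclideanSpace ℝ (Fin n)} {K A r : ℝ}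
    (hx : ContDiffAt ℝ 2 u x) (hy : ContDiffAt ℝ 2 u y) (hxy : x ≠ y) (hr : 0 < r)
    (hmax : ∀ a b : EuclideanSpace ℝ (Fin n), ‖a‖ < r → ‖b‖ < r →
      u (x + a) - u (y + b) - K * (4 * ‖x + a - (y + b)‖ - ‖x + a - (y + b)‖ ^ 2)
        - A * ‖x + a - x0‖ ^ 2 - A * ‖y + b - x0‖ ^ 2
      ≤ u x - u y - K * (4 * ‖x - y‖ - ‖x - y‖ ^ 2) - A * ‖x - x0‖ ^ 2 - A * ‖y - x0‖ ^ 2) :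
    lap n u x - lap n u y ≤ -8 * K + 4 * n * A := by
  have hd : 0 < ‖x - y‖ := norm_pos_iff.2 (sub_ne_zero.2 hxy)
  set e : EuclideanSpace ℝ (Fin n) := ‖x - y‖⁻¹ • (x - y) with he
  have hne : ‖e‖ = 1 := by
    rw [he, norm_smul, norm_inv, norm_norm, inv_mul_cancel₀ hd.ne']
  set b := EuclideanSpace.basisFun (Fin n) ℝ with hb
  set R := (Submodule.span ℝ {e}).reflection with hR
  set b' := b.map (R.trans (LinearIsometryEquiv.neg ℝ)) with hb'
  have hb'i : ∀ i, b i - b' i = (2 * inner ℝ e (b i)) • e := by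
    intro i
    simp only [hb', OrthonormalBasis.map_apply, LinearIsometryEquiv.trans_apply, hR,
      LinearIsometryEquiv.coe_neg, Submodule.reflection_singleton_apply, hne]
    simp only [RCLike.ofReal_one, one_pow, div_one, mul_smul, two_smul]
    abel
  have e1 : lap n u x = ∑ i, iteratedFDeriv ℝ 2 u x ![b i, b i] := by
    simp [lap, hb]
  have e2 : lap n u y = ∑ i, iteratedFDeriv ℝ 2 u y ![b' i, b' i] := by
    have h1 := congrFun (InnerProductSpace.laplacian_eq_iteratedFDeriv_orthonormalBasis u b) y
    have h2 := congrFun (InnerProductSpace.laplacian_eq_iteratedFDeriv_orthonormalBasis u b') y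
    rw [← h2, h1]
    simp [lap, hb]
  have hs : ∑ i, (inner ℝ e (b i)) ^ 2 = 1 := by
    have := b.sum_sq_norm_inner_left e
    simpa [hne] using this
  rw [e1, e2, ← Finset.sum_sub_distrib]
  calc _ ≤ ∑ i, (-8 * K * (inner ℝ e (b i)) ^ 2 + 4 * A) := by
        refine Finset.sum_le_sum fun i _ => ?_
        refine dir_comp hx hy hne (b.orthonormal.1 i) (b'.orthonormal.1 i) hd ?_ (hb'i i) hr hmax
        rw [he, smul_smul, mul_inv_cancel₀ hd.ne', one_smul]
    _ = _ := by
        rw [Finset.sum_add_distrib, ← Finset.mul_sum, hs]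
        simp; ring

lemma tail_ineq {E : Type*} [NormedAddCommGroup E] {x z : E} {ρ p : ℝ} (hx : ‖x‖ ≤ 1)
    (hρ : 0 < ρ) (hρ1 : ρ ≤ 1) (hp : 0 ≤ p) (hz : ρ / 2 ≤ ‖z‖) :
    1 + ‖x + z‖ ^ p ≤ 2 * (3 / ρ) ^ p * ‖z‖ ^ p := by
  have h3 : 1 + ‖z‖ ≤ 3 / ρ * ‖z‖ := by
    rw [div_mul_eq_mul_div, le_div_iff₀ hρ]; nlinarith [norm_nonneg z]
  have h1 : (1:ℝ) ≤ (3 / ρ * ‖z‖) ^ p := Real.one_le_rpow (by linarith [norm_nonneg z]) hp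
  have h2 : ‖x + z‖ ^ p ≤ (3 / ρ * ‖z‖) ^ p :=
    Real.rpow_le_rpow (norm_nonneg _) ((norm_add_le _ _).trans (by linarith)) hp
  rw [Real.mul_rpow (by positivity) (norm_nonneg z)] at h1 h2
  linarith

lemma tail_bound {E : Type*} [NormedAddCommGroup E] {x z : E} {ρ p : ℝ} (hx : ‖x‖ ≤ 1)
    (hρ : 0 < ρ) (hρ1 : ρ ≤ 1) (hp : 0 ≤ p) (hz : ρ / 2 ≤ ‖z‖) (u : E → ℝ) :
    |u (x + z)| / ‖z‖ ^ p ≤ 2 * (3 / ρ) ^ p * (|u (x + z)| / (1 + ‖x + z‖ ^ p)) := by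
  have h := tail_ineq hx hρ hρ1 hp hz
  have hz0 : 0 < ‖z‖ := by linarith
  have h1 : 0 < ‖z‖ ^ p := Real.rpow_pos_of_pos hz0 p
  have h2 : 0 < 1 + ‖x + z‖ ^ p := by positivity
  rw [← mul_div_assoc, div_le_div_iff₀ h1 h2]
  nlinarith [abs_nonneg (u (x + z)), mul_le_mul_of_nonneg_left h (abs_nonneg (u (x + z)))]

lemma tail_bound' {E : Type*} [NormedAddCommGroup E] {x z : E} {ρ p : ℝ} (hx : ‖x‖ ≤ 1)
    (hρ : 0 < ρ) (hρ1 : ρ ≤ 1) (hp : 0 ≤ p) (hz : ρ / 2 ≤ ‖z‖) (u : E → ℝ) :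
    |u (x - z)| / ‖z‖ ^ p ≤ 2 * (3 / ρ) ^ p * (|u (x - z)| / (1 + ‖x - z‖ ^ p)) := by
  have := tail_bound (z := -z) hx hρ hρ1 hp (by rwa [norm_neg]) u
  simpa [sub_eq_add_neg] using this

lemma near_integrable {n : ℕ} (hn : 1 ≤ n) {s : ℝ} (hs : s ∈ Ioo (0 : ℝ) 1) (r : ℝ) :
    IntegrableOn (fun z : EuclideanSpace ℝ (Fin n) => ‖z‖ ^ (2 - ((n : ℝ) + 2 * s)))
      (ball 0 r) := by
  refine integrableOn_ball_of_norm_le_rpow (C := 1) (α := (n : ℝ) + 2 * s - 2) (by simpa using hn)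
    (by simp; linarith [hs.2]) (Filter.Eventually.of_forall fun z => ?_) ?_
  · rw [Real.norm_eq_abs, abs_of_nonneg (by positivity), one_mul, neg_sub]
  · exact (measurable_norm.pow_const _).aestronglyMeasurable

lemma near_bound {E : Type*} [NormedAddCommGroup E] {z : E} {p a C : ℝ} (hC : 0 ≤ C)
    (h : |a| ≤ C * ‖z‖ ^ 2) : |a| / ‖z‖ ^ p ≤ C * ‖z‖ ^ (2 - p) := by
  rcases eq_or_ne z 0 with rfl | hz
  · have : |a| = 0 := le_antisymm (by simpa using h) (abs_nonneg a)
    rw [this, zero_div]; positivity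
  · have hz0 : 0 < ‖z‖ := norm_pos_iff.2 hz
    rw [Real.rpow_sub hz0, ← mul_div_assoc]
    have : ‖z‖ ^ (2:ℝ) = ‖z‖ ^ 2 := by norm_cast
    rw [this]
    gcongr

lemma weight_meas {n : ℕ} {p : ℝ} {u : EuclideanSpace ℝ (Fin n) → ℝ}
    (hInt : Integrable (fun y : EuclideanSpace ℝ (Fin n) => u y / (1 + ‖y‖ ^ p))) :
    AEStronglyMeasurable u := by
  have h : Measurable (fun y : EuclideanSpace ℝ (Fin n) => (1 + ‖y‖ ^ p)) :=
    (measurable_norm.pow_const _).const_add 1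
  have := hInt.aestronglyMeasurable.mul h.aestronglyMeasurable
  refine this.congr (Filter.Eventually.of_forall fun y => ?_)
  have : 0 < 1 + ‖y‖ ^ p := by positivity
  simp only [Pi.mul_apply]
  field_simp

lemma weight_int {n : ℕ} {p : ℝ} {u : EuclideanSpace ℝ (Fin n) → ℝ}
    (hInt : Integrable (fun y : EuclideanSpace ℝ (Fin n) => u y / (1 + ‖y‖ ^ p))) :
    Integrable (fun y : EuclideanSpace ℝ (Fin n) => |u y| / (1 + ‖y‖ ^ p)) := by
  refine hInt.abs.congr (Filter.Eventually.of_forall fun y => ?_)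
  simp only
  rw [abs_div, abs_of_pos (a := 1 + ‖y‖ ^ p) (by positivity)]

lemma frac_int {n : ℕ} (hn : 1 ≤ n) {s : ℝ} (hs : s ∈ Ioo (0 : ℝ) 1)
    {u : EuclideanSpace ℝ (Fin n) → ℝ} {x : EuclideanSpace ℝ (Fin n)}
    (hInt : Integrable (fun y : EuclideanSpace ℝ (Fin n) => u y / (1 + ‖y‖ ^ ((n : ℝ) + 2 * s))))
    (hx : ContDiffAt ℝ 2 u x) (hx1 : ‖x‖ ≤ 1) :
    Integrable (fun z : EuclideanSpace ℝ (Fin n) =>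
      (2 * u x - u (x + z) - u (x - z)) / ‖z‖ ^ ((n : ℝ) + 2 * s)) := by
  obtain ⟨r, hr, h⟩ := secdiff hx one_pos
  have hs0 := hs.1
  have hp : 0 ≤ (n : ℝ) + 2 * s := by positivity
  have hpn : (Module.finrank ℝ (EuclideanSpace ℝ (Fin n)) : ℝ) < (n : ℝ) + 2 * s := by
    simpa using hs0
  set p := (n : ℝ) + 2 * s with hpdef
  set ρ := min r 1 with hρdef
  have hρ : 0 < ρ := lt_min hr one_pos
  have hρ1 : ρ ≤ 1 := min_le_right _ _
  set C := ‖iteratedFDeriv ℝ 2 u x‖ + 1 with hC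
  have hC0 : 0 ≤ C := by positivity
  have hW := weight_int hInt
  set W := fun y : EuclideanSpace ℝ (Fin n) => |u y| / (1 + ‖y‖ ^ p) with hWd
  have hW1 : Integrable (fun z => W (x + z)) := hW.comp_add_left x
  have hW2 : Integrable (fun z => W (x - z)) := hW.comp_sub_left x
  have hJ := integrable_one_add_norm (μ := (volume : Measure (EuclideanSpace ℝ (Fin n)))) hpn
  have hN := (near_integrable hn hs ρ).integrable_indicator measurableSet_ball
  have hm := weight_meas hInt
  have hm1 : AEStronglyMeasurable (fun z => u (x + z)) :=
    hm.comp_quasiMeasurePreserving (quasiMeasurePreserving_add_left volume x)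
  have hm2 : AEStronglyMeasurable (fun z => u (x - z)) :=
    hm.comp_quasiMeasurePreserving (quasiMeasurePreserving_sub_left volume x)
  have hpm : Measurable (fun y : EuclideanSpace ℝ (Fin n) => ‖y‖ ^ p) :=
    measurable_norm.pow_const _
  refine Integrable.mono' (((hN.const_mul C).add (hJ.const_mul (2 * |u x| * (3 / ρ) ^ p))).add
    ((hW1.add hW2).const_mul (2 * (3 / ρ) ^ p)))
    (((aestronglyMeasurable_const.sub hm1).sub hm2).aemeasurable.div
      hpm.aemeasurable).aestronglyMeasurable
    (Filter.Eventually.of_forall fun z => ?_)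
  simp only [Pi.add_apply]
  have W0 : ∀ y, 0 ≤ W y := fun y => by positivity
  have hK : 0 ≤ (3 / ρ) ^ p := by positivity
  rw [Real.norm_eq_abs, abs_div, abs_of_nonneg (a := ‖z‖ ^ p) (by positivity)]
  by_cases hz : ‖z‖ < ρ
  · rw [indicator_of_mem (by simpa using hz)]
    have b1 : |2 * u x - u (x + z) - u (x - z)| ≤ C * ‖z‖ ^ 2 := by
      have h1 := h z (hz.trans_le (min_le_left _ _))
      have h2 : |iteratedFDeriv ℝ 2 u x ![z, z]| ≤ ‖iteratedFDeriv ℝ 2 u x‖ * ‖z‖ ^ 2 := by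
        have := (iteratedFDeriv ℝ 2 u x).le_opNorm ![z, z]
        simpa [Fin.prod_univ_two, pow_two] using this
      rw [abs_le] at h1 h2 ⊢
      constructor <;> nlinarith
    have b2 := near_bound (p := p) hC0 b1
    have : 0 ≤ (1 + ‖z‖) ^ (-p) := by positivity
    have := mul_nonneg (mul_nonneg (mul_nonneg zero_le_two (abs_nonneg (u x))) hK) this
    have := mul_nonneg (mul_nonneg zero_le_two hK) (add_nonneg (W0 (x + z)) (W0 (x - z)))
    linarith
  · push Not at hz
    rw [indicator_of_notMem (by simpa using hz)]
    have hz2 : ρ / 2 ≤ ‖z‖ := by linarith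
    have hz0 : 0 < ‖z‖ := by linarith
    have c1 := tail_bound hx1 hρ hρ1 hp hz2 u
    have c2 := tail_bound' hx1 hρ hρ1 hp hz2 u
    have c3 : 1 / ‖z‖ ^ p ≤ (3 / ρ) ^ p * (1 + ‖z‖) ^ (-p) := by
      have h3 : 1 + ‖z‖ ≤ 3 / ρ * ‖z‖ := by
        rw [div_mul_eq_mul_div, le_div_iff₀ hρ]; nlinarith [norm_nonneg z]
      have h4 : (1 + ‖z‖) ^ p ≤ (3 / ρ * ‖z‖) ^ p :=
        Real.rpow_le_rpow (by positivity) h3 hp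
      rw [Real.mul_rpow (by positivity) (norm_nonneg z)] at h4
      rw [Real.rpow_neg (by positivity), ← div_eq_mul_inv, div_le_div_iff₀ (by positivity)
        (by positivity)]
      linarith
    have c4 := mul_le_mul_of_nonneg_left c3 (mul_nonneg zero_le_two (abs_nonneg (u x)))
    have c5 : |2 * u x - u (x + z) - u (x - z)| ≤ 2 * |u x| + |u (x + z)| + |u (x - z)| := by
      refine (abs_sub _ _).trans ?_
      have := abs_sub (2 * u x) (u (x + z))
      rw [abs_mul, abs_two] at this
      linarith
    have c6 := div_le_div_of_nonneg_right c5 (c := ‖z‖ ^ p) (by positivity)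
    rw [add_div, add_div] at c6
    have c7 : 2 * |u x| / ‖z‖ ^ p = 2 * |u x| * (1 / ‖z‖ ^ p) := by ring
    have c8 : 2 * (3 / ρ) ^ p * (W (x + z) + W (x - z))
      = 2 * (3 / ρ) ^ p * W (x + z) + 2 * (3 / ρ) ^ p * W (x - z) := by ring
    rw [c8]
    simp only [hWd]
    linarith

lemma const_nonneg {n : ℕ} {s : ℝ} (hs : s ∈ Ioo (0 : ℝ) 1) : 0 ≤ fracLapConst n s := by
  have h1 := Real.Gamma_pos_of_pos (s := (n : ℝ) / 2 + s) (by have := hs.1; positivity)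
  have h2 := Real.Gamma_pos_of_pos (s := 1 - s) (by linarith [hs.2])
  have h3 := hs.1
  unfold fracLapConst
  have := Real.pi_pos
  positivity

lemma frac_comp {n : ℕ} (hn : 1 ≤ n) {s : ℝ} (hs : s ∈ Ioo (0 : ℝ) 1)
    {u : EuclideanSpace ℝ (Fin n) → ℝ} {x y : EuclideanSpace ℝ (Fin n)} {A ρ : ℝ}
    (hInt : Integrable (fun y : EuclideanSpace ℝ (Fin n) => u y / (1 + ‖y‖ ^ ((n : ℝ) + 2 * s))))
    (hx : ContDiffAt ℝ 2 u x) (hx1 : ‖x‖ ≤ 1) (hy : ContDiffAt ℝ 2 u y) (hy1 : ‖y‖ ≤ 1)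
    (hA : 0 ≤ A) (hρ : 0 < ρ) (hρ1 : ρ ≤ 1) (hpos : u y ≤ u x)
    (hnear : ∀ z : EuclideanSpace ℝ (Fin n), ‖z‖ < ρ / 2 →
      (u (x + z) - u (y + z)) + (u (x - z) - u (y - z)) - 2 * (u x - u y) ≤ 4 * A * ‖z‖ ^ 2) :
    fracLap n s u y - fracLap n s u x ≤ fracLapConst n s / 2 *
      (4 * A * (∫ z in ball (0 : EuclideanSpace ℝ (Fin n)) 1, ‖z‖ ^ (2 - ((n : ℝ) + 2 * s)))
        + 8 * (3 / ρ) ^ ((n : ℝ) + 2 * s) *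
          ∫ z : EuclideanSpace ℝ (Fin n), |u z| / (1 + ‖z‖ ^ ((n : ℝ) + 2 * s))) := by
  have ix := frac_int hn hs hInt hx hx1
  have iy := frac_int hn hs hInt hy hy1
  have hs0 := hs.1
  have hp : 0 ≤ (n : ℝ) + 2 * s := by positivity
  unfold fracLap
  have hN := (near_integrable hn hs 1).integrable_indicator measurableSet_ball
  have hW := weight_int hInt
  set p := (n : ℝ) + 2 * s with hpdef
  set W := fun y : EuclideanSpace ℝ (Fin n) => |u y| / (1 + ‖y‖ ^ p) with hWd
  have hc := const_nonneg (n := n) hs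
  rw [← mul_sub, ← integral_sub iy ix]
  refine mul_le_mul_of_nonneg_left ?_ (by positivity)
  have W1 : Integrable (fun z => W (x + z)) := hW.comp_add_left x
  have W2 : Integrable (fun z => W (x - z)) := hW.comp_sub_left x
  have W3 : Integrable (fun z => W (y + z)) := hW.comp_add_left y
  have W4 : Integrable (fun z => W (y - z)) := hW.comp_sub_left y
  have W12 : Integrable (fun z => W (x + z) + W (x - z)) := W1.add W2
  have W34 : Integrable (fun z => W (y + z) + W (y - z)) := W3.add W4
  have W1234 : Integrable (fun z => (W (x + z) + W (x - z)) + (W (y + z) + W (y - z))) :=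
    W12.add W34
  have hD : ∫ z, (4 * A * (ball (0 : EuclideanSpace ℝ (Fin n)) 1).indicator
        (fun z => ‖z‖ ^ (2 - p)) z + 2 * (3 / ρ) ^ p *
        ((W (x + z) + W (x - z)) + (W (y + z) + W (y - z)))) =
      4 * A * (∫ z in ball (0 : EuclideanSpace ℝ (Fin n)) 1, ‖z‖ ^ (2 - p))
        + 8 * (3 / ρ) ^ p * ∫ z, W z := by
    rw [integral_add (hN.const_mul _) (W1234.const_mul _),
      integral_const_mul, integral_const_mul, integral_indicator measurableSet_ball,
      integral_add W12 W34, integral_add W1 W2, integral_add W3 W4,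
      integral_add_left_eq_self W, integral_add_left_eq_self W, integral_sub_left_eq_self W,
      integral_sub_left_eq_self W]
    ring
  rw [← hD]
  refine integral_mono (iy.sub ix)
    ((hN.const_mul _).add (W1234.const_mul _)) fun z => ?_
  simp only
  have W0 : ∀ y, 0 ≤ W y := fun y => by positivity
  have hK : 0 ≤ (3 / ρ) ^ p := by positivity
  have hzp : 0 ≤ ‖z‖ ^ p := by positivity
  rw [← sub_div]
  set G := 2 * u y - u (y + z) - u (y - z) - (2 * u x - u (x + z) - u (x - z)) with hG
  by_cases hz : ‖z‖ < ρ / 2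
  · rw [indicator_of_mem (by simp; linarith)]
    have h1 : G ≤ 4 * A * ‖z‖ ^ 2 := by have := hnear z hz; linarith
    have h2 : |max G 0| ≤ 4 * A * ‖z‖ ^ 2 := by
      rw [abs_of_nonneg (le_max_right _ _)]
      exact max_le h1 (by positivity)
    have h3 := near_bound (p := p) (by positivity) h2
    have h4 : G / ‖z‖ ^ p ≤ |max G 0| / ‖z‖ ^ p :=
      div_le_div_of_nonneg_right ((le_max_left _ _).trans (le_abs_self _)) hzp
    have := mul_nonneg (mul_nonneg zero_le_two hK) (add_nonneg
      (add_nonneg (W0 (x + z)) (W0 (x - z))) (add_nonneg (W0 (y + z)) (W0 (y - z))))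
    linarith
  · push Not at hz
    have c1 := tail_bound hx1 hρ hρ1 hp hz u
    have c2 := tail_bound' hx1 hρ hρ1 hp hz u
    have c3 := tail_bound hy1 hρ hρ1 hp hz u
    have c4 := tail_bound' hy1 hρ hρ1 hp hz u
    have h1 : G ≤ |u (x + z)| + |u (x - z)| + |u (y + z)| + |u (y - z)| := by
      have := le_abs_self (u (x + z))
      have := le_abs_self (u (x - z))
      have := neg_abs_le (u (y + z))
      have := neg_abs_le (u (y - z))
      linarith
    have h2 := div_le_div_of_nonneg_right h1 hzp
    rw [add_div, add_div, add_div] at h2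
    have h5 : 0 ≤ 4 * A * (ball (0 : EuclideanSpace ℝ (Fin n)) 1).indicator
        (fun z => ‖z‖ ^ (2 - p)) z :=
      mul_nonneg (by positivity) (indicator_nonneg (fun z _ => by positivity) z)
    rw [mul_add, mul_add, mul_add]
    simp only [hWd]
    linarith

set_option maxHeartbeats 1000000 in
lemma lip_pos {n : ℕ} (hn : 1 ≤ n) {s : ℝ} (hs : s ∈ Ioo (0 : ℝ) 1) :
    ∃ C : ℝ, 1 ≤ C ∧ ∀ u f : EuclideanSpace ℝ (Fin n) → ℝ,
      ContDiffOn ℝ 2 u (ball (0 : EuclideanSpace ℝ (Fin n)) 1) →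
      Integrable (fun y : EuclideanSpace ℝ (Fin n) => u y / (1 + ‖y‖ ^ ((n : ℝ) + 2 * s))) →
      (∀ x ∈ ball (0 : EuclideanSpace ℝ (Fin n)) 1, -lap n u x + fracLap n s u x = f x) →
      ∀ F : ℝ, 0 ≤ F → (∀ x ∈ ball (0 : EuclideanSpace ℝ (Fin n)) 1,
        ∀ y ∈ ball (0 : EuclideanSpace ℝ (Fin n)) 1, f x - f y ≤ F) →
      ∀ (x0 : EuclideanSpace ℝ (Fin n)) (ρ M : ℝ), 0 < ρ → ρ ≤ 1 → 0 < M →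
        closedBall x0 ρ ⊆ ball (0 : EuclideanSpace ℝ (Fin n)) 1 →
        (∀ x ∈ closedBall x0 ρ, |u x| ≤ M) →
        ∀ x ∈ closedBall x0 ρ, |u x - u x0| ≤ C / ρ ^ (n + 2) *
          (M + (∫ z : EuclideanSpace ℝ (Fin n), |u z| / (1 + ‖z‖ ^ ((n : ℝ) + 2 * s))) + F)
            * ‖x - x0‖ := by
  have hc := const_nonneg (n := n) hs
  set c := fracLapConst n s with hcd
  set Cs := ∫ z in ball (0 : EuclideanSpace ℝ (Fin n)) 1, ‖z‖ ^ (2 - ((n : ℝ) + 2 * s)) with hCsd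
  have hCs : 0 ≤ Cs := integral_nonneg fun z => by positivity
  clear_value Cs c
  set C1 : ℝ := 1 + 32 * n + 16 * c * Cs + 4 * c * 3 ^ (n + 2) with hC1d
  have hC1 : 1 ≤ C1 := by
    have : 0 ≤ 32 * (n : ℝ) + 16 * c * Cs + 4 * c * 3 ^ (n + 2) := by positivity
    linarith
  refine ⟨4 * C1 + 8, by linarith, ?_⟩
  intro u f hu hInt heq F hF hf x0 ρ M hρ hρ1 hM hsub hub
  set I := ∫ z : EuclideanSpace ℝ (Fin n), |u z| / (1 + ‖z‖ ^ ((n : ℝ) + 2 * s)) with hId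
  have hI : 0 ≤ I := integral_nonneg fun z => by positivity
  clear_value I
  set T : ℝ := 1 / ρ ^ (n + 2) with hT
  have hT1 : 1 ≤ T := by
    rw [hT, le_div_iff₀ (by positivity), one_mul]; exact pow_le_one₀ hρ.le hρ1
  set A := 8 * M / ρ ^ 2 with hAd
  have hA : 0 < A := by positivity
  have hAT : A ≤ 8 * M * T := by
    rw [hAd, hT, mul_one_div]
    exact div_le_div_of_nonneg_left (by positivity) (by positivity)
      (pow_le_pow_of_le_one hρ.le hρ1 (by omega))
  have hAρ : A * (ρ / 2) ^ 2 = 2 * M := by rw [hAd]; field_simp; norm_num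
  have hPT : (3 / ρ) ^ ((n : ℝ) + 2 * s) ≤ 3 ^ (n + 2) * T := by
    have h3 : 1 ≤ 3 / ρ := by rw [le_div_iff₀ hρ]; linarith
    have : (3 / ρ) ^ ((n : ℝ) + 2 * s) ≤ (3 / ρ) ^ (((n + 2 : ℕ)) : ℝ) := by
      apply Real.rpow_le_rpow_of_exponent_le h3
      push_cast; linarith [hs.2]
    rw [Real.rpow_natCast, div_pow] at this
    rw [hT, mul_one_div]; exact this
  set K := C1 * T * (M + I + F) with hKd
  have hT0 : 0 < T := by linarith
  have hC10 : 0 < C1 := by linarith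
  have hK : 0 < K := by positivity
  clear_value K A T C1
  set Φ : EuclideanSpace ℝ (Fin n) × EuclideanSpace ℝ (Fin n) → ℝ := fun q =>
    u q.1 - u q.2 - K * (4 * ‖q.1 - q.2‖ - ‖q.1 - q.2‖ ^ 2) - A * ‖q.1 - x0‖ ^ 2
      - A * ‖q.2 - x0‖ ^ 2 with hΦ
  have hcont : ContinuousOn u (closedBall x0 ρ) := hu.continuousOn.mono hsub
  have hΦc : ContinuousOn Φ (closedBall x0 ρ ×ˢ closedBall x0 ρ) := by
    have h1 : ContinuousOn (fun q : EuclideanSpace ℝ (Fin n) × EuclideanSpace ℝ (Fin n) => u q.1)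
      (closedBall x0 ρ ×ˢ closedBall x0 ρ) :=
      hcont.comp continuousOn_fst fun q hq => hq.1
    have h2 : ContinuousOn (fun q : EuclideanSpace ℝ (Fin n) × EuclideanSpace ℝ (Fin n) => u q.2)
      (closedBall x0 ρ ×ˢ closedBall x0 ρ) :=
      hcont.comp continuousOn_snd fun q hq => hq.2
    refine (((h1.sub h2).sub ?_).sub ?_).sub ?_ <;> exact Continuous.continuousOn (by fun_prop)
  have hx0 : x0 ∈ closedBall x0 ρ := mem_closedBall_self hρ.le
  have main : ∀ x ∈ closedBall x0 ρ, ∀ y ∈ closedBall x0 ρ, Φ (x, y) ≤ 0 := by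
    obtain ⟨⟨x, y⟩, hxy, hmax⟩ := ((isCompact_closedBall x0 ρ).prod
      (isCompact_closedBall x0 ρ)).exists_isMaxOn ⟨(x0, x0), hx0, hx0⟩ hΦc
    by_contra! hcon
    obtain ⟨x', hx', y', hy', hpos'⟩ := hcon
    have hpos : 0 < Φ (x, y) := hpos'.trans_le (hmax ⟨hx', hy'⟩)
    have hxc : x ∈ closedBall x0 ρ := hxy.1
    have hyc : y ∈ closedBall x0 ρ := hxy.2
    have hφ : 0 ≤ K * (4 * ‖x - y‖ - ‖x - y‖ ^ 2) := by
      have : ‖x - y‖ ≤ 2 := by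
        rw [← dist_eq_norm]
        have := dist_triangle_right x y x0
        rw [mem_closedBall] at hxc hyc
        linarith
      have := norm_nonneg (x - y)
      apply mul_nonneg hK.le; nlinarith
    have hP := hpos
    simp only [hΦ] at hP
    have hux := abs_le.1 (hub x hxc)
    have huy := abs_le.1 (hub y hyc)
    have ax : 0 ≤ A * ‖x - x0‖ ^ 2 := by positivity
    have ay : 0 ≤ A * ‖y - x0‖ ^ 2 := by positivity
    have hxr : ‖x - x0‖ < ρ / 2 := by
      have : A * ‖x - x0‖ ^ 2 < A * (ρ / 2) ^ 2 := by rw [hAρ]; linarith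
      exact lt_of_pow_lt_pow_left₀ 2 (by positivity) (lt_of_mul_lt_mul_left this hA.le)
    have hyr : ‖y - x0‖ < ρ / 2 := by
      have : A * ‖y - x0‖ ^ 2 < A * (ρ / 2) ^ 2 := by rw [hAρ]; linarith
      exact lt_of_pow_lt_pow_left₀ 2 (by positivity) (lt_of_mul_lt_mul_left this hA.le)
    have hne : x ≠ y := by
      rintro rfl
      simp at hP
      linarith
    have hxB := hsub hxc
    have hyB := hsub hyc
    have cx : ContDiffAt ℝ 2 u x := hu.contDiffAt (isOpen_ball.mem_nhds hxB)
    have cy : ContDiffAt ℝ 2 u y := hu.contDiffAt (isOpen_ball.mem_nhds hyB)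
    have hin : ∀ p a : EuclideanSpace ℝ (Fin n), ‖p - x0‖ < ρ / 2 → ‖a‖ < ρ / 2 →
        p + a ∈ closedBall x0 ρ := by
      intro p a hp ha
      rw [mem_closedBall, dist_eq_norm, show p + a - x0 = (p - x0) + a by abel]
      linarith [norm_add_le (p - x0) a]
    have hmax2 : ∀ a b : EuclideanSpace ℝ (Fin n), ‖a‖ < ρ / 2 → ‖b‖ < ρ / 2 →
      u (x + a) - u (y + b) - K * (4 * ‖x + a - (y + b)‖ - ‖x + a - (y + b)‖ ^ 2)
        - A * ‖x + a - x0‖ ^ 2 - A * ‖y + b - x0‖ ^ 2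
      ≤ u x - u y - K * (4 * ‖x - y‖ - ‖x - y‖ ^ 2) - A * ‖x - x0‖ ^ 2 - A * ‖y - x0‖ ^ 2 := by
      intro a b ha hb
      exact hmax (a := (x + a, y + b)) ⟨hin x a hxr ha, hin y b hyr hb⟩
    have L := lap_comp cx cy hne (half_pos hρ) hmax2
    have N := frac_comp hn hs hInt cx (by simpa using (mem_ball_zero_iff.1 hxB).le) cy
      (mem_ball_zero_iff.1 hyB).le hA.le hρ hρ1 (by linarith) (by
        intro z hz
        have m1 := hmax2 z z hz hz
        have m2 := hmax2 (-z) (-z) (by rwa [norm_neg]) (by rwa [norm_neg])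
        rw [add_sub_add_right_eq_sub] at m1 m2
        have par : ∀ p : EuclideanSpace ℝ (Fin n),
            ‖p + z - x0‖ ^ 2 + ‖p + -z - x0‖ ^ 2 = 2 * ‖p - x0‖ ^ 2 + 2 * ‖z‖ ^ 2 := by
          intro p
          have := parallelogram_law_with_norm ℝ (p - x0) z
          rw [show p + z - x0 = p - x0 + z by abel, show p + -z - x0 = p - x0 - z by abel]
          simp only [pow_two]
          linarith
        have p1 : A * (‖x + z - x0‖ ^ 2 + ‖x + -z - x0‖ ^ 2)
          = A * (2 * ‖x - x0‖ ^ 2 + 2 * ‖z‖ ^ 2) := by rw [par]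
        have p2 : A * (‖y + z - x0‖ ^ 2 + ‖y + -z - x0‖ ^ 2)
          = A * (2 * ‖y - x0‖ ^ 2 + 2 * ‖z‖ ^ 2) := by rw [par]
        rw [sub_eq_add_neg x z, sub_eq_add_neg y z]
        linarith)
    have e1 := heq x hxB
    have e2 := heq y hyB
    have e3 := hf x hxB y hyB
    rw [← hcd, ← hCsd, ← hId] at N
    have k1 : 8 * K ≤ F + 4 * n * A + 2 * c * Cs * A
        + 4 * c * I * (3 / ρ) ^ ((n : ℝ) + 2 * s) := by linarith
    have k2 : 4 * n * A ≤ 4 * n * (8 * M * T) := by gcongr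
    have k3 : 2 * c * Cs * A ≤ 2 * c * Cs * (8 * M * T) := by gcongr
    have k4 : 4 * c * I * (3 / ρ) ^ ((n : ℝ) + 2 * s) ≤ 4 * c * I * (3 ^ (n + 2) * T) := by gcongr
    have k5 : F ≤ T * F := le_mul_of_one_le_left hF hT1
    have k6 : K = T * F + 4 * n * (8 * M * T) + 2 * c * Cs * (8 * M * T)
        + 4 * c * I * (3 ^ (n + 2) * T)
        + T * ((M + I) + (32 * n + 16 * c * Cs) * (I + F) + 4 * c * 3 ^ (n + 2) * (M + F)) := by
      rw [hKd, hC1d]; ring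
    have k7 : 0 ≤ T * ((M + I) + (32 * n + 16 * c * Cs) * (I + F)
      + 4 * c * 3 ^ (n + 2) * (M + F)) := by positivity
    linarith
  intro x hx
  have a1 := main x hx x0 hx0
  have a2 := main x0 hx0 x hx
  simp only [hΦ, sub_self, norm_zero] at a1 a2
  rw [norm_sub_rev x0 x] at a2
  have hd1 : ‖x - x0‖ ≤ 1 := by rw [← dist_eq_norm]; exact (mem_closedBall.1 hx).trans hρ1
  have hd0 := norm_nonneg (x - x0)
  generalize ‖x - x0‖ = d at *
  have g0 : 0 ≤ K * d ^ 2 := by positivity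
  have g1 : A * d ^ 2 ≤ 8 * M * T * d := by
    have : d ^ 2 ≤ d := by nlinarith
    exact mul_le_mul hAT this (by positivity) (by positivity)
  have g2 : (4 * C1 + 8) / ρ ^ (n + 2) * (M + I + F) * d
      = 4 * K * d + 8 * M * T * d + 8 * T * (I + F) * d := by
    rw [hKd, hT]; ring
  have g3 : 0 ≤ 8 * T * (I + F) * d := by positivity
  rw [g2, abs_le]
  constructor <;> linarith

lemma sup_bound {n : ℕ} (hn : 1 ≤ n) {s : ℝ} (hs : s ∈ Ioo (0 : ℝ) 1) :
    ∃ C : ℝ, 0 < C ∧ ∀ u f : EuclideanSpace ℝ (Fin n) → ℝ,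
      ContDiffOn ℝ 2 u (ball (0 : EuclideanSpace ℝ (Fin n)) 1) →
      Integrable (fun y : EuclideanSpace ℝ (Fin n) => u y / (1 + ‖y‖ ^ ((n : ℝ) + 2 * s))) →
      (∀ x ∈ ball (0 : EuclideanSpace ℝ (Fin n)) 1, -lap n u x + fracLap n s u x = f x) →
      ∀ F : ℝ, 0 ≤ F → (∀ x ∈ ball (0 : EuclideanSpace ℝ (Fin n)) 1,
        ∀ y ∈ ball (0 : EuclideanSpace ℝ (Fin n)) 1, f x - f y ≤ F) →
      ∀ x : EuclideanSpace ℝ (Fin n), ‖x‖ ≤ 3 / 4 → |u x| ≤ C *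
          ((∫ z : EuclideanSpace ℝ (Fin n), |u z| / (1 + ‖z‖ ^ ((n : ℝ) + 2 * s))) + F) := by
  obtain ⟨C, hC, hlip⟩ := lip_pos hn hs
  set m := (n + 2) * n with hm
  have hm0 : m ≠ 0 := by positivity
  set V := volume.real (ball (0 : EuclideanSpace ℝ (Fin n)) 1) with hV
  have hV0 : 0 < V := by
    rw [hV, measureReal_def]
    exact ENNReal.toReal_pos (measure_ball_pos _ _ one_pos).ne' measure_ball_lt_top.ne
  have hC0 : 0 < C := by linarith
  set C' : ℝ := 2 ^ m * (1 + 4 * (2 ^ (m + 1) * C) ^ n / V) with hC'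
  have hC'0 : 0 < C' := by positivity
  clear_value V C'
  refine ⟨8 ^ m * C', by positivity, ?_⟩
  intro u f hu hInt heq F hF hf
  have hl := hlip u f hu hInt heq F hF hf
  have hW := weight_int hInt
  set I := ∫ z : EuclideanSpace ℝ (Fin n), |u z| / (1 + ‖z‖ ^ ((n : ℝ) + 2 * s)) with hId
  have hI : 0 ≤ I := integral_nonneg fun z => by positivity
  clear_value I
  have hsub : closedBall (0 : EuclideanSpace ℝ (Fin n)) (7 / 8) ⊆ ball 0 1 :=
    closedBall_subset_ball (by norm_num)
  have hcont : ContinuousOn (fun x : EuclideanSpace ℝ (Fin n) => (7 / 8 - ‖x‖) ^ m * |u x|)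
      (closedBall 0 (7 / 8)) := by
    refine ContinuousOn.mul (Continuous.continuousOn (by fun_prop)) ?_
    exact (hu.continuousOn.mono hsub).abs
  obtain ⟨x0, hx0, hmax⟩ := (isCompact_closedBall (0 : EuclideanSpace ℝ (Fin n)) (7 / 8)).exists_isMaxOn
    ⟨0, by simp; norm_num⟩ hcont
  have hx0' : ‖x0‖ ≤ 7 / 8 := by simpa using hx0
  have key : (7 / 8 - ‖x0‖) ^ m * |u x0| ≤ C' * (I + F) := by
    rcases hx0'.eq_or_lt with h | hlt
    · rw [h, sub_self, zero_pow hm0, zero_mul]; positivity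
    rcases (abs_nonneg (u x0)).eq_or_lt with h | hU
    · rw [← h, mul_zero]; positivity
    set U := |u x0| with hUd
    obtain ⟨ρ, hρd⟩ : ∃ ρ, ρ = (7 / 8 - ‖x0‖) / 2 := ⟨_, rfl⟩
    have hρ : 0 < ρ := by linarith
    have hρ1 : ρ ≤ 1 := by linarith [norm_nonneg x0]
    have hd2 : 7 / 8 - ‖x0‖ = 2 * ρ := by linarith
    have hnorm : ∀ x ∈ closedBall x0 ρ, ‖x‖ ≤ 7 / 8 - ρ := by
      intro x hx
      rw [mem_closedBall, dist_eq_norm] at hx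
      have := norm_le_norm_add_norm_sub' x x0
      linarith
    have hbound : ∀ x ∈ closedBall x0 ρ, |u x| ≤ 2 ^ m * U := by
      intro x hx
      have h1 := hnorm x hx
      have h2 : (7 / 8 - ‖x‖) ^ m * |u x| ≤ (7 / 8 - ‖x0‖) ^ m * U :=
        hmax (by simp; linarith)
      rw [hd2, mul_pow] at h2
      have h3 : ρ ^ m * |u x| ≤ (7 / 8 - ‖x‖) ^ m * |u x| := by
        gcongr; linarith
      have h4 : ρ ^ m * |u x| ≤ ρ ^ m * (2 ^ m * U) := by linarith
      exact le_of_mul_le_mul_left h4 (by positivity)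
    have hsub2 : closedBall x0 ρ ⊆ ball (0 : EuclideanSpace ℝ (Fin n)) 1 := by
      intro x hx
      rw [mem_ball_zero_iff]; linarith [hnorm x hx]
    have hL := hl x0 ρ (2 ^ m * U) hρ hρ1 (by positivity) hsub2 hbound
    obtain ⟨ε, hεd⟩ : ∃ ε, ε = ρ ^ (n + 2) / (2 ^ (m + 1) * C) := ⟨_, rfl⟩
    have hε : 0 < ε := by rw [hεd]; positivity
    have hρε : ρ ^ (n + 2) = ε * (2 ^ (m + 1) * C) := by rw [hεd]; field_simp
    have h2m : (1 : ℝ) ≤ 2 ^ m := one_le_pow₀ (by norm_num)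
    have hερ : ε ≤ ρ := by
      rw [hεd, div_le_iff₀ (by positivity)]
      have h1 : ρ ^ (n + 2) ≤ ρ := pow_le_of_le_one hρ.le hρ1 (by omega)
      have h2 : (1:ℝ) ≤ 2 ^ (m + 1) * C := by
        have : (1:ℝ) ≤ 2 ^ (m + 1) := one_le_pow₀ (by norm_num)
        nlinarith
      nlinarith
    set J := I + F with hJ
    have hJ0 : 0 ≤ J := by positivity
    have hlow : ∀ x ∈ ball x0 ε, (U - J) / 4 ≤ |u x| / (1 + ‖x‖ ^ ((n : ℝ) + 2 * s)) := by
      intro x hx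
      have hxd : ‖x - x0‖ ≤ ε := by rw [← dist_eq_norm]; exact (mem_ball.1 hx).le
      have hxc : x ∈ closedBall x0 ρ := ball_subset_closedBall (ball_subset_ball hερ hx)
      have h1 := hL x hxc
      have h2 : C / ρ ^ (n + 2) * (2 ^ m * U + I + F) * ‖x - x0‖
          ≤ C / ρ ^ (n + 2) * (2 ^ m * U + I + F) * ε := by gcongr
      have h3 : C / ρ ^ (n + 2) * (2 ^ m * U + I + F) * ε = U / 2 + J / (2 * 2 ^ m) := by
        rw [hρε, pow_succ, hJ]; field_simp; ring
      have h4 : J / (2 * 2 ^ m) ≤ J / 2 :=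
        div_le_div_of_nonneg_left hJ0 (by norm_num) (by linarith)
      have h5 : U - |u x| ≤ |u x - u x0| := by
        rw [abs_sub_comm]; exact abs_sub_abs_le_abs_sub _ _
      have h6 : (U - J) / 2 ≤ |u x| := by linarith
      have h7 : ‖x‖ ^ ((n : ℝ) + 2 * s) ≤ 1 :=
        Real.rpow_le_one (norm_nonneg _) (mem_ball_zero_iff.1 (hsub2 hxc)).le
          (by have := hs.1; positivity)
      have h8 : |u x| / 2 ≤ |u x| / (1 + ‖x‖ ^ ((n : ℝ) + 2 * s)) :=
        div_le_div_of_nonneg_left (abs_nonneg _) (by positivity) (by linarith)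
      linarith
    have hvol : volume.real (ball x0 ε) = ε ^ n * V := by
      rw [hV, measureReal_def, measureReal_def, Measure.addHaar_ball_of_pos _ _ hε, ENNReal.toReal_mul,
        ENNReal.toReal_ofReal (by positivity)]
      simp
    have hInt2 : ε ^ n * V * ((U - J) / 4) ≤ I := by
      have h1 : ∫ x in ball x0 ε, (U - J) / 4 ≤
          ∫ x in ball x0 ε, |u x| / (1 + ‖x‖ ^ ((n : ℝ) + 2 * s)) :=
        setIntegral_mono_on (integrableOn_const measure_ball_lt_top.ne) hW.integrableOn
          measurableSet_ball hlow
      rw [setIntegral_const, hvol, smul_eq_mul] at h1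
      rw [hId]
      refine h1.trans (setIntegral_le_integral hW (Filter.Eventually.of_forall fun x => ?_))
      show 0 ≤ |u x| / (1 + ‖x‖ ^ ((n : ℝ) + 2 * s))
      positivity
    have hUle : U ≤ J + 4 * J / (ε ^ n * V) := by
      have hIJ : I ≤ J := by linarith
      have hpos : 0 < ε ^ n * V := by positivity
      have : (U - J) ≤ 4 * J / (ε ^ n * V) := by
        rw [le_div_iff₀ hpos]; linarith
      linarith
    have hρm : ρ ^ m = ε ^ n * (2 ^ (m + 1) * C) ^ n := by
      rw [hm, pow_mul, hρε, mul_pow]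
    have hρm1 : ρ ^ m ≤ 1 := pow_le_one₀ hρ.le hρ1
    rw [hd2, mul_pow]
    calc 2 ^ m * ρ ^ m * U ≤ 2 ^ m * ρ ^ m * (J + 4 * J / (ε ^ n * V)) := by gcongr
      _ = 2 ^ m * (ρ ^ m * J + ρ ^ m * (4 * J / (ε ^ n * V))) := by ring
      _ ≤ 2 ^ m * (1 * J + ρ ^ m * (4 * J / (ε ^ n * V))) := by gcongr
      _ = C' * J := by
        rw [hρm, hC']; field_simp
  intro x hx
  have h1 : (7 / 8 - ‖x‖) ^ m * |u x| ≤ (7 / 8 - ‖x0‖) ^ m * |u x0| := hmax (by simp; linarith)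
  have h2 : (1 / 8 : ℝ) ^ m * |u x| ≤ (7 / 8 - ‖x‖) ^ m * |u x| := by
    gcongr; linarith
  have h3 : (1 / 8 : ℝ) ^ m * |u x| ≤ C' * (I + F) := by linarith
  rw [one_div, inv_pow, inv_mul_le_iff₀ (by positivity)] at h3
  linarith

/-- Interior Hölder estimate on `B_{1/2}`: if `-Δu + (-Δ)ˢu = f` in `B₁`, then
`[u]_{C^α(B_{1/2})} ≤ N‖u‖_{L₁(ℝⁿ,ω)} + N osc_{B₁} f`, with `N = N(n,s,α)`. -/
theorem stmt6 (n : ℕ) (hn : 1 ≤ n) (s α : ℝ) (hs : s ∈ Ioo (0 : ℝ) 1)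
    (hα : α ∈ Ioo (0 : ℝ) (min 1 (2 * s))) :
    ∃ N : ℝ, 0 < N ∧
      ∀ u f : EuclideanSpace ℝ (Fin n) → ℝ,
        ContDiffOn ℝ 2 u (ball (0 : EuclideanSpace ℝ (Fin n)) 1) →
        Integrable (fun y : EuclideanSpace ℝ (Fin n) =>
          u y / (1 + ‖y‖ ^ ((n : ℝ) + 2 * s))) →
        (∃ M : ℝ, ∀ x ∈ ball (0 : EuclideanSpace ℝ (Fin n)) 1, |f x| ≤ M) →
        (∀ x ∈ ball (0 : EuclideanSpace ℝ (Fin n)) 1,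
          -lap n u x + fracLap n s u x = f x) →
        ∀ x ∈ ball (0 : EuclideanSpace ℝ (Fin n)) (1 / 2),
        ∀ y ∈ ball (0 : EuclideanSpace ℝ (Fin n)) (1 / 2),
          |u x - u y| ≤
            (N * (∫ z : EuclideanSpace ℝ (Fin n), |u z| / (1 + ‖z‖ ^ ((n : ℝ) + 2 * s)))
              + N * (sSup (f '' ball (0 : EuclideanSpace ℝ (Fin n)) 1)
                  - sInf (f '' ball (0 : EuclideanSpace ℝ (Fin n)) 1)))
              * ‖x - y‖ ^ α := by
  obtain ⟨C, hC, hlip⟩ := lip_pos hn hs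
  obtain ⟨C2, hC2, hsup⟩ := sup_bound hn hs
  have hC0 : 0 < C := by linarith
  have hα1 : α ≤ 1 := (hα.2.trans_le (min_le_left _ _)).le
  refine ⟨C * 4 ^ (n + 2) * (C2 + 1) + 8 * C2, by positivity, ?_⟩
  intro u f hu hInt hbd heq x hx y hy
  obtain ⟨B, hB⟩ := hbd
  have hba : BddAbove (f '' ball (0 : EuclideanSpace ℝ (Fin n)) 1) :=
    ⟨B, by rintro _ ⟨z, hz, rfl⟩; exact (abs_le.1 (hB z hz)).2⟩
  have hbb : BddBelow (f '' ball (0 : EuclideanSpace ℝ (Fin n)) 1) :=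
    ⟨-B, by rintro _ ⟨z, hz, rfl⟩; exact (abs_le.1 (hB z hz)).1⟩
  set F := sSup (f '' ball (0 : EuclideanSpace ℝ (Fin n)) 1)
    - sInf (f '' ball (0 : EuclideanSpace ℝ (Fin n)) 1) with hFd
  have hf : ∀ x ∈ ball (0 : EuclideanSpace ℝ (Fin n)) 1,
        ∀ y ∈ ball (0 : EuclideanSpace ℝ (Fin n)) 1, f x - f y ≤ F := by
    intro x hx y hy
    exact sub_le_sub (le_csSup hba (mem_image_of_mem f hx)) (csInf_le hbb (mem_image_of_mem f hy))
  have hF : 0 ≤ F := by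
    have h0 : (0 : EuclideanSpace ℝ (Fin n)) ∈ ball (0 : EuclideanSpace ℝ (Fin n)) 1 := by simp
    simpa using hf 0 h0 0 h0
  clear_value F
  have hl := hlip u f hu hInt heq F hF hf
  have hsu := hsup u f hu hInt heq F hF hf
  set I := ∫ z : EuclideanSpace ℝ (Fin n), |u z| / (1 + ‖z‖ ^ ((n : ℝ) + 2 * s)) with hId
  have hI : 0 ≤ I := integral_nonneg fun z => by positivity
  clear_value I
  rw [mem_ball_zero_iff] at hx hy
  have hJ : 0 ≤ I + F := by positivity
  have hd1 : ‖x - y‖ ≤ 1 := by linarith [norm_sub_le x y]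
  have hd0 := norm_nonneg (x - y)
  have hpow : ‖x - y‖ ≤ ‖x - y‖ ^ α := by
    have := Real.rpow_le_rpow_of_exponent_ge' hd0 hd1 hα.1.le hα1
    rwa [Real.rpow_one] at this
  have hN : |u x - u y| ≤ (C * 4 ^ (n + 2) * (C2 + 1) + 8 * C2) * (I + F) * ‖x - y‖ := by
    have p1 : 0 ≤ C * 4 ^ (n + 2) * (C2 + 1) * (I + F) * ‖x - y‖ := by positivity
    have p2 : 0 ≤ 8 * C2 * (I + F) * ‖x - y‖ := by positivity
    have p3 : (C * 4 ^ (n + 2) * (C2 + 1) + 8 * C2) * (I + F) * ‖x - y‖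
      = C * 4 ^ (n + 2) * (C2 + 1) * (I + F) * ‖x - y‖ + 8 * C2 * (I + F) * ‖x - y‖ := by ring
    rw [p3]
    by_cases hxy : ‖x - y‖ ≤ 1 / 4
    · have hnorm : ∀ z ∈ closedBall y (1 / 4), ‖z‖ ≤ 3 / 4 := by
        intro z hz
        rw [mem_closedBall, dist_eq_norm] at hz
        linarith [norm_le_norm_add_norm_sub' z y]
      have hsub : closedBall y (1 / 4) ⊆ ball (0 : EuclideanSpace ℝ (Fin n)) 1 := by
        intro z hz
        rw [mem_ball_zero_iff]; linarith [hnorm z hz]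
      have hη : |u x - u y| ≤ C * 4 ^ (n + 2) * (C2 + 1) * (I + F) * ‖x - y‖ := by
        refine le_of_forall_pos_le_add fun δ hδ => ?_
        obtain ⟨η, hηd⟩ : ∃ η, η = δ / (C * 4 ^ (n + 2)) := ⟨_, rfl⟩
        have hη : 0 < η := by rw [hηd]; positivity
        have hηδ : C * 4 ^ (n + 2) * η = δ := by rw [hηd]; field_simp
        have := hl y (1 / 4) (C2 * (I + F) + η) (by norm_num) (by norm_num) (by positivity) hsub
          (fun z hz => by linarith [hsu z (hnorm z hz)]) x
          (by rwa [mem_closedBall, dist_eq_norm])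
        refine this.trans ?_
        have e : C / (1 / 4) ^ (n + 2) * (C2 * (I + F) + η + I + F) * ‖x - y‖
          = C * 4 ^ (n + 2) * (C2 + 1) * (I + F) * ‖x - y‖
            + C * 4 ^ (n + 2) * η * ‖x - y‖ := by
          rw [one_div, inv_pow, div_inv_eq_mul]; ring
        rw [e, hηδ]
        have : δ * ‖x - y‖ ≤ δ := mul_le_of_le_one_right hδ.le hd1
        linarith
      linarith
    · push Not at hxy
      have h1 := hsu x (by linarith)
      have h2 := hsu y (by linarith)
      have h3 := abs_sub (u x) (u y)
      have h4 : 0 ≤ C2 * (I + F) := by positivity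
      nlinarith
  have hN0 : 0 ≤ (C * 4 ^ (n + 2) * (C2 + 1) + 8 * C2) * (I + F) := by positivity
  have := mul_le_mul_of_nonneg_left hpow hN0
  rw [← mul_add]
  exact hN.trans this
end
end
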